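/- Fix n ≥ 2 and let N_{U,k}(q) denote the number of isomorphism classes of irreducible finite-dimensional complex representations of GL_n(F_q) of U-rank k. Then for fixed 0 ≤ k < ⌊n/2⌋, N_{U,k}(q) / q^{k+1} → 1 as q → ∞ over prime powers, and for k = ⌊n/2⌋, N_{U,k}(q) / q^{n} → 1 as q → ∞ over prime powers. -/

import Mathlib

open Matrix CategoryTheory
open scoped BigOperators

/-- The reindexing equivalence `Fin (n/2) ⊕ Fin (n − n/2) ≃ Fin n`. -/
def blockEquiv (n : ℕ) : (Fin (n / 2) ⊕ Fin (n - n / 2)) ≃ Fin n :=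
  finSumFinEquiv.trans (finCongr (by omega))

/-- The block unipotent matrix `u(A) = [[I, A], [0, I]]`, viewed as an `n × n` matrix. -/
def uMat (F : Type) [Field F] (n : ℕ)
    (A : Matrix (Fin (n / 2)) (Fin (n - n / 2)) F) : Matrix (Fin n) (Fin n) F :=
  (Matrix.fromBlocks 1 A 0 1).submatrix (blockEquiv n).symm (blockEquiv n).symm

lemma uMat_det (F : Type) [Field F] [Fintype F] (n : ℕ)
    (A : Matrix (Fin (n / 2)) (Fin (n - n / 2)) F) : (uMat F n A).det = 1 := by
  unfold uMat
  rw [Matrix.det_submatrix_equiv_self, Matrix.det_fromBlocks_zero₂₁]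
  simp

/-- The block unipotent matrix `u(A)` as an element of `GL_n(F_q)`; these form the abelian
subgroup `U`. -/
noncomputable def uGL (F : Type) [Field F] [Fintype F] (n : ℕ)
    (A : Matrix (Fin (n / 2)) (Fin (n - n / 2)) F) : GL (Fin n) F :=
  Matrix.GeneralLinearGroup.mkOfDetNeZero (uMat F n A)
    (by rw [uMat_det]; exact one_ne_zero)

/-- The character `ψ_B` of `U` occurs in `ρ|_U`, i.e. its multiplicity
`(1/#U)·Σ_A χ_ρ(u(A)) ψ(−trace(Bᵀ A))` is nonzero. -/
noncomputable def OccursInRes (n : ℕ) (F : Type) [Field F] [Fintype F] (ψ : AddChar F ℂ)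
    (ρ : FDRep ℂ (GL (Fin n) F)) (B : Matrix (Fin (n / 2)) (Fin (n - n / 2)) F) : Prop :=
  (∑ A : Matrix (Fin (n / 2)) (Fin (n - n / 2)) F,
      ρ.character (uGL F n A) * ψ (-(Bᵀ * A).trace)) ≠ 0

/-- `ρ` has `U`-rank `k`: some `ψ_B` with `rank B = k` occurs in `ρ|_U`, and no `ψ_B` with
`rank B > k` occurs. -/
noncomputable def HasURank (n : ℕ) (F : Type) [Field F] [Fintype F] (ψ : AddChar F ℂ)
    (ρ : FDRep ℂ (GL (Fin n) F)) (k : ℕ) : Prop :=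
  (∃ B : Matrix (Fin (n / 2)) (Fin (n - n / 2)) F, B.rank = k ∧ OccursInRes n F ψ ρ B) ∧
  (∀ B : Matrix (Fin (n / 2)) (Fin (n - n / 2)) F, k < B.rank → ¬ OccursInRes n F ψ ρ B)

/-- `N_{U,k}(q)`: the number of isomorphism classes of irreducible representations of
`GL_n(F_q)` of `U`-rank `k`. -/
noncomputable def URankIsoClasses (n : ℕ) (F : Type) [Field F] [Fintype F]
    (ψ : AddChar F ℂ) (k : ℕ) : ℕ :=
  Nat.card (Quotient (Setoid.mk
    (fun ρ σ : {ρ : FDRep ℂ (GL (Fin n) F) // Simple ρ ∧ HasURank n F ψ ρ k} =>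
      Nonempty (ρ.1 ≅ σ.1))
    ⟨fun ρ => ⟨Iso.refl _⟩,
     fun h => h.elim fun i => ⟨i.symm⟩,
     fun h h' => h.elim fun i => h'.elim fun j => ⟨i.trans j⟩⟩))

set_option linter.unusedSectionVars false

namespace URank
open scoped Classical

section Schur
variable {G : Type} [Group G]

lemma simple_nontrivial (V : FDRep ℂ G) [Simple V] : Nontrivial V := by
  by_contra h
  rw [not_nontrivial_iff_subsingleton] at h
  apply id_nonzero V
  ext x
  exact Subsingleton.elim _ _

lemma simple_finrank_pos (V : FDRep ℂ G) [Simple V] : 0 < Module.finrank ℂ V := by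
  have := simple_nontrivial V
  exact Module.finrank_pos

lemma schur_scalar (V : FDRep ℂ G) [Simple V] (T : V →ₗ[ℂ] V)
    (hT : ∀ g, T ∘ₗ V.ρ g = V.ρ g ∘ₗ T) : ∃ c : ℂ, T = c • LinearMap.id := by
  have h1 : Module.finrank ℂ (Representation.linHom V.ρ V.ρ).invariants = 1 := by
    rw [(Representation.linHom.invariantsEquivFDRepHom V V).finrank_eq]
    exact finrank_endomorphism_simple_eq_one ℂ V
  have hmem : ∀ S : V →ₗ[ℂ] V, (∀ g, S ∘ₗ V.ρ g = V.ρ g ∘ₗ S) →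
      S ∈ (Representation.linHom V.ρ V.ρ).invariants := by
    intro S hS g
    rw [Representation.linHom_apply, ← LinearMap.comp_assoc, ← hS g, LinearMap.comp_assoc]
    have : V.ρ g ∘ₗ V.ρ g⁻¹ = LinearMap.id := by
      change V.ρ g * V.ρ g⁻¹ = 1
      rw [← map_mul, mul_inv_cancel, map_one]
    rw [this, LinearMap.comp_id]
  let I : (Representation.linHom V.ρ V.ρ).invariants := ⟨LinearMap.id, hmem _ (fun g => rfl)⟩
  have hI : I ≠ 0 := by
    intro h
    have h2 : (LinearMap.id : V →ₗ[ℂ] V) = 0 := congrArg Subtype.val h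
    have := simple_nontrivial V
    obtain ⟨x, hx⟩ := exists_ne (0 : V)
    exact hx (by simpa using LinearMap.congr_fun h2 x)
  obtain ⟨c, hc⟩ := (finrank_eq_one_iff_of_nonzero' I hI).mp h1 ⟨T, hmem T hT⟩
  exact ⟨c, (congrArg Subtype.val hc).symm⟩

lemma class_sum_comm [Fintype G] (V : FDRep ℂ G) (φ : G → ℂ) (hφ : ∀ g h, φ (h * g * h⁻¹) = φ g)
    (x : G) : (∑ g, φ g • V.ρ g) ∘ₗ V.ρ x = V.ρ x ∘ₗ (∑ g, φ g • V.ρ g) := by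
  change (∑ g, φ g • V.ρ g) * V.ρ x = V.ρ x * (∑ g, φ g • V.ρ g)
  rw [Finset.sum_mul, Finset.mul_sum]
  refine Fintype.sum_equiv (MulAut.conj x⁻¹).toEquiv _ _ (fun g => ?_)
  have h1 : φ (x⁻¹ * (g * x)) = φ g := by simpa [mul_assoc] using hφ g x⁻¹
  simp [h1, ← map_mul, mul_assoc]

open scoped Classical in
lemma char_conv [Fintype G] (V W : FDRep ℂ G) [Simple V] [Simple W] :
    ∑ g, V.character g⁻¹ • W.ρ g =
      (if Nonempty (W ≅ V) then (Fintype.card G : ℂ) / Module.finrank ℂ W else 0) •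
        LinearMap.id := by
  have : Invertible (Nat.card G : ℂ) := invertibleOfNonzero (by simp)
  obtain ⟨c, hc⟩ := schur_scalar W (∑ g, V.character g⁻¹ • W.ρ g)
    (class_sum_comm W (fun g => V.character g⁻¹) (fun g h => by
      have := FDRep.char_conj V g⁻¹ h
      simpa [mul_assoc] using this))
  have hd : (Module.finrank ℂ W : ℂ) ≠ 0 := by
    exact_mod_cast (simple_finrank_pos W).ne'
  have ht := congrArg (LinearMap.trace ℂ W) hc
  have ho := FDRep.char_orthonormal W V
  simp only [map_sum, map_smul, LinearMap.trace_id, smul_eq_mul] at ht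
  have h3 : ∑ g, W.character g * V.character g⁻¹ = c * Module.finrank ℂ W := by
    rw [← ht]
    exact Finset.sum_congr rfl fun g _ => mul_comm _ _
  rw [h3] at ho
  rw [hc]
  congr 1
  have hG : (Nat.card G : ℂ) ≠ 0 := by simp
  have hG' : (Fintype.card G : ℂ) ≠ 0 := by simp
  rw [Nat.card_eq_fintype_card] at ho
  split_ifs at ho ⊢ with h
  · field_simp at ho ⊢
    linear_combination ho
  · field_simp at ho
    simpa [hd] using ho

lemma class_sum_smul_eq_zero [Fintype G] (φ : G → ℂ) (hφ : ∀ g h, φ (h * g * h⁻¹) = φ g)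
    (h0 : ∀ V : FDRep ℂ G, Simple V → ∑ g, φ g * V.character g = 0)
    (M : Type) [AddCommGroup M] [Module ℂ M] [Module (MonoidAlgebra ℂ G) M]
    [IsScalarTower ℂ (MonoidAlgebra ℂ G) M]
    [hs : IsSimpleModule (MonoidAlgebra ℂ G) M] (m : M) :
    (∑ g, MonoidAlgebra.single g (φ g) : MonoidAlgebra ℂ G) • m = 0 := by
  have : Invertible (Nat.card G : ℂ) := invertibleOfNonzero (by simp)
  have hfinM : Module.Finite ℂ M := Module.Finite.trans (MonoidAlgebra ℂ G) _
  let σ : Representation ℂ G M := Representation.ofModule' M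
  have hσ : ∀ (g : G) (x : M), σ g x = (MonoidAlgebra.single g 1 : MonoidAlgebra ℂ G) • x := by
    intro g x
    simp [σ, Representation.ofModule']
  have hstab : ∀ (U : Submodule ℂ M), (∀ g, ∀ x ∈ U, σ g x ∈ U) → U = ⊥ ∨ U = ⊤ := by
    intro U hU
    let U' : Submodule (MonoidAlgebra ℂ G) M :=
      { U with
        smul_mem' := fun a x hx => by
          induction a using MonoidAlgebra.induction_on with
          | of g => simpa [hσ] using hU g x hx
          | add a b ha hb => rw [add_smul]; exact U.add_mem ha hb
          | smul r a ha => rw [smul_assoc]; exact U.smul_mem r ha }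
    have h1 : ∀ x, x ∈ U' ↔ x ∈ U := fun x => Iff.rfl
    rcases eq_bot_or_eq_top U' with h | h
    · left
      ext x
      rw [← h1, h]; simp
    · right
      ext x
      rw [← h1, h]; simp
  have hirr : σ.IsIrreducible := by
    have : Nontrivial M := IsSimpleModule.nontrivial (MonoidAlgebra ℂ G) M
    refine { exists_pair_ne := ⟨⊥, ⊤, fun h => ?_⟩, eq_bot_or_eq_top := fun U => ?_ }
    · have h' : (⊥ : Submodule ℂ M) = ⊤ := congrArg Subrepresentation.toSubmodule h
      exact bot_ne_top h'
    · exact (hstab U.toSubmodule (fun g x hx => U.apply_mem_toSubmodule g hx)).imp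
        (fun h => Subrepresentation.toSubmodule_injective h)
        (fun h => Subrepresentation.toSubmodule_injective h)
  let V : FDRep ℂ G := FDRep.of σ
  have hV : Simple V := by
    rw [FDRep.simple_iff_char_is_norm_one]
    have := Representation.char_orthonormal σ σ
    rw [if_pos ⟨Representation.Equiv.refl σ⟩] at this
    have hG : (Nat.card G : ℂ) ≠ 0 := by simp
    rw [inv_mul_eq_one₀ hG] at this
    exact this.symm
  obtain ⟨c, hc⟩ := schur_scalar V _ (class_sum_comm V φ hφ)
  have hd : (Module.finrank ℂ V : ℂ) ≠ 0 := by
    exact_mod_cast (simple_finrank_pos V).ne'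
  have hc0 : c = 0 := by
    have ht := congrArg (LinearMap.trace ℂ V) hc
    simp only [map_sum, map_smul, LinearMap.trace_id, smul_eq_mul] at ht
    have := h0 V hV
    unfold FDRep.character at this
    rw [this] at ht
    simpa [hd] using ht.symm
  rw [hc0, zero_smul] at hc
  have h1 := LinearMap.congr_fun hc m
  have h2 : (∑ g, φ g • σ g m) = 0 := by
    have h3 : (∑ g, φ g • V.ρ g) m = ∑ g, φ g • σ g m := by
      rw [LinearMap.sum_apply]; rfl
    rw [← h3, h1]; rfl
  rw [Finset.sum_smul, ← h2]
  refine Finset.sum_congr rfl fun g _ => ?_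
  rw [hσ, ← smul_assoc, MonoidAlgebra.smul_single, smul_eq_mul, mul_one]

lemma class_eq_zero [Fintype G] (φ : G → ℂ) (hφ : ∀ g h, φ (h * g * h⁻¹) = φ g)
    (h0 : ∀ V : FDRep ℂ G, Simple V → ∑ g, φ g * V.character g = 0) : φ = 0 := by
  classical
  have hn : NeZero (Nat.card G : ℂ) := ⟨by simp⟩
  set t : MonoidAlgebra ℂ G := ∑ g, MonoidAlgebra.single g (φ g) with ht
  have hkey : ∀ I : Ideal (MonoidAlgebra ℂ G), I.IsMaximal → t ∈ I := by
    intro I hI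
    have hs : IsSimpleModule (MonoidAlgebra ℂ G) (MonoidAlgebra ℂ G ⧸ I) := by
      rw [isSimpleModule_iff_isCoatom]
      exact hI.out
    have := class_sum_smul_eq_zero φ hφ h0 (MonoidAlgebra ℂ G ⧸ I) (Submodule.Quotient.mk 1)
    rw [← ht, ← Submodule.Quotient.mk_smul, Submodule.Quotient.mk_eq_zero] at this
    simpa using this
  have hz : t = 0 := by
    have : t ∈ Ring.jacobson (MonoidAlgebra ℂ G) := by
      rw [Ring.jacobson_eq_sInf_isMaximal, Submodule.mem_sInf]
      exact fun I hI => hkey I hI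
    rw [IsSemisimpleRing.jacobson_eq_bot] at this
    simpa using this
  ext g
  have := congrArg (fun s : MonoidAlgebra ℂ G => s.coeff g) hz
  simpa [ht, MonoidAlgebra.coeff_sum, Finsupp.single_apply] using this

/-- The matrix form of a finite dimensional representation. -/
noncomputable def toMat (V : FDRep ℂ G) :
    G →* Matrix (Fin (Module.finrank ℂ V)) (Fin (Module.finrank ℂ V)) ℂ :=
  (LinearMap.toMatrixAlgEquiv (Module.finBasis ℂ V)).toMonoidHom.comp V.ρ

lemma toMat_apply (V : FDRep ℂ G) (g : G) :
    toMat V g = LinearMap.toMatrixAlgEquiv (Module.finBasis ℂ V) (V.ρ g) := rfl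

lemma trace_toMat (V : FDRep ℂ G) (g : G) : (toMat V g).trace = V.character g := by
  rw [toMat_apply, FDRep.character, LinearMap.trace_eq_matrix_trace ℂ (Module.finBasis ℂ V)]
  rfl

open scoped Classical in
theorem exists_irreps (G : Type) [Group G] [Fintype G] :
    ∃ (N : ℕ) (d : Fin N → ℕ) (R : ∀ i, G →* Matrix (Fin (d i)) (Fin (d i)) ℂ),
      (∀ i, 0 < d i) ∧
      (∀ i j, ∑ g, (R i g⁻¹).trace • R j g =
        if i = j then ((Fintype.card G : ℂ) / d j) • 1 else 0) ∧
      (∀ φ : G → ℂ, (∀ g h, φ (h * g * h⁻¹) = φ g) →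
        φ ∈ Submodule.span ℂ (Set.range fun i g => (R i g).trace)) ∧
      (∀ (P : (G → ℂ) → Prop) (s : Setoid {V : FDRep ℂ G // Simple V ∧ P V.character}),
        (∀ a b, s a b ↔ Nonempty (a.1 ≅ b.1)) →
        Nat.card (Quotient s) = Nat.card {i // P (fun g => (R i g).trace)}) := by
  let S : Setoid {V : FDRep ℂ G // Simple V} :=
    ⟨fun a b => Nonempty (a.1 ≅ b.1), fun _ => ⟨Iso.refl _⟩, fun ⟨i⟩ => ⟨i.symm⟩,
      fun ⟨i⟩ ⟨j⟩ => ⟨i.trans j⟩⟩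
  have hout : ∀ a b : Quotient S, Nonempty (a.out.1 ≅ b.out.1) ↔ a = b := by
    intro a b
    constructor
    · intro h
      rw [← Quotient.out_eq a, ← Quotient.out_eq b]
      exact Quotient.sound h
    · rintro rfl
      exact ⟨Iso.refl _⟩
  have hG : (Fintype.card G : ℂ) ≠ 0 := by simp
  have hsimple : ∀ a : Quotient S, Simple a.out.1 := fun a => a.out.2
  have horth : ∀ a b : Quotient S, ∑ g, a.out.1.character g⁻¹ * b.out.1.character g =
      if a = b then (Fintype.card G : ℂ) else 0 := by
    intro a b
    have : Invertible (Nat.card G : ℂ) := invertibleOfNonzero (by simp)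
    have := FDRep.char_orthonormal b.out.1 a.out.1
    rw [hout, Nat.card_eq_fintype_card, inv_mul_eq_iff_eq_mul₀ hG] at this
    rw [← Finset.sum_congr rfl fun g _ => mul_comm _ _, this]
    simp [eq_comm]
  have hli : LinearIndependent ℂ (fun a : Quotient S => a.out.1.character) := by
    rw [linearIndependent_iff']
    intro t c hc a ha
    have h1 : ∑ g, a.out.1.character g⁻¹ * (∑ i ∈ t, c i • i.out.1.character) g = 0 := by
      rw [hc]; simp
    simp only [Finset.sum_apply, Pi.smul_apply, smul_eq_mul, Finset.mul_sum] at h1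
    rw [Finset.sum_comm] at h1
    have h2 : ∀ i ∈ t, ∑ g, a.out.1.character g⁻¹ * (c i * i.out.1.character g) =
        c i * if a = i then (Fintype.card G : ℂ) else 0 := by
      intro i _
      rw [← horth, Finset.mul_sum]
      exact Finset.sum_congr rfl fun g _ => by ring
    rw [Finset.sum_congr rfl h2] at h1
    simpa [ha, hG] using h1
  have hfin : Finite (Quotient S) := hli.finite
  obtain ⟨N, ⟨e⟩⟩ := Finite.exists_equiv_fin (Quotient S)
  refine ⟨N, fun i => Module.finrank ℂ (e.symm i).out.1, fun i => toMat (e.symm i).out.1,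
    fun i => ?_, fun i j => ?_, fun φ hφ => ?_, fun P s hs => ?_⟩
  · have := hsimple (e.symm i)
    exact simple_finrank_pos _
  · have := hsimple (e.symm i)
    have := hsimple (e.symm j)
    have h1 := char_conv (e.symm i).out.1 (e.symm j).out.1
    have h2 := congrArg (LinearMap.toMatrixAlgEquiv (Module.finBasis ℂ (e.symm j).out.1)) h1
    rw [map_sum] at h2
    simp only [map_smul, hout, EmbeddingLike.apply_eq_iff_eq] at h2
    simp only [trace_toMat]
    simp only [toMat_apply]
    rw [h2]
    have h3 : (LinearMap.toMatrixAlgEquiv (Module.finBasis ℂ (e.symm j).out.1))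
      LinearMap.id = 1 := map_one _
    rw [h3]
    by_cases hij : i = j
    · simp [hij]
    · simp [hij, Ne.symm hij]
  · simp only [trace_toMat]
    have hclass : ∀ (V : FDRep ℂ G) (g h : G), V.character (h * g * h⁻¹) = V.character g :=
      fun V g h => FDRep.char_conj V g h
    let a : Fin N → ℂ := fun i =>
      (Fintype.card G : ℂ)⁻¹ * ∑ g, φ g * (e.symm i).out.1.character g⁻¹
    have h0 : (fun g => φ g⁻¹ - ∑ i, a i * (e.symm i).out.1.character g⁻¹) = 0 := by
      apply class_eq_zero
      · intro g h
        have : (h * g * h⁻¹)⁻¹ = h * g⁻¹ * h⁻¹ := by group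
        simp only [this, hφ, hclass]
      · intro V hV
        let b : Quotient S := Quotient.mk S ⟨V, hV⟩
        have hb : b.out.1.character = V.character := by
          have : S b.out ⟨V, hV⟩ := Quotient.mk_out (s := S) ⟨V, hV⟩
          obtain ⟨i⟩ := this
          exact FDRep.char_iso i
        rw [← hb]
        simp only [sub_mul, Finset.sum_sub_distrib, Finset.sum_mul]
        rw [Finset.sum_comm]
        have h2 : ∀ i, ∑ g, a i * (e.symm i).out.1.character g⁻¹ * b.out.1.character g =
            a i * if e.symm i = b then (Fintype.card G : ℂ) else 0 := by
          intro i
          rw [← horth, Finset.mul_sum]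
          exact Finset.sum_congr rfl fun g _ => by ring
        rw [Finset.sum_congr rfl fun i _ => h2 i, Finset.sum_eq_single (e b)]
        · have : ∑ g, φ g⁻¹ * b.out.1.character g = ∑ g, φ g * b.out.1.character g⁻¹ :=
            Fintype.sum_equiv (Equiv.inv G) _ _ (fun g => by simp)
          simp only [a, Equiv.symm_apply_apply, if_true]
          rw [this]
          field_simp
          simp
        · intro i _ hi
          rw [if_neg, mul_zero]
          intro h
          exact hi (by rw [← h, Equiv.apply_symm_apply])
        · simp
    have h1 : φ = ∑ i, a i • (e.symm i).out.1.character := by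
      ext g
      have := congrFun h0 g⁻¹
      simp only [inv_inv, Pi.zero_apply, sub_eq_zero] at this
      rw [this]
      simp
    rw [h1]
    exact Submodule.sum_mem _ fun i _ => Submodule.smul_mem _ _ (Submodule.subset_span ⟨i, rfl⟩)
  · simp only [trace_toMat]
    refine Nat.card_congr (Equiv.symm (Equiv.ofBijective
      (fun i => Quotient.mk s ⟨(e.symm i.1).out.1, hsimple _, i.2⟩) ⟨?_, ?_⟩))
    · intro i j hij
      have := (hs _ _).mp (Quotient.exact hij)
      rw [hout] at this
      exact Subtype.ext (e.symm.injective this)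
    · intro x
      induction x using Quotient.inductionOn with
      | h V =>
        obtain ⟨V, hV, hP⟩ := V
        let b : Quotient S := Quotient.mk S ⟨V, hV⟩
        have hb' : Nonempty (b.out.1 ≅ V) := Quotient.mk_out (s := S) ⟨V, hV⟩
        have hb : b.out.1.character = V.character := by
          obtain ⟨i⟩ := hb'
          exact FDRep.char_iso i
        refine ⟨⟨e b, ?_⟩, Quotient.sound ?_⟩
        · simp only [Equiv.symm_apply_apply]
          change P b.out.1.character
          rw [hb]
          exact hP
        · refine (hs _ _).mpr ?_
          simpa using hb'

end Schur

section LinAlg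
variable {F : Type} [Field F] {ι κ σ : Type} [Fintype ι] [DecidableEq ι] [Fintype κ] [DecidableEq κ]

/-- A matrix with a left inverse can be completed to an invertible matrix, compatibly with the given
left inverse. -/
lemma exists_split (W : Matrix ι κ F) (W' : Matrix κ ι F) (h : W' * W = 1) (s : ℕ)
    (hs : Fintype.card κ + s = Fintype.card ι) :
    ∃ (U : Matrix ι (Fin s) F) (U' : Matrix (Fin s) ι F),
      U' * U = 1 ∧ W' * U = 0 ∧ U' * W = 0 ∧ W * W' + U * U' = 1 := by
  have hsurj : Function.Surjective W'.mulVecLin := by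
    intro x
    exact ⟨W *ᵥ x, by simp [Matrix.mulVec_mulVec, h]⟩
  have hK : Module.finrank F (LinearMap.ker W'.mulVecLin) = s := by
    have h1 := LinearMap.finrank_range_add_finrank_ker W'.mulVecLin
    rw [LinearMap.range_eq_top.mpr hsurj] at h1
    simp at h1
    omega
  let b := Module.finBasisOfFinrankEq F (LinearMap.ker W'.mulVecLin) hK
  let U : Matrix ι (Fin s) F := Matrix.of fun i k => (b k : ι → F) i
  have hU : W' * U = 0 := by
    ext i k
    have h2 : W'.mulVecLin (b k : ι → F) = 0 := (b k).2
    exact congrFun h2 i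
  have hUinj : ∀ x, U *ᵥ x = 0 → x = 0 := by
    intro x hx
    have h2 : ∑ k, x k • b k = 0 := by
      apply Subtype.ext
      ext i
      have := congrFun hx i
      simp only [Matrix.mulVec, dotProduct, U, Matrix.of_apply, Pi.zero_apply] at this
      simp only [Submodule.coe_sum, Submodule.coe_smul, Finset.sum_apply, Pi.smul_apply,
        smul_eq_mul, Submodule.coe_zero, Pi.zero_apply]
      rw [← this]
      exact Finset.sum_congr rfl fun k _ => mul_comm _ _
    ext k
    exact Fintype.linearIndependent_iff.mp b.linearIndependent x h2 k
  let P : Matrix ι (κ ⊕ Fin s) F := Matrix.fromCols W U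
  have hPinj : Function.Injective P.mulVecLin := by
    rw [← LinearMap.ker_eq_bot, LinearMap.ker_eq_bot']
    intro x hx
    have h3 : W *ᵥ (x ∘ Sum.inl) + U *ᵥ (x ∘ Sum.inr) = 0 := by
      rw [← Matrix.fromCols_mulVec]; exact hx
    have h4 : x ∘ Sum.inl = 0 := by
      have := congrArg (fun v => W' *ᵥ v) h3
      simpa [Matrix.mulVec_add, Matrix.mulVec_mulVec, h, hU] using this
    have h5 : x ∘ Sum.inr = 0 := by
      apply hUinj
      simpa [h4] using h3
    ext (i | i)
    · exact congrFun h4 i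
    · exact congrFun h5 i
  have hcard : Fintype.card (κ ⊕ Fin s) = Fintype.card ι := by simpa using hs
  obtain ⟨Q, hQ⟩ : ∃ Q : Matrix (κ ⊕ Fin s) ι F, Q * P = 1 := by
    obtain ⟨g, hg⟩ := P.mulVecLin.exists_leftInverse_of_injective (LinearMap.ker_eq_bot.mpr hPinj)
    refine ⟨LinearMap.toMatrix' g, ?_⟩
    have := congrArg LinearMap.toMatrix' hg
    rw [LinearMap.toMatrix'_comp, LinearMap.toMatrix'_id] at this
    convert this
    rw [← Matrix.toLin'_apply', LinearMap.toMatrix'_toLin']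
  have hQ' : P * Q = 1 := (mul_eq_one_comm_of_card_eq _ _ _ hcard).mp hQ
  have hQe : Q = Matrix.fromRows W' Q.toRows₂ := by
    have h6 : Q.toRows₁ = W' := by
      have h7 : W' * P = Matrix.fromCols 1 0 := by
        rw [Matrix.mul_fromCols, h, hU]
      calc Q.toRows₁ = (Matrix.fromCols (1 : Matrix κ κ F) (0 : Matrix κ (Fin s) F)) * Q := by
            conv_rhs => rw [← Matrix.fromRows_toRows Q]
            rw [Matrix.fromCols_mul_fromRows]
            simp
        _ = W' := by rw [← h7, Matrix.mul_assoc, hQ', Matrix.mul_one]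
    rw [← h6, Matrix.fromRows_toRows]
  rw [hQe, Matrix.fromRows_mul_fromCols, ← Matrix.fromBlocks_one, Matrix.fromBlocks_inj] at hQ
  rw [hQe, Matrix.fromCols_mul_fromRows] at hQ'
  exact ⟨U, Q.toRows₂, hQ.2.2.2, hU, hQ.2.2.1, hQ'⟩

/-- Any two split injections of the same rank are related by an invertible matrix. -/
lemma exists_conj (W V : Matrix ι κ F) (W' V' : Matrix κ ι F) (hW : W' * W = 1) (hV : V' * V = 1) :
    ∃ g g' : Matrix ι ι F, g * g' = 1 ∧ g' * g = 1 ∧ g * W = V ∧ V' * g = W' := by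
  have hle : Fintype.card κ ≤ Fintype.card ι := by
    have h1 : W.rank = Fintype.card κ := by
      apply le_antisymm (Matrix.rank_le_card_width W)
      have := Matrix.rank_mul_le_right W' W
      rwa [hW, Matrix.rank_one] at this
    rw [← h1]
    exact Matrix.rank_le_card_height W
  obtain ⟨s, hs⟩ := Nat.exists_eq_add_of_le hle
  obtain ⟨U, U', a1, a2, a3, a4⟩ := exists_split W W' hW s hs.symm
  obtain ⟨T, T', b1, b2, b3, b4⟩ := exists_split V V' hV s hs.symm
  have h1 : (V * W' + T * U') * (W * V' + U * T') = 1 := by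
    calc _ = V * (W' * W) * V' + V * (W' * U) * T' + T * (U' * W) * V' + T * (U' * U) * T' := by
          simp only [Matrix.add_mul, Matrix.mul_add, Matrix.mul_assoc]; abel
      _ = 1 := by simp [hW, a1, a2, a3, b4]
  refine ⟨V * W' + T * U', W * V' + U * T', h1, mul_eq_one_comm.mp h1, ?_, ?_⟩
  · simp [Matrix.add_mul, Matrix.mul_assoc, hW, a3]
  · simp [Matrix.mul_add, ← Matrix.mul_assoc, hV, b2]

/-- A scalar multiple of an idempotent with zero trace vanishes. -/
lemma eq_zero_of_quasi_idem {d : Type} [Fintype d] [DecidableEq d] (P : Matrix d d ℂ) (m : ℂ)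
    (hm : m ≠ 0) (h : P * P = m • P) (ht : P.trace = 0) : P = 0 := by
  let E : Matrix d d ℂ := m⁻¹ • P
  have hE : IsIdempotentElem E := by
    simp only [IsIdempotentElem, E, Matrix.smul_mul, Matrix.mul_smul, h, smul_smul]
    congr 1
    field_simp
  have hL : IsIdempotentElem (Matrix.toLin' E) := by
    rw [IsIdempotentElem, Module.End.mul_eq_comp, ← Matrix.toLin'_mul, hE.eq]
  have h0 : Matrix.toLin' E = 0 := by
    rw [← LinearMap.IsIdempotentElem.trace_eq_zero_iff hL]
    rw [Matrix.trace_toLin'_eq]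
    simp [E, Matrix.trace_smul, ht]
  have h1 : E = 0 := by simpa using h0
  simpa [E, hm] using h1

end LinAlg

section Framework
variable {F : Type} [Field F] [Fintype F] {ι κ : Type} [Fintype ι] [DecidableEq ι]
  [Fintype κ] [DecidableEq κ]

/-- Existence of a left inverse. -/
def LInv (Y : Matrix ι κ F) : Prop := ∃ Y' : Matrix κ ι F, Y' * Y = 1

/-- Existence of a right inverse. -/
def RInv (Z : Matrix κ ι F) : Prop := ∃ Z' : Matrix ι κ F, Z * Z' = 1

/-- A function on matrices is killed at level `p` if its Fourier coefficients along all abelian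
unipotent subgroups `1 + Y A Z` of size `p × p` vanish at the characters of full rank. -/
def KilledFn (ψ : AddChar F ℂ) (p : ℕ) {E : Type} [AddCommGroup E] [Module ℂ E]
    (φ : Matrix ι ι F → E) : Prop :=
  ∀ (Y : Matrix ι (Fin p) F) (Z : Matrix (Fin p) ι F), LInv Y → RInv Z →
    Z * Y = 0 → ∀ X, ∑ A : Matrix (Fin p) (Fin p) F, ψ (-A.trace) • φ (X * (1 + Y * A * Z)) = 0

lemma KilledFn.apply {ψ : AddChar F ℂ} {p : ℕ} {E : Type} [AddCommGroup E] [Module ℂ E]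
    {φ : Matrix ι ι F → E} (h : KilledFn ψ p φ) (hκ : Fintype.card κ = p)
    (Y : Matrix ι κ F) (Z : Matrix κ ι F) (hY : LInv Y) (hZ : RInv Z)
    (hZY : Z * Y = 0) (C C' : Matrix κ κ F) (hC : C * C' = 1) (X : Matrix ι ι F) :
    ∑ A : Matrix κ κ F, ψ (-(C * A).trace) • φ (X * (1 + Y * A * Z)) = 0 := by
  obtain ⟨Y', hY'⟩ := hY
  obtain ⟨Z', hZ'⟩ := hZ
  have hC' : C' * C = 1 := mul_eq_one_comm.mp hC
  let e : Fin p ≃ κ := (Fintype.equivFinOfCardEq hκ).symm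
  have key := h ((Y * C').submatrix id e) (Z.submatrix e id)
    ⟨(C * Y').submatrix e id, by
      rw [← Matrix.submatrix_mul _ _ _ _ _ Function.bijective_id,
        show C * Y' * (Y * C') = C * (Y' * Y) * C' by simp only [Matrix.mul_assoc], hY',
        Matrix.mul_one, hC]
      simp⟩
    ⟨Z'.submatrix id e, by
      rw [← Matrix.submatrix_mul _ _ _ _ _ Function.bijective_id, hZ']; simp⟩
    (by rw [← Matrix.submatrix_mul _ _ _ _ _ Function.bijective_id, ← Matrix.mul_assoc, hZY]
        simp) X
  have hbij : Function.Bijective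
      (fun A : Matrix κ κ F => (C * A).submatrix e e) := by
    constructor
    · intro A B hAB
      have h1 : C * A = C * B := by
        ext a b
        simpa using congrFun (congrFun hAB (e.symm a)) (e.symm b)
      have := congrArg (fun M => C' * M) h1
      simpa [← Matrix.mul_assoc, hC'] using this
    · intro B
      refine ⟨C' * B.submatrix e.symm e.symm, ?_⟩
      simp [← Matrix.mul_assoc, hC]
  rw [← key, ← hbij.sum_comp]
  refine Finset.sum_congr rfl fun A _ => ?_
  congr 2
  · rw [Matrix.trace, Matrix.trace]
    congr 1
    exact (Equiv.sum_comp e (fun a => (C * A) a a)).symm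
  · rw [Matrix.submatrix_mul_equiv, Matrix.submatrix_mul_equiv, Matrix.submatrix_id_id,
      show Y * C' * (C * A) = Y * (C' * C) * A by simp only [Matrix.mul_assoc], hC',
      Matrix.mul_one]

lemma KilledFn.comp {ψ : AddChar F ℂ} {p : ℕ} {E E' : Type} [AddCommGroup E] [Module ℂ E]
    [AddCommGroup E'] [Module ℂ E'] {φ : Matrix ι ι F → E} (h : KilledFn ψ p φ) (l : E →ₗ[ℂ] E') :
    KilledFn ψ p (fun X => l (φ X)) := by
  intro Y Z hY hZ hZY X
  have := congrArg l (h Y Z hY hZ hZY X)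
  simpa [map_sum] using this

/-- Class functions on `GL`, extended by zero to all matrices. -/
def CF (ι F : Type) [Field F] [Fintype F] [Fintype ι] [DecidableEq ι] :
    Submodule ℂ (Matrix ι ι F → ℂ) where
  carrier := {φ | (∀ X, X.det = 0 → φ X = 0) ∧ ∀ h h' X, h * h' = 1 → φ (h * X * h') = φ X}
  add_mem' := by
    rintro a b ⟨ha, ha'⟩ ⟨hb, hb'⟩
    exact ⟨fun X hX => by simp [ha X hX, hb X hX], fun h h' X e => by
      simp [ha' h h' X e, hb' h h' X e]⟩
  zero_mem' := ⟨fun _ _ => rfl, fun _ _ _ _ => rfl⟩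
  smul_mem' := by
    rintro c a ⟨ha, ha'⟩
    exact ⟨fun X hX => by simp [ha X hX], fun h h' X e => by simp [ha' h h' X e]⟩

/-- Class functions killed at level `p`. -/
def KCF (ι : Type) {F : Type} [Field F] [Fintype F] [Fintype ι] [DecidableEq ι]
    (ψ : AddChar F ℂ) (p : ℕ) : Submodule ℂ (Matrix ι ι F → ℂ) where
  carrier := {φ | φ ∈ CF ι F ∧ KilledFn ψ p φ}
  add_mem' := by
    rintro a b ⟨ha, ha'⟩ ⟨hb, hb'⟩
    refine ⟨add_mem ha hb, fun Y Z hY hZ hZY X => ?_⟩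
    have h1 := ha' Y Z hY hZ hZY X
    have h2 := hb' Y Z hY hZ hZY X
    simp only [Pi.add_apply, smul_add, Finset.sum_add_distrib, h1, h2, add_zero]
  zero_mem' := ⟨zero_mem _, fun Y Z hY hZ hZY X => by simp⟩
  smul_mem' := by
    rintro c a ⟨ha, ha'⟩
    refine ⟨Submodule.smul_mem _ c ha, fun Y Z hY hZ hZY X => ?_⟩
    have h1 := ha' Y Z hY hZ hZY X
    simp only [Pi.smul_apply, smul_comm _ c, ← Finset.smul_sum, h1, smul_zero]

/-- The operator attached to a corner: the (unnormalised) projection to the `ψ ∘ tr`-isotypic part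
of the subgroup `1 + Y A Z`. -/
noncomputable def cornerSum (ψ : AddChar F ℂ) {d : Type} (R : Matrix ι ι F → Matrix d d ℂ)
    (Y : Matrix ι κ F) (Z : Matrix κ ι F) : Matrix d d ℂ :=
  ∑ A : Matrix κ κ F, ψ (-A.trace) • R (1 + Y * A * Z)

/-- A twisted sum over a finite additive group is a multiple of an idempotent. -/
lemma twisted_sum_mul {A : Type} [AddCommGroup A] [Fintype A] {d : Type} [Fintype d]
    (θ : A → ℂ) (hθ : ∀ a b, θ (a + b) = θ a * θ b) (T : A → Matrix d d ℂ)
    (hT : ∀ a b, T (a + b) = T a * T b) :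
    (∑ a, θ a • T a) * (∑ a, θ a • T a) = (Fintype.card A : ℂ) • ∑ a, θ a • T a := by
  rw [Finset.sum_mul]
  have : ∀ a, θ a • T a * ∑ b, θ b • T b = ∑ b, θ b • T b := by
    intro a
    rw [Finset.mul_sum, ← Equiv.sum_comp (Equiv.addLeft a) (fun b => θ b • T b)]
    refine Finset.sum_congr rfl fun b _ => ?_
    simp [hT, hθ, smul_smul, mul_comm]
  rw [Finset.sum_congr rfl fun a _ => this a]
  simp [Nat.cast_smul_eq_nsmul]

lemma one_add_mul_mul (Y : Matrix ι κ F) (Z : Matrix κ ι F) (h : Z * Y = 0)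
    (A B : Matrix κ κ F) :
    (1 + Y * (A + B) * Z) = (1 + Y * A * Z) * (1 + Y * B * Z) := by
  have : Y * A * Z * (Y * B * Z) = Y * A * (Z * Y) * B * Z := by simp only [Matrix.mul_assoc]
  rw [Matrix.add_mul, Matrix.mul_add, Matrix.mul_add, Matrix.mul_add, Matrix.add_mul, this, h]
  simp only [Matrix.one_mul, Matrix.mul_one, Matrix.mul_zero, Matrix.zero_mul, add_zero]
  abel

lemma cornerSum_mul_self (ψ : AddChar F ℂ) {d : Type} [Fintype d] [DecidableEq d]
    (R : Matrix ι ι F →* Matrix d d ℂ) (Y : Matrix ι κ F) (Z : Matrix κ ι F) (h : Z * Y = 0) :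
    cornerSum ψ R Y Z * cornerSum ψ R Y Z =
      (Fintype.card (Matrix κ κ F) : ℂ) • cornerSum ψ R Y Z := by
  apply twisted_sum_mul (fun A : Matrix κ κ F => ψ (-A.trace))
    (T := fun A => R (1 + Y * A * Z))
  · intro a b
    rw [one_add_mul_mul Y Z h, map_mul]
  · intro a b
    rw [Matrix.trace_add, neg_add, AddChar.map_add_eq_mul]

lemma killedFn_rep_iff (ψ : AddChar F ℂ) {p : ℕ} {d : Type} [Fintype d] [DecidableEq d]
    (R : Matrix ι ι F →* Matrix d d ℂ) :
    KilledFn ψ p (R : Matrix ι ι F → Matrix d d ℂ) ↔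
      ∀ (Y : Matrix ι (Fin p) F) (Z : Matrix (Fin p) ι F), LInv Y →
      RInv Z → Z * Y = 0 → cornerSum ψ R Y Z = 0 := by
  constructor
  · intro h Y Z hY hZ hZY
    simpa [cornerSum] using h Y Z hY hZ hZY 1
  · intro h Y Z hY hZ hZY X
    have := congrArg (fun M => R X * M) (h Y Z hY hZ hZY)
    simpa [cornerSum, Finset.mul_sum] using this

/-- A complete family of irreducible representations of `GL`, in matrix form and extended by zero to
singular matrices. -/
structure IrrFam (ι F : Type) [Field F] [Fintype F] [Fintype ι] [DecidableEq ι] where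
  /-- the number of representations -/
  N : ℕ
  /-- their dimensions -/
  d : Fin N → ℕ
  /-- the representations -/
  R : ∀ i, Matrix ι ι F →* Matrix (Fin (d i)) (Fin (d i)) ℂ
  d_pos : ∀ i, 0 < d i
  sing : ∀ i X, X.det = 0 → R i X = 0
  orth : ∀ i j, i ≠ j → ∑ X : Matrix ι ι F, (R i X⁻¹).trace • R j X = 0
  orth_self : ∀ i, ∃ c : ℂ, c ≠ 0 ∧ ∑ X : Matrix ι ι F, (R i X⁻¹).trace • R i X = c • 1
  span_top : ∀ φ ∈ CF ι F, φ ∈ Submodule.span ℂ (Set.range fun i X => (R i X).trace)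

/-- Extension of a representation of `GL` by zero to all matrices. -/
noncomputable def extendZero {d : Type} [Fintype d] [DecidableEq d] [Nonempty d]
    (r : GL ι F →* Matrix d d ℂ) : Matrix ι ι F →* Matrix d d ℂ where
  toFun X := if h : IsUnit X then r h.unit else 0
  map_one' := by
    rw [dif_pos isUnit_one, show (isUnit_one (M := Matrix ι ι F)).unit = 1 from Units.ext rfl,
      map_one]
  map_mul' X Y := by
    by_cases hX : IsUnit X
    · by_cases hY : IsUnit Y
      · rw [dif_pos hX, dif_pos hY, dif_pos (hX.mul hY), ← map_mul]
        congr 1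
        exact Units.ext rfl
      · rw [dif_neg hY, dif_neg, mul_zero]
        intro h
        apply hY
        rw [Matrix.isUnit_iff_isUnit_det] at h ⊢
        rw [Matrix.det_mul] at h
        exact isUnit_of_mul_isUnit_right h
    · rw [dif_neg hX, dif_neg, zero_mul]
      intro h
      apply hX
      rw [Matrix.isUnit_iff_isUnit_det] at h ⊢
      rw [Matrix.det_mul] at h
      exact isUnit_of_mul_isUnit_left h

lemma extendZero_unit {d : Type} [Fintype d] [DecidableEq d] [Nonempty d]
    (r : GL ι F →* Matrix d d ℂ) (g : GL ι F) : extendZero r (g : Matrix ι ι F) = r g := by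
  simp only [extendZero, MonoidHom.coe_mk, OneHom.coe_mk]
  rw [dif_pos g.isUnit]
  congr 1
  exact Units.ext rfl

lemma extendZero_sing {d : Type} [Fintype d] [DecidableEq d] [Nonempty d]
    (r : GL ι F →* Matrix d d ℂ) (X : Matrix ι ι F) (hX : X.det = 0) : extendZero r X = 0 := by
  simp only [extendZero, MonoidHom.coe_mk, OneHom.coe_mk]
  rw [dif_neg]
  rw [Matrix.isUnit_iff_isUnit_det, hX]
  simp

lemma sum_eq_sum_units {E : Type} [AddCommMonoid E] (f : Matrix ι ι F → E)
    (hf : ∀ X, X.det = 0 → f X = 0) : ∑ X, f X = ∑ g : GL ι F, f g := by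
  refine (Finset.sum_of_injOn (fun g : GL ι F => (g : Matrix ι ι F)) ?_ ?_ ?_ ?_).symm
  · intro a _ b _ h
    exact Units.ext h
  · simp
  · intro X _ hX
    apply hf
    by_contra hne
    apply hX
    simp only [Finset.coe_univ, Set.image_univ, Set.mem_range]
    exact ⟨Matrix.GeneralLinearGroup.mkOfDetNeZero X hne, rfl⟩
  · simp

/-- A complete family of irreducible representations exists, and it enumerates the isomorphism
classes of irreducible representations. -/
theorem exists_irrFam (ι F : Type) [Field F] [Fintype F] [Fintype ι] [DecidableEq ι] :
    ∃ I : IrrFam ι F,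
      ∀ (P : (GL ι F → ℂ) → Prop) (s : Setoid {V : FDRep ℂ (GL ι F) // Simple V ∧ P V.character}),
        (∀ a b, s a b ↔ Nonempty (a.1 ≅ b.1)) →
        Nat.card (_root_.Quotient s) = Nat.card {i // P (fun g => (I.R i g).trace)} := by
  obtain ⟨N, d, R, hd, horth, hspan, hcount⟩ := exists_irreps (GL ι F)
  have : ∀ i, Nonempty (Fin (d i)) := fun i => ⟨⟨0, hd i⟩⟩
  have horth' : ∀ i j, ∑ X : Matrix ι ι F, (extendZero (R i) X⁻¹).trace • extendZero (R j) X =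
      if i = j then ((Fintype.card (GL ι F) : ℂ) / d j) • 1 else 0 := by
    intro i j
    rw [← horth i j, sum_eq_sum_units _ (fun X hX => by rw [extendZero_sing _ X hX, smul_zero])]
    refine Finset.sum_congr rfl fun g _ => ?_
    rw [extendZero_unit, ← Matrix.coe_units_inv, extendZero_unit]
  refine ⟨⟨N, d, fun i => extendZero (R i), hd, fun i => extendZero_sing _, fun i j hij => ?_,
    fun i => ⟨(Fintype.card (GL ι F) : ℂ) / d i, ?_, ?_⟩, ?_⟩, ?_⟩
  · rw [horth', if_neg hij]
  · have := hd i
    have h2 : (d i : ℂ) ≠ 0 := by exact_mod_cast this.ne'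
    have h3 : (Fintype.card (GL ι F) : ℂ) ≠ 0 := by exact_mod_cast Fintype.card_ne_zero
    exact div_ne_zero h3 h2
  · rw [horth', if_pos rfl]
  · rintro φ ⟨hφ, hφ'⟩
    have h1 := hspan (fun g => φ g) (fun g h => by
      simpa using hφ' (h : Matrix ι ι F) ((h⁻¹ : GL ι F) : Matrix ι ι F) g
        (by rw [← Units.val_mul]; simp))
    rw [Submodule.mem_span_range_iff_exists_fun] at h1 ⊢
    obtain ⟨a, ha⟩ := h1
    refine ⟨a, ?_⟩
    ext X
    by_cases hX : X.det = 0
    · simp [hφ X hX, extendZero_sing _ X hX]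
    · have h2 := congrFun ha (Matrix.GeneralLinearGroup.mkOfDetNeZero X hX)
      have h3 : ((Matrix.GeneralLinearGroup.mkOfDetNeZero X hX : GL ι F) : Matrix ι ι F) = X := rfl
      simp only [Finset.sum_apply, Pi.smul_apply, ← extendZero_unit] at h2 ⊢
      exact h2
  · intro P s hs
    rw [hcount P s hs]
    simp only [extendZero_unit]

namespace IrrFam
variable (I : IrrFam ι F)

/-- The character of a member of the family. -/
noncomputable def χ (i : Fin I.N) (X : Matrix ι ι F) : ℂ := (I.R i X).trace

lemma χ_mem (i : Fin I.N) : I.χ i ∈ CF ι F := by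
  refine ⟨fun X hX => by simp [χ, I.sing i X hX], fun h h' X e => ?_⟩
  rw [χ, map_mul, Matrix.trace_mul_comm, ← map_mul, ← Matrix.mul_assoc, mul_eq_one_comm.mp e,
    Matrix.one_mul, χ]

/-- Matrix coefficients of different members of the family are independent. -/
lemma indep (M : ∀ i, Matrix (Fin (I.d i)) (Fin (I.d i)) ℂ)
    (h : ∀ X, X.det ≠ 0 → ∑ i, (I.R i X * M i).trace = 0) (i : Fin I.N) (X : Matrix ι ι F) :
    (I.R i X * M i).trace = 0 := by
  by_cases hX : X.det = 0
  · simp [I.sing i X hX]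
  have h1 : ∑ g : Matrix ι ι F, (I.R i g⁻¹).trace * ∑ j, (I.R j (g * X) * M j).trace = 0 := by
    apply Finset.sum_eq_zero
    intro g _
    by_cases hg : g.det = 0
    · have : (g * X).det = 0 := by simp [hg]
      simp [I.sing _ _ this]
    · rw [h, mul_zero]
      rw [Matrix.det_mul]
      exact mul_ne_zero hg hX
  have h2 : ∑ g : Matrix ι ι F, (I.R i g⁻¹).trace * ∑ j, (I.R j (g * X) * M j).trace =
      ∑ j, ((∑ g : Matrix ι ι F, (I.R i g⁻¹).trace • I.R j g) * (I.R j X * M j)).trace := by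
    simp only [Finset.mul_sum]
    rw [Finset.sum_comm]
    refine Finset.sum_congr rfl fun j _ => ?_
    rw [Finset.sum_mul, Matrix.trace_sum]
    refine Finset.sum_congr rfl fun g _ => ?_
    rw [Matrix.smul_mul, Matrix.trace_smul, map_mul, Matrix.mul_assoc, smul_eq_mul]
  rw [h1, Finset.sum_eq_single i] at h2
  · obtain ⟨c, hc, hc'⟩ := I.orth_self i
    rw [hc'] at h2
    simpa [hc] using h2.symm
  · intro j _ hj
    rw [I.orth i j (Ne.symm hj)]
    simp
  · simp

lemma linearIndependent_χ : LinearIndependent ℂ I.χ := by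
  rw [Fintype.linearIndependent_iff]
  intro a ha i
  have h1 := I.indep (fun i => a i • 1) (fun X _ => by
    have := congrFun ha X
    simpa [χ, Matrix.trace_smul] using this) i 1
  have := I.d_pos i
  have h2 : (I.d i : ℂ) ≠ 0 := by exact_mod_cast this.ne'
  simpa [Matrix.trace_smul, h2] using h1

lemma killedFn_of_sum (ψ : AddChar F ℂ) (p : ℕ) (a : Fin I.N → ℂ)
    (h : KilledFn ψ p (∑ i, a i • I.χ i)) (i : Fin I.N) (hi : a i ≠ 0) :
    KilledFn ψ p (I.R i : Matrix ι ι F → _) := by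
  rw [killedFn_rep_iff]
  intro Y Z hY hZ hZY
  have h1 := I.indep (fun i => a i • cornerSum ψ (I.R i) Y Z) (fun X _ => by
    have h2 := h Y Z hY hZ hZY X
    rw [← h2]
    simp only [Finset.sum_apply, Pi.smul_apply, χ, Finset.smul_sum, cornerSum, Finset.mul_sum,
      Matrix.trace_sum, map_mul, Matrix.mul_smul, Matrix.trace_smul]
    rw [Finset.sum_comm]
    refine Finset.sum_congr rfl fun A _ => Finset.sum_congr rfl fun i _ => ?_
    rw [smul_comm]) i 1
  rw [map_one, Matrix.one_mul, Matrix.trace_smul, smul_eq_mul, mul_eq_zero] at h1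
  exact eq_zero_of_quasi_idem _ _ (by exact_mod_cast Fintype.card_ne_zero)
    (cornerSum_mul_self ψ (I.R i) Y Z hZY) (h1.resolve_left hi)

lemma card_eq_finrank_CF : I.N = Module.finrank ℂ (CF ι F) := by
  have h1 : CF ι F = Submodule.span ℂ (Set.range I.χ) := by
    apply le_antisymm
    · exact fun φ hφ => I.span_top φ hφ
    · rw [Submodule.span_le]
      rintro _ ⟨i, rfl⟩
      exact I.χ_mem i
  rw [h1, finrank_span_eq_card I.linearIndependent_χ, Fintype.card_fin]

lemma card_killed (ψ : AddChar F ℂ) (p : ℕ) :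
    Nat.card {i // KilledFn ψ p (I.R i : Matrix ι ι F → _)} = Module.finrank ℂ (KCF ι ψ p) := by
  have h1 : KCF ι ψ p = Submodule.span ℂ (Set.range
      fun i : {i // KilledFn ψ p (I.R i : Matrix ι ι F → _)} => I.χ i.1) := by
    apply le_antisymm
    · rintro φ ⟨hφ, hk⟩
      have h2 := I.span_top φ hφ
      rw [Submodule.mem_span_range_iff_exists_fun] at h2
      obtain ⟨a, rfl⟩ := h2
      refine Submodule.sum_mem _ fun i _ => ?_
      by_cases hi : a i = 0
      · simp [hi]
      · refine Submodule.smul_mem _ _ (Submodule.subset_span ⟨⟨i, ?_⟩, rfl⟩)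
        exact I.killedFn_of_sum ψ p a hk i hi
    · rw [Submodule.span_le]
      rintro _ ⟨i, rfl⟩
      exact ⟨I.χ_mem i.1, i.2.comp (Matrix.traceLinearMap _ ℂ ℂ)⟩
  rw [h1, finrank_span_eq_card, Nat.card_eq_fintype_card]
  exact I.linearIndependent_χ.comp _ Subtype.val_injective

end IrrFam
end Framework

section Inverses
variable {F : Type} [Field F] {ι κ σ : Type} [Fintype ι] [DecidableEq ι]
  [Fintype κ] [DecidableEq κ] [Fintype σ] [DecidableEq σ]

lemma lInv_iff (K : Matrix ι κ F) : LInv K ↔ ∀ x, K *ᵥ x = 0 → x = 0 := by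
  constructor
  · rintro ⟨K', hK'⟩ x hx
    have := congrArg (fun v => K' *ᵥ v) hx
    simpa [Matrix.mulVec_mulVec, hK'] using this
  · intro h
    have h1 : LinearMap.ker K.mulVecLin = ⊥ := by
      rw [LinearMap.ker_eq_bot']
      exact h
    obtain ⟨g, hg⟩ := K.mulVecLin.exists_leftInverse_of_injective h1
    refine ⟨LinearMap.toMatrix' g, ?_⟩
    have := congrArg LinearMap.toMatrix' hg
    rw [LinearMap.toMatrix'_comp, LinearMap.toMatrix'_id] at this
    convert this
    rw [← Matrix.toLin'_apply', LinearMap.toMatrix'_toLin']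

lemma lInv_transpose (Z : Matrix κ ι F) : LInv Zᵀ ↔ RInv Z := by
  constructor
  · rintro ⟨Y, hY⟩
    exact ⟨Yᵀ, by rw [← Matrix.transpose_transpose Z, ← Matrix.transpose_mul, hY,
      Matrix.transpose_one]⟩
  · rintro ⟨Y, hY⟩
    exact ⟨Yᵀ, by rw [← Matrix.transpose_mul, hY, Matrix.transpose_one]⟩

lemma rInv_iff (Z : Matrix κ ι F) : RInv Z ↔ ∀ x, x ᵥ* Z = 0 → x = 0 := by
  rw [← lInv_transpose, lInv_iff]
  simp [Matrix.mulVec_transpose]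

lemma LInv.mul {K : Matrix ι κ F} {L : Matrix κ σ F} (hK : LInv K) (hL : LInv L) :
    LInv (K * L) := by
  obtain ⟨K', hK'⟩ := hK
  obtain ⟨L', hL'⟩ := hL
  exact ⟨L' * K', by rw [Matrix.mul_assoc, ← Matrix.mul_assoc K', hK', Matrix.one_mul, hL']⟩

lemma RInv.mul {K : Matrix ι κ F} {L : Matrix κ σ F} (hK : RInv K) (hL : RInv L) :
    RInv (K * L) := by
  obtain ⟨K', hK'⟩ := hK
  obtain ⟨L', hL'⟩ := hL
  exact ⟨L' * K', by rw [Matrix.mul_assoc, ← Matrix.mul_assoc L, hL', Matrix.one_mul, hK']⟩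

lemma LInv.submatrix {K : Matrix ι κ F} (hK : LInv K) (e : σ ≃ κ) : LInv (K.submatrix id e) := by
  obtain ⟨K', hK'⟩ := hK
  exact ⟨K'.submatrix e id, by
    rw [← Matrix.submatrix_mul _ _ _ _ _ Function.bijective_id, hK']; simp⟩

lemma RInv.submatrix {Z : Matrix κ ι F} (hZ : RInv Z) (e : σ ≃ κ) : RInv (Z.submatrix e id) := by
  obtain ⟨K', hK'⟩ := hZ
  exact ⟨K'.submatrix id e, by
    rw [← Matrix.submatrix_mul _ _ _ _ _ Function.bijective_id, hK']; simp⟩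

lemma mul_eq_add_vecMulVec (K : Matrix ι (κ ⊕ Unit) F) (Z : Matrix (κ ⊕ Unit) σ F) :
    K * Z = K.toCols₁ * Z.toRows₁ + vecMulVec (fun i => K i (Sum.inr ())) (Z (Sum.inr ())) := by
  ext i j
  simp [Matrix.mul_apply, vecMulVec_apply, Matrix.toCols₁, Matrix.toRows₁]

end Inverses

/-- The coefficients in the formula expressing a function satisfying the hypotheses of
`extension_formula` through its values on `Z = 0`. -/
noncomputable def lam (q s j : ℕ) : ℕ → ℝ
  | 0 => 1
  | t + 1 => -((q : ℝ) ^ t * lam q s j t) / (((q : ℝ) ^ s - (q : ℝ) ^ t) * (q : ℝ) ^ j)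

lemma lam_sign (q s j : ℕ) (hq : 1 < q) (t : ℕ) (ht : t ≤ s) : 0 < (-1) ^ t * lam q s j t := by
  induction t with
  | zero => simp [lam]
  | succ t ih =>
    have h1 := ih (by omega)
    have hq' : (1 : ℝ) < q := by exact_mod_cast hq
    have h2 : (0 : ℝ) < (q : ℝ) ^ s - (q : ℝ) ^ t := by
      have := pow_lt_pow_right₀ hq' (show t < s by omega)
      linarith
    have h3 : (0 : ℝ) < (q : ℝ) ^ t := by positivity
    have h4 : (0 : ℝ) < (q : ℝ) ^ j := by positivity
    have : (-1) ^ (t + 1) * lam q s j (t + 1) =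
        (q : ℝ) ^ t * ((-1) ^ t * lam q s j t) / (((q : ℝ) ^ s - (q : ℝ) ^ t) * (q : ℝ) ^ j) := by
      simp only [lam, pow_succ]; ring
    rw [this]
    positivity

section Star
variable {F : Type} [Field F] [Fintype F] {α σ : Type} [Fintype α] [DecidableEq α]
  [Fintype σ] [DecidableEq σ]

lemma extension_formula (f : Matrix α α F → Matrix σ α F → ℂ)
    (h1 : ∀ (n : Matrix α σ F) (g g' : Matrix σ σ F), g * g' = 1 →
      ∀ X Z, f (X + n * Z) (g * Z) = f X Z)
    (h2 : ∀ X Z (η : α → F), η ≠ 0 → ∑ x : α → F, ∑ y : σ → F,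
      f (X + vecMulVec x η) (Z + vecMulVec y η) = 0) (t : ℕ) :
    ∀ (τ : Type) [Fintype τ] [DecidableEq τ], Fintype.card τ = t →
      ∀ (X : Matrix α α F) (K : Matrix σ τ F) (Z : Matrix τ α F), LInv K → RInv Z →
      f X (K * Z) = lam (Fintype.card F) (Fintype.card σ) (Fintype.card α) t *
        ∑ B : Matrix α τ F, f (X + B * Z) 0 := by
  induction t with
  | zero =>
    intro τ _ _ hτ X K Z _ _
    have : IsEmpty τ := Fintype.card_eq_zero_iff.mp hτ
    have h3 : K * Z = 0 := by ext i j; simp [Matrix.mul_apply]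
    have h4 : ∀ B : Matrix α τ F, B * Z = 0 := fun B => by ext i j; simp [Matrix.mul_apply]
    have h5 : Fintype.card (Matrix α τ F) = 1 := by
      rw [Fintype.card_eq_one_iff]
      exact ⟨0, fun B => by ext i j; exact isEmptyElim j⟩
    simp [lam, h3, h4, h5]
  | succ t ih =>
    suffices key : ∀ (X : Matrix α α F) (K : Matrix σ (Fin t ⊕ Unit) F)
        (Z : Matrix (Fin t ⊕ Unit) α F), LInv K → RInv Z →
        f X (K * Z) = lam (Fintype.card F) (Fintype.card σ) (Fintype.card α) (t + 1) *
          ∑ B : Matrix α (Fin t ⊕ Unit) F, f (X + B * Z) 0 by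
      intro τ _ _ hτ X K Z hK hZ
      let e : Fin t ⊕ Unit ≃ τ := Fintype.equivOfCardEq (by simp [hτ])
      have := key X (K.submatrix id e) (Z.submatrix e id) (hK.submatrix e) (hZ.submatrix e)
      rw [Matrix.submatrix_mul_equiv, Matrix.submatrix_id_id] at this
      rw [this]
      congr 1
      refine Fintype.sum_equiv ((Equiv.refl α).arrowCongr (e.arrowCongr (Equiv.refl F))) _ _ ?_
      intro B
      congr 2
      rw [show ((Equiv.refl α).arrowCongr (e.arrowCongr (Equiv.refl F))) B =
        Matrix.submatrix B id e.symm from rfl]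
      have h3 : B = (Matrix.submatrix B id e.symm).submatrix id e := by
        ext i k; change B i k = B i (e.symm (e k)); simp
      conv_lhs => rw [h3]
      rw [Matrix.submatrix_mul_equiv, Matrix.submatrix_id_id]
    intro X K Z hK hZ
    set q := Fintype.card F with hq
    set K' := K.toCols₁ with hK'
    set Z' := Z.toRows₁ with hZ'
    set η := Z (Sum.inr ()) with hη
    have hKi : ∀ x, K *ᵥ x = 0 → x = 0 := (lInv_iff K).mp hK
    have hZi : ∀ x, x ᵥ* Z = 0 → x = 0 := (rInv_iff Z).mp hZ
    have hK'inj : ∀ c, K' *ᵥ c = 0 → c = 0 := by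
      intro c hc
      have := hKi (Sum.elim c 0) (by
        rw [← Matrix.fromCols_toCols K, Matrix.fromCols_mulVec]
        simpa using hc)
      ext i
      exact congrFun this (Sum.inl i)
    have hη0 : η ≠ 0 := by
      intro h0
      have := hZi (Sum.elim 0 1) (by
        rw [← Matrix.fromRows_toRows Z, Matrix.sumElim_vecMul_fromRows]
        ext i
        have := congrFun h0 i
        simpa [Matrix.vecMul, dotProduct, Matrix.toRows₂] using this)
      simpa using congrFun this (Sum.inr ())
    have hstar := h2 X (K' * Z') η hη0
    have hoff : ∀ x : α → F, ∀ y : σ → F, (∀ c, K' *ᵥ c ≠ y) →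
        f (X + vecMulVec x η) (K' * Z' + vecMulVec y η) = f X (K * Z) := by
      intro x y hy
      let Ky : Matrix σ (Fin t ⊕ Unit) F := Matrix.fromCols K' (Matrix.replicateCol Unit y)
      have hKy : LInv Ky := by
        rw [lInv_iff]
        intro v hv
        have hv' : K' *ᵥ (v ∘ Sum.inl) + v (Sum.inr ()) • y = 0 := by
          rw [← hv, Matrix.fromCols_mulVec]
          congr 1
          ext i
          simp [Matrix.mulVec, dotProduct, mul_comm]
        have hlast : v (Sum.inr ()) = 0 := by
          by_contra hne
          apply hy (-(v (Sum.inr ()))⁻¹ • (v ∘ Sum.inl))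
          rw [Matrix.mulVec_smul, eq_neg_of_add_eq_zero_left hv', smul_neg, neg_smul, neg_neg,
            smul_smul, inv_mul_cancel₀ hne, one_smul]
        have hfirst := hK'inj (v ∘ Sum.inl) (by simpa [hlast] using hv')
        ext (i | i)
        · exact congrFun hfirst i
        · exact hlast
      obtain ⟨L, hL⟩ := hK
      obtain ⟨Ly, hLy⟩ := hKy
      obtain ⟨g, g', hg, -, hgK, -⟩ := exists_conj K Ky L Ly hL hLy
      have e1 : K' * Z' + vecMulVec y η = g * (K * Z) := by
        rw [← Matrix.mul_assoc, hgK, mul_eq_add_vecMulVec]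
        congr 1
      have e2 : vecMulVec x η =
          Matrix.fromCols (0 : Matrix α (Fin t) F) (Matrix.replicateCol Unit x) * L * (K * Z) := by
        rw [Matrix.mul_assoc, ← Matrix.mul_assoc L, hL, Matrix.one_mul, mul_eq_add_vecMulVec]
        simp [Matrix.fromCols, Matrix.toCols₁, hη]
        ext i j
        simp [Matrix.mul_apply]
      rw [e1, e2]
      exact h1 _ g g' hg X (K * Z)
    have hon : ∀ c : Fin t → F, ∑ x : α → F,
        f (X + vecMulVec x η) (K' * Z' + vecMulVec (K' *ᵥ c) η) =
        lam q (Fintype.card σ) (Fintype.card α) t *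
          ∑ B : Matrix α (Fin t ⊕ Unit) F, f (X + B * Z) 0 := by
      intro c
      let Zc : Matrix (Fin t) α F := Z' + vecMulVec c η
      have hZc : RInv Zc := by
        rw [rInv_iff]
        intro v hv
        have := hZi (Sum.elim v (fun _ => v ⬝ᵥ c)) (by
          rw [← hv, ← Matrix.fromRows_toRows Z, Matrix.sumElim_vecMul_fromRows, Matrix.vecMul_add]
          congr 1
          ext i
          simp [Matrix.vecMul, dotProduct, Matrix.toRows₂, vecMulVec_apply, hη, Finset.sum_mul,
            mul_assoc])
        ext i
        exact congrFun this (Sum.inl i)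
      have e1 : K' * Z' + vecMulVec (K' *ᵥ c) η = K' * Zc := by
        rw [Matrix.mul_add, Matrix.mul_vecMulVec]
      have e2 : ∀ x : α → F, f (X + vecMulVec x η) (K' * Zc) =
          lam q (Fintype.card σ) (Fintype.card α) t *
            ∑ B : Matrix α (Fin t) F, f (X + vecMulVec x η + B * Zc) 0 := fun x =>
        ih (Fin t) (by simp) _ K' Zc ((lInv_iff K').mpr hK'inj) hZc
      rw [e1, Finset.sum_congr rfl fun x _ => e2 x, ← Finset.mul_sum]
      congr 1
      rw [Finset.sum_comm]
      have e3 : ∀ B : Matrix α (Fin t) F, ∑ x : α → F, f (X + vecMulVec x η + B * Zc) 0 =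
          ∑ x : α → F, f (X + B * Z' + vecMulVec x η) 0 := by
        intro B
        rw [← Equiv.sum_comp (Equiv.addRight (B *ᵥ c))
          (fun x => f (X + B * Z' + vecMulVec x η) 0)]
        refine Finset.sum_congr rfl fun x _ => ?_
        congr 1
        simp only [Equiv.coe_addRight, Matrix.add_vecMulVec, Zc, Matrix.mul_add,
          Matrix.mul_vecMulVec]
        abel
      rw [Finset.sum_congr rfl fun B _ => e3 B, ← Finset.sum_product']
      refine Finset.sum_bij'
        (fun (P : Matrix α (Fin t) F × (α → F)) _ =>
          Matrix.fromCols P.1 (Matrix.replicateCol Unit P.2))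
        (fun B _ => (B.toCols₁, fun i => B i (Sum.inr ()))) ?_ ?_ ?_ ?_ ?_
      · simp
      · simp
      · rintro ⟨B, x⟩ _
        rfl
      · intro B _
        ext i (k | k) <;> rfl
      · rintro ⟨B, x⟩ _
        congr 1
        rw [mul_eq_add_vecMulVec, ← add_assoc]
        rfl
    have hinj : Function.Injective fun c : Fin t → F => K' *ᵥ c := by
      intro a b hab
      have : K' *ᵥ (a - b) = 0 := by rw [Matrix.mulVec_sub, sub_eq_zero]; exact hab
      exact sub_eq_zero.mp (hK'inj _ this)
    rw [Finset.sum_comm, ← Finset.sum_filter_add_sum_filter_not Finset.univ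
      (fun y : σ → F => ∃ c, K' *ᵥ c = y)] at hstar
    have hfil : (Finset.univ.filter fun y : σ → F => ∃ c, K' *ᵥ c = y) =
        Finset.univ.image fun c : Fin t → F => K' *ᵥ c := by
      ext y; simp
    have hcard1 : (Finset.univ.filter fun y : σ → F => ∃ c, K' *ᵥ c = y).card = q ^ t := by
      rw [hfil, Finset.card_image_of_injective _ hinj]
      simp [hq]
    have hcard2 := Finset.card_filter_add_card_filter_not
      (s := (Finset.univ : Finset (σ → F))) (fun y : σ → F => ∃ c, K' *ᵥ c = y)
    have hoff' : ∑ y ∈ Finset.univ.filter (fun y : σ → F => ¬ ∃ c, K' *ᵥ c = y), ∑ x : α → F,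
        f (X + vecMulVec x η) (K' * Z' + vecMulVec y η) =
        ∑ y ∈ Finset.univ.filter (fun y : σ → F => ¬ ∃ c, K' *ᵥ c = y), ∑ _x : α → F,
          f X (K * Z) := by
      refine Finset.sum_congr rfl fun y hy => Finset.sum_congr rfl fun x _ => hoff x y ?_
      simpa using (Finset.mem_filter.mp hy).2
    rw [hoff', hfil, Finset.sum_image (fun a _ b _ h => hinj h),
      Finset.sum_congr rfl fun c _ => hon c] at hstar
    rw [hcard1] at hcard2
    simp only [Finset.sum_const, Finset.card_univ, nsmul_eq_mul, Fintype.card_fun,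
      Fintype.card_fin] at hstar hcard2
    have hts : t < Fintype.card σ := by
      have h3 : Fintype.card (Fin t ⊕ Unit) ≤ Fintype.card σ := by
        obtain ⟨L, hL⟩ := hK
        have h4 := Matrix.rank_mul_le_right L K
        rw [hL, Matrix.rank_one] at h4
        exact h4.trans (Matrix.rank_le_card_height K)
      simpa using h3
    have hq1 : 1 < q := Fintype.one_lt_card
    have hC : ((Finset.univ.filter fun y : σ → F => ¬ ∃ c, K' *ᵥ c = y).card : ℂ) =
        (q : ℂ) ^ Fintype.card σ - (q : ℂ) ^ t := by
      rw [← hq] at hcard2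
      have : ((q ^ t + (Finset.univ.filter fun y : σ → F => ¬ ∃ c, K' *ᵥ c = y).card : ℕ) : ℂ) =
        ((q ^ Fintype.card σ : ℕ) : ℂ) := by rw [hcard2]
      push_cast at this
      rw [← this]; ring
    have hne : (q : ℂ) ^ Fintype.card σ - (q : ℂ) ^ t ≠ 0 := by
      rw [sub_ne_zero]
      exact_mod_cast (Nat.pow_lt_pow_right hq1 hts).ne'
    have hq0 : (q : ℂ) ^ Fintype.card α ≠ 0 := by
      have : (q : ℂ) ≠ 0 := by exact_mod_cast (by omega : q ≠ 0)
      exact pow_ne_zero _ this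
    rw [hC] at hstar
    rw [lam]
    push_cast at hstar ⊢
    rw [← hq] at hstar
    have hD : ((q : ℂ) ^ Fintype.card σ - (q : ℂ) ^ t) * (q : ℂ) ^ Fintype.card α ≠ 0 :=
      mul_ne_zero hne hq0
    rw [div_mul_eq_mul_div, eq_div_iff hD]
    linear_combination hstar

end Star

section Restriction
variable {F : Type} [Field F] {ι α σ : Type} [Fintype ι] [DecidableEq ι]
  [Fintype α] [DecidableEq α] [Fintype σ] [DecidableEq σ]

/-- Rank factorization. -/
lemma exists_rank_factorization (Z : Matrix σ α F) :
    ∃ (t : ℕ) (K : Matrix σ (Fin t) F) (L : Matrix (Fin t) α F), LInv K ∧ RInv L ∧ Z = K * L := by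
  let b := Module.finBasis F (LinearMap.range Z.mulVecLin)
  let K : Matrix σ (Fin _) F := Matrix.of fun i k => (b k : σ → F) i
  let L : Matrix (Fin _) α F := Matrix.of fun k j =>
    b.repr ⟨Z *ᵥ Pi.single j 1, ⟨Pi.single j 1, rfl⟩⟩ k
  have hKx : ∀ x, K *ᵥ x = ((∑ k, x k • b k : LinearMap.range Z.mulVecLin) : σ → F) := by
    intro x
    ext i
    simp only [Matrix.mulVec, dotProduct, K, Matrix.of_apply, Submodule.coe_sum, Submodule.coe_smul,
      Finset.sum_apply, Pi.smul_apply, smul_eq_mul]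
    exact Finset.sum_congr rfl fun k _ => mul_comm _ _
  have hK : ∀ x, K *ᵥ x = 0 → x = 0 := by
    intro x hx
    rw [hKx] at hx
    have h2 : ∑ k, x k • b k = 0 := Subtype.ext hx
    ext k
    exact Fintype.linearIndependent_iff.mp b.linearIndependent x h2 k
  have hZ : Z = K * L := by
    ext i j
    have h1 : K *ᵥ (fun k => L k j) = Z *ᵥ Pi.single j 1 := by
      rw [hKx]
      have := b.sum_repr ⟨Z *ᵥ Pi.single j 1, ⟨Pi.single j 1, rfl⟩⟩
      exact congrArg Subtype.val this
    have h2 := congrFun h1 i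
    rw [Matrix.mulVec_single_one] at h2
    simpa [Matrix.mul_apply, Matrix.mulVec, dotProduct] using h2.symm
  refine ⟨_, K, L, (lInv_iff K).mpr hK, ?_, hZ⟩
  have h3 : ∀ k, ∃ x, Z *ᵥ x = (b k : σ → F) := fun k => (b k).2
  choose x hx using h3
  refine ⟨Matrix.of fun j k => x k j, ?_⟩
  have h4 : ∀ k, L *ᵥ x k = Pi.single k 1 := by
    intro k
    rw [← sub_eq_zero]
    apply hK
    rw [Matrix.mulVec_sub, Matrix.mulVec_mulVec, ← hZ, hx, sub_eq_zero]
    ext i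
    simp [K]
  ext k l
  have := congrFun (h4 l) k
  simpa [Matrix.mul_apply, Matrix.mulVec, dotProduct, Matrix.one_apply, Pi.single_apply] using this

variable [Fintype F]

/-- Sum of `φ` over all matrices with prescribed restriction to the image of `W`. -/
noncomputable def restr (φ : Matrix ι ι F → ℂ) (W x : Matrix ι α F) : ℂ :=
  ∑ M : Matrix ι ι F, if M * W = x then φ M else 0

/-- All sums of `φ` over the matrices with prescribed restriction to a subspace of dimension `l`
vanish. -/
def FixVanish (l : ℕ) (φ : Matrix ι ι F → ℂ) : Prop :=
  ∀ W : Matrix ι (Fin l) F, LInv W → ∀ x, restr φ W x = 0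

lemma FixVanish.restr_eq_zero {l : ℕ} {φ : Matrix ι ι F → ℂ} (h : FixVanish l φ)
    (hα : Fintype.card α = l) (W : Matrix ι α F) (hW : LInv W) (x : Matrix ι α F) :
    restr φ W x = 0 := by
  let e : Fin l ≃ α := (Fintype.equivFinOfCardEq hα).symm
  rw [← h (W.submatrix id e) (hW.submatrix e) (x.submatrix id e)]
  unfold restr
  refine Finset.sum_congr rfl fun M _ => ?_
  congr 1
  rw [eq_iff_iff]
  constructor
  · rintro rfl
    ext i j
    simp [Matrix.mul_apply]
  · intro h2
    ext i j
    have := congrFun (congrFun h2 i) (e.symm j)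
    simpa [Matrix.mul_apply] using this

lemma restr_conj {φ : Matrix ι ι F → ℂ} (hφ : φ ∈ CF ι F) (W x : Matrix ι α F)
    (h h' : Matrix ι ι F) (e : h * h' = 1) : restr φ (h * W) (h * x) = restr φ W x := by
  have e' : h' * h = 1 := mul_eq_one_comm.mp e
  unfold restr
  refine Finset.sum_bij' (fun M _ => h' * M * h) (fun M _ => h * M * h') (by simp) (by simp)
    ?_ ?_ ?_
  · intro M _
    calc h * (h' * M * h) * h' = (h * h') * M * (h * h') := by simp only [Matrix.mul_assoc]
      _ = M := by simp [e]
  · intro M _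
    calc h' * (h * M * h') * h = (h' * h) * M * (h' * h) := by simp only [Matrix.mul_assoc]
      _ = M := by simp [e']
  · intro M _
    rw [hφ.2 h' h M e']
    congr 1
    rw [eq_iff_iff]
    constructor
    · intro h2
      calc h' * M * h * W = h' * (M * (h * W)) := by simp only [Matrix.mul_assoc]
        _ = x := by rw [h2, ← Matrix.mul_assoc, e', Matrix.one_mul]
    · rintro rfl
      calc M * (h * W) = (h * h') * (M * (h * W)) := by rw [e, Matrix.one_mul]
        _ = _ := by simp only [Matrix.mul_assoc]

lemma restr_comp (φ : Matrix ι ι F → ℂ) (W x : Matrix ι α F) (h h' : Matrix α α F)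
    (e : h * h' = 1) : restr φ (W * h) (x * h) = restr φ W x := by
  unfold restr
  refine Finset.sum_congr rfl fun M _ => ?_
  congr 1
  rw [eq_iff_iff]
  constructor
  · intro h2
    have := congrArg (fun X => X * h') h2
    simpa [Matrix.mul_assoc, e] using this
  · rintro rfl
    rw [Matrix.mul_assoc]

lemma restr_eq_zero_of_not_lInv {φ : Matrix ι ι F → ℂ} (hφ : φ ∈ CF ι F) (W x : Matrix ι α F)
    (hW : LInv W) (hx : ¬ LInv x) : restr φ W x = 0 := by
  unfold restr
  apply Finset.sum_eq_zero
  intro M _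
  split_ifs with h
  · apply hφ.1
    by_contra hne
    apply hx
    rw [← h]
    refine LInv.mul ⟨M⁻¹, ?_⟩ hW
    rw [Matrix.nonsing_inv_mul _ (Ne.isUnit hne)]
  · rfl

/-- The restriction of a class function to `α × α` matrices along a splitting. -/
lemma restr_mem_CF {φ : Matrix ι ι F → ℂ} (hφ : φ ∈ CF ι F) (W : Matrix ι α F) (hW : LInv W) :
    (fun X : Matrix α α F => restr φ W (W * X)) ∈ CF α F := by
  refine ⟨fun X hX => ?_, fun h h' X e => ?_⟩
  · apply restr_eq_zero_of_not_lInv hφ W _ hW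
    rintro ⟨Y, hY⟩
    have := congrArg Matrix.det (show Y * W * X = 1 by rw [← hY, Matrix.mul_assoc])
    rw [Matrix.det_mul, hX] at this
    simp at this
  · obtain ⟨W', hW'⟩ := hW
    have e' : h' * h = 1 := mul_eq_one_comm.mp e
    let P : Matrix ι ι F := 1 + W * (h - 1) * W'
    let P' : Matrix ι ι F := 1 + W * (h' - 1) * W'
    have hPW : P * W = W * h := by
      simp only [P, Matrix.add_mul, Matrix.mul_assoc, hW', Matrix.mul_one, Matrix.one_mul,
        Matrix.mul_sub]
      abel
    have hPW' : P' * W = W * h' := by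
      simp only [P', Matrix.add_mul, Matrix.mul_assoc, hW', Matrix.mul_one, Matrix.one_mul,
        Matrix.mul_sub]
      abel
    have hP : P * P' = 1 := by
      have h1 : P * P' = 1 + W * (h' - 1) * W' + W * (h - 1) * W' +
          W * (h - 1) * (W' * W) * (h' - 1) * W' := by
        simp only [P, P', Matrix.add_mul, Matrix.mul_add, Matrix.mul_assoc, Matrix.one_mul,
          Matrix.mul_one]
        abel
      have h2 : (h - 1) * (h' - 1) = -(h' - 1) - (h - 1) := by
        rw [Matrix.sub_mul, Matrix.mul_sub, e]
        simp only [Matrix.mul_one, Matrix.one_mul]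
        abel
      rw [h1, hW', Matrix.mul_one, Matrix.mul_assoc W (h - 1) (h' - 1), h2, Matrix.mul_sub W (-(h' - 1)),
        Matrix.sub_mul _ _ W', Matrix.mul_neg, Matrix.neg_mul]
      abel
    have h2 := restr_conj hφ W (W * X * h') P P' hP
    have h3 := restr_comp φ W (W * (h * X * h')) h h' e
    rw [hPW] at h2
    change restr φ W (W * (h * X * h')) = restr φ W (W * X)
    rw [← h3, show W * (h * X * h') * h = P * (W * X * h') * h by
      rw [← Matrix.mul_assoc P, ← Matrix.mul_assoc P, hPW]; simp only [Matrix.mul_assoc]]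
    rw [show P * (W * X * h') * h = P * (W * X) by
      simp only [Matrix.mul_assoc, e', Matrix.mul_one], ← hPW, restr_conj hφ W _ P P' hP]

/-- The restriction of `φ` to a subspace is determined by the restriction to the Levi block, if all
the restrictions to smaller subspaces vanish. -/
lemma restr_formula {φ : Matrix ι ι F → ℂ} (hφ : φ ∈ CF ι F) (W : Matrix ι α F) (W' : Matrix α ι F)
    (U : Matrix ι σ F) (U' : Matrix σ ι F) (hW : W' * W = 1) (hU : U' * U = 1) (hWU : W' * U = 0)
    (hUW : U' * W = 0) (hsum : W * W' + U * U' = 1)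
    (hv : ∀ l, l + 1 = Fintype.card α → FixVanish l φ) (t : ℕ) (τ : Type) [Fintype τ]
    [DecidableEq τ] (hτ : Fintype.card τ = t) (X : Matrix α α F) (K : Matrix σ τ F)
    (Z : Matrix τ α F) (hK : LInv K) (hZ : RInv Z) :
    restr φ W (W * X + U * (K * Z)) =
      lam (Fintype.card F) (Fintype.card σ) (Fintype.card α) t *
        ∑ B : Matrix α τ F, restr φ W (W * (X + B * Z)) := by
  have key := extension_formula (fun (X : Matrix α α F) (Z : Matrix σ α F) =>
    restr φ W (W * X + U * Z)) ?_ ?_ t τ hτ X K Z hK hZ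
  · simpa using key
  · intro n g g' hg X Z
    let h : Matrix ι ι F := W * W' + U * g * U' + W * n * U'
    let h' : Matrix ι ι F := W * W' + U * g' * U' - W * (n * g') * U'
    have hh : h * h' = 1 := by
      have h1 : h * h' = W * (W' * W) * W' + W * (W' * U) * g' * U' - W * (W' * W) * (n * g') * U' +
          U * g * (U' * W) * W' + U * g * (U' * U) * g' * U' - U * g * (U' * W) * (n * g') * U' +
          W * n * (U' * W) * W' + W * n * (U' * U) * g' * U' - W * n * (U' * W) * (n * g') * U' := by
        simp only [h, h', Matrix.add_mul, Matrix.mul_add, Matrix.mul_sub, Matrix.mul_assoc]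
        abel
      rw [h1, hW, hU, hWU, hUW]
      simp only [Matrix.mul_one, Matrix.mul_zero, Matrix.zero_mul, add_zero, sub_zero]
      rw [Matrix.mul_assoc U g, hg, Matrix.mul_one, ← hsum]
      simp only [Matrix.mul_assoc]
      abel
    have hhW : h * W = W := by
      simp only [h, Matrix.add_mul, Matrix.mul_assoc, hW, hUW, Matrix.mul_one, Matrix.mul_zero,
        add_zero]
    have hhx : h * (W * X + U * Z) = W * (X + n * Z) + U * (g * Z) := by
      have h1 : h * (W * X + U * Z) = W * (W' * W) * X + U * g * (U' * W) * X +
          W * n * (U' * W) * X + W * (W' * U) * Z + U * g * (U' * U) * Z + W * n * (U' * U) * Z := by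
        simp only [h, Matrix.add_mul, Matrix.mul_add, Matrix.mul_assoc]
        abel
      rw [h1, hW, hU, hWU, hUW]
      simp only [Matrix.mul_one, Matrix.mul_zero, Matrix.zero_mul, add_zero, Matrix.mul_add,
        Matrix.mul_assoc]
      abel
    change restr φ W (W * (X + n * Z) + U * (g * Z)) = restr φ W (W * X + U * Z)
    rw [← hhx]
    conv_lhs => rw [← hhW]
    rw [hhW]
    have := restr_conj hφ W (W * X + U * Z) h h' hh
    rwa [hhW] at this
  · intro X Z η hη
    obtain ⟨i₀, hi₀⟩ := Function.ne_iff.mp hη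
    obtain ⟨l, hl⟩ : ∃ l, Fintype.card α = l + 1 :=
      Nat.exists_eq_succ_of_ne_zero (Fintype.card_pos_iff.mpr ⟨i₀⟩).ne'
    obtain ⟨N, N', a1, a2, a3, a4⟩ := exists_split (Matrix.replicateCol Unit η)
      (Matrix.replicateRow Unit (Pi.single i₀ (η i₀)⁻¹)) (by
        ext
        simp [Matrix.mul_apply, Pi.single_apply]
        exact inv_mul_cancel₀ hi₀) l (by rw [hl]; simp [add_comm])
    have hηN : η ᵥ* N'ᵀ = 0 := by
      rw [Matrix.vecMul_transpose]
      ext k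
      have := congrFun (congrFun a3 k) ()
      simpa [Matrix.mul_apply, Matrix.mulVec, dotProduct] using this
    have hcol : ∀ y : Matrix ι α F, y * N'ᵀ = 0 → ∃ v, y = vecMulVec v η := by
      intro y hy
      refine ⟨y *ᵥ (Pi.single i₀ (η i₀)⁻¹), ?_⟩
      have h1 := congrArg Matrix.transpose a4
      rw [Matrix.transpose_add, Matrix.transpose_mul, Matrix.transpose_mul] at h1
      have h2 := congrArg (fun M => y * M) h1
      simp only [Matrix.mul_add, ← Matrix.mul_assoc, hy, Matrix.zero_mul, add_zero,
        Matrix.transpose_one, Matrix.mul_one] at h2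
      ext i j
      rw [← congrFun (congrFun h2 i) j, Matrix.mul_apply]
      simp only [Finset.univ_unique, Finset.sum_singleton]
      rfl
    have hWN : LInv (W * N'ᵀ) :=
      LInv.mul ⟨W', hW⟩ ⟨Nᵀ, by rw [← Matrix.transpose_mul, a1, Matrix.transpose_one]⟩
    have hvan := hv l hl.symm (W * N'ᵀ) hWN ((W * X + U * Z) * N'ᵀ)
    rw [← hvan]
    unfold restr
    have hswap : ∀ M : Matrix ι ι F, (∑ x : α → F, ∑ y : σ → F,
        if M * W = W * (X + vecMulVec x η) + U * (Z + vecMulVec y η) then φ M else 0) =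
        if M * (W * N'ᵀ) = (W * X + U * Z) * N'ᵀ then φ M else 0 := by
      intro M
      have hrw : ∀ x y, W * (X + vecMulVec x η) + U * (Z + vecMulVec y η) =
          W * X + U * Z + vecMulVec (W *ᵥ x + U *ᵥ y) η := by
        intro x y
        rw [Matrix.mul_add, Matrix.mul_add, Matrix.mul_vecMulVec, Matrix.mul_vecMulVec,
          Matrix.add_vecMulVec]
        abel
      simp only [hrw]
      split_ifs with hM
      · obtain ⟨v, hv'⟩ := hcol (M * W - (W * X + U * Z)) (by
          rw [Matrix.sub_mul, Matrix.mul_assoc, hM, sub_self])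
        have huniq : ∀ x y, M * W = W * X + U * Z + vecMulVec (W *ᵥ x + U *ᵥ y) η ↔
            x = W' *ᵥ v ∧ y = U' *ᵥ v := by
          intro x y
          rw [← sub_eq_iff_eq_add', hv']
          constructor
          · intro h2
            have h3 : v = W *ᵥ x + U *ᵥ y := by
              ext i
              have := congrFun (congrFun h2 i) i₀
              simp only [vecMulVec_apply] at this
              exact mul_right_cancel₀ hi₀ this
            rw [h3]
            simp [Matrix.mulVec_add, Matrix.mulVec_mulVec, hW, hU, hWU, hUW]
          · rintro ⟨rfl, rfl⟩
            rw [Matrix.mulVec_mulVec, Matrix.mulVec_mulVec, ← Matrix.add_mulVec, hsum,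
              Matrix.one_mulVec]
        simp only [huniq]
        rw [Finset.sum_eq_single (W' *ᵥ v), Finset.sum_eq_single (U' *ᵥ v)]
        · simp
        · intro y _ hy
          simp [hy]
        · simp
        · intro x _ hx
          simp [hx]
        · simp
      · refine Finset.sum_eq_zero fun x _ => Finset.sum_eq_zero fun y _ => if_neg ?_
        intro h2
        apply hM
        rw [← Matrix.mul_assoc, h2, Matrix.add_mul, Matrix.vecMulVec_mul, hηN]
        ext
        simp [vecMulVec_apply]
    rw [← Finset.sum_congr rfl fun M _ => hswap M]
    rw [Finset.sum_comm]
    rw [Finset.sum_comm]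
    conv_rhs => rw [Finset.sum_comm]
    refine Finset.sum_congr rfl fun x _ => ?_
    rw [Finset.sum_comm]

end Restriction

section Sums
variable {F : Type} [Fintype F] {ι κ σ τ : Type} [Fintype ι] [DecidableEq ι]
  [Fintype κ] [DecidableEq κ] [Fintype σ] [DecidableEq σ] [Fintype τ] [DecidableEq τ]

lemma sum_fromRows {E : Type} [AddCommMonoid E] (f : Matrix (κ ⊕ σ) τ F → E) :
    ∑ A, f A = ∑ A₁ : Matrix κ τ F, ∑ A₂ : Matrix σ τ F, f (fromRows A₁ A₂) := by
  rw [← Finset.sum_product', Finset.univ_product_univ]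
  refine (Finset.sum_bij' (fun P _ => fromRows P.1 P.2) (fun A _ => (A.toRows₁, A.toRows₂))
    (by simp) (by simp) (by simp) (by simp) (by simp)).symm

lemma sum_fromCols {E : Type} [AddCommMonoid E] (f : Matrix τ (κ ⊕ σ) F → E) :
    ∑ A, f A = ∑ A₁ : Matrix τ κ F, ∑ A₂ : Matrix τ σ F, f (fromCols A₁ A₂) := by
  rw [← Finset.sum_product', Finset.univ_product_univ]
  refine (Finset.sum_bij' (fun P _ => fromCols P.1 P.2) (fun A _ => (A.toCols₁, A.toCols₂))
    (by simp) (by simp) (by simp) (by simp) (by simp)).symm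

end Sums

section Fourier
variable {F : Type} [Field F] [Fintype F] {ι κ σ : Type} [Fintype ι] [DecidableEq ι]
  [Fintype κ] [DecidableEq κ] [Fintype σ] [DecidableEq σ]

/-- Orthogonality of the characters `ψ (tr (B A))` of a matrix space. -/
lemma sum_psi_trace {ψ : AddChar F ℂ} (hψ : ψ ≠ 1) (A : Matrix κ σ F) :
    ∑ B : Matrix σ κ F, ψ (-(B * A).trace) =
      if A = 0 then (Fintype.card (Matrix σ κ F) : ℂ) else 0 := by
  split_ifs with hA
  · simp [hA]
  · obtain ⟨x, hx⟩ : ∃ x, ψ x ≠ 1 := by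
      by_contra! h
      exact hψ (by ext x; simp [h x])
    obtain ⟨i, j, hij⟩ : ∃ i j, A i j ≠ 0 := by
      by_contra! h
      exact hA (by ext i j; simp [h i j])
    let B₀ : Matrix σ κ F := Matrix.single j i (-x * (A i j)⁻¹)
    have h0 : -(B₀ * A).trace = x := by
      rw [Matrix.trace_single_mul]
      simp
      field_simp
    have h1 : ∑ B : Matrix σ κ F, ψ (-(B * A).trace) =
        ψ x * ∑ B : Matrix σ κ F, ψ (-(B * A).trace) := by
      rw [Finset.mul_sum]
      conv_lhs => rw [← Equiv.sum_comp (Equiv.addLeft B₀)]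
      refine Finset.sum_congr rfl fun B _ => ?_
      rw [Equiv.coe_addLeft, Matrix.add_mul, Matrix.trace_add, neg_add, AddChar.map_add_eq_mul, h0]
    by_contra hne
    apply hx
    have h2 : (1 : ℂ) * ∑ B : Matrix σ κ F, ψ (-(B * A).trace) =
        ψ x * ∑ B : Matrix σ κ F, ψ (-(B * A).trace) := by rw [one_mul]; exact h1
    exact (mul_right_cancel₀ hne h2).symm

/-- The Fourier transform of the indicator function of the invertible matrices. -/
noncomputable def glSum (ψ : AddChar F ℂ) (A : Matrix κ κ F) : ℂ :=
  ∑ C : Matrix κ κ F, if C.det ≠ 0 then ψ (-(C * A).trace) else 0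

lemma glSum_eq {ψ : AddChar F ℂ} (hψ : ψ ≠ 1) (t : ℕ) (K : Matrix κ (Fin t) F)
    (Z : Matrix (Fin t) κ F) (hK : LInv K) (hZ : RInv Z) :
    glSum ψ (K * Z) = lam (Fintype.card F) (Fintype.card κ) (Fintype.card κ) t *
      (Fintype.card (Matrix κ (Fin t) F) *
        ((Finset.univ.filter fun C : Matrix κ κ F => C.det ≠ 0).card : ℂ)) := by
  have := extension_formula (fun (_ : Matrix κ κ F) (Z : Matrix κ κ F) => glSum ψ Z) ?_ ?_ t
    (Fin t) (by simp) 0 K Z hK hZ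
  · rw [this]
    simp [glSum, Finset.sum_ite]
  · intro n g g' hg X Z
    unfold glSum
    have hg' := mul_eq_one_comm.mp hg
    refine Finset.sum_bij' (fun C _ => C * g) (fun C _ => C * g') (by simp) (by simp)
      ?_ ?_ ?_
    · intro C _
      rw [Matrix.mul_assoc, hg, Matrix.mul_one]
    · intro C _
      rw [Matrix.mul_assoc, hg', Matrix.mul_one]
    · intro C _
      have h1 : g.det ≠ 0 := by
        intro h0
        have := congrArg Matrix.det hg
        simp [h0] at this
      simp [Matrix.mul_assoc, h1]
  · intro X Z η hη
    rw [Finset.sum_const, smul_eq_zero]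
    right
    unfold glSum
    rw [Finset.sum_comm]
    refine Finset.sum_eq_zero fun C _ => ?_
    split_ifs with hC
    · have h1 : ∀ y : κ → F, ψ (-(C * (Z + vecMulVec y η)).trace) =
          ψ (-(C * Z).trace) * ψ (-((Matrix.replicateRow Unit y) *
            (Matrix.replicateCol Unit (η ᵥ* C))).trace) := by
        intro y
        rw [Matrix.mul_add, Matrix.trace_add, neg_add, AddChar.map_add_eq_mul]
        congr 3
        rw [Matrix.mul_vecMulVec, Matrix.trace_vecMulVec]
        simp only [Matrix.trace, Matrix.mul_apply, Matrix.diag_apply, Finset.univ_unique,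
          Finset.sum_singleton, Matrix.replicateRow_apply, Matrix.replicateCol_apply]
        rw [dotProduct_comm, Matrix.dotProduct_mulVec, dotProduct_comm]
        rfl
      rw [Finset.sum_congr rfl fun y _ => h1 y, ← Finset.mul_sum]
      have h2 := sum_psi_trace hψ (Matrix.replicateCol Unit (η ᵥ* C))
      rw [if_neg] at h2
      · convert mul_zero _
        rw [← h2]
        refine Finset.sum_bij' (fun y _ => Matrix.replicateRow Unit y) (fun B _ => B ()) (by simp)
          (by simp) (fun _ _ => rfl) (fun _ _ => rfl) (fun _ _ => rfl)
      · intro h3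
        apply hη
        have h4 : η ᵥ* C = 0 := by
          ext i
          exact congrFun (congrFun h3 i) ()
        have := congrArg (fun v => v ᵥ* C⁻¹) h4
        simpa [Matrix.vecMul_vecMul, Matrix.mul_nonsing_inv C (Ne.isUnit hC)] using this
    · simp

lemma exists_lInv_fin {b s : ℕ} (h : b ≤ s) : ∃ K : Matrix (Fin s) (Fin b) F, LInv K := by
  refine ⟨(1 : Matrix (Fin s) (Fin s) F).submatrix id (Fin.castLE h),
    (1 : Matrix (Fin s) (Fin s) F).submatrix (Fin.castLE h) id, ?_⟩
  rw [← Matrix.submatrix_mul _ _ _ _ _ Function.bijective_id, Matrix.one_mul]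
  exact Matrix.submatrix_one _ (Fin.castLE_injective h)

/-- A corner can be enlarged by rows killing its column space. -/
lemma exists_rows {p₀ b : ℕ} (Y : Matrix κ (Fin p₀) F) (Z : Matrix (Fin p₀) κ F) (hY : LInv Y)
    (hZ : RInv Z) (hZY : Z * Y = 0) (h : p₀ + b + p₀ ≤ Fintype.card κ) :
    ∃ Z₁ : Matrix (Fin b) κ F, Z₁ * Y = 0 ∧ RInv (fromRows Z Z₁) := by
  obtain ⟨Y', hY'⟩ := hY
  obtain ⟨V, hV⟩ := hZ
  obtain ⟨s, hs⟩ := Nat.exists_eq_add_of_le (show p₀ + p₀ ≤ Fintype.card κ by omega)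
  obtain ⟨U, U', h1, h2, h3, -⟩ := exists_split (fromCols Y V) (fromRows (Y' - Y' * V * Z) Z) (by
    rw [fromRows_mul_fromCols, ← fromBlocks_one]
    congr 1
    · rw [Matrix.sub_mul, hY', Matrix.mul_assoc, hZY]; simp
    · rw [Matrix.sub_mul, Matrix.mul_assoc _ Z, hV]; simp) s (by rw [hs]; simp)
  obtain ⟨K, K', hK⟩ := exists_lInv_fin (F := F) (show b ≤ s by omega)
  rw [Matrix.mul_fromCols, ← fromCols_zero] at h3
  have h3 := fromCols_inj h3
  rw [fromRows_mul, ← fromRows_zero] at h2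
  have h2 := fromRows_inj h2
  refine ⟨K' * U', by rw [Matrix.mul_assoc, h3.1, Matrix.mul_zero], fromCols V (U * K), ?_⟩
  rw [fromRows_mul_fromCols, ← fromBlocks_one]
  congr 1
  · rw [← Matrix.mul_assoc, h2.2, Matrix.zero_mul]
  · rw [Matrix.mul_assoc, h3.2, Matrix.mul_zero]
  · rw [Matrix.mul_assoc, ← Matrix.mul_assoc U', h1, Matrix.one_mul, hK]

end Fourier

section Positivity
variable {d : Type} [Fintype d] [DecidableEq d]

open scoped ComplexOrder in
lemma trace_mul_nonneg (P G : Matrix d d ℂ) (m k : ℝ) (hm : 0 < m) (hk : 0 < k) (hP : Pᴴ = P)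
    (hG : Gᴴ = G) (hPP : P * P = (m : ℂ) • P) (hGG : G * G = (k : ℂ) • G) : 0 ≤ (P * G).trace := by
  have h1 : 0 ≤ ((P * G)ᴴ * (P * G)).trace := (posSemidef_conjTranspose_mul_self _).trace_nonneg
  have h2 : ((P * G)ᴴ * (P * G)).trace = (m : ℂ) * (k : ℂ) * (P * G).trace := by
    rw [conjTranspose_mul, hP, hG, Matrix.mul_assoc, ← Matrix.mul_assoc P P, hPP,
      Matrix.trace_mul_comm, Matrix.mul_assoc, hGG]
    simp only [Matrix.trace_smul, smul_eq_mul, Matrix.mul_smul, Matrix.smul_mul, mul_assoc]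
    ring
  rw [h2] at h1
  have h3 : (0 : ℂ) ≤ ((m * k)⁻¹ : ℝ) := by exact_mod_cast (inv_pos.mpr (mul_pos hm hk)).le
  have h4 := mul_nonneg h3 h1
  have hm' : (m : ℂ) ≠ 0 := by exact_mod_cast hm.ne'
  have hk' : (k : ℂ) ≠ 0 := by exact_mod_cast hk.ne'
  have h5 : (((m * k)⁻¹ : ℝ) : ℂ) * (m * k * (P * G).trace) = (P * G).trace := by
    push_cast
    field_simp
  rwa [h5] at h4

end Positivity

section FixSum
variable {F : Type} [Field F] [Fintype F] {ι α d : Type} [Fintype ι] [DecidableEq ι]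
  [Fintype α] [DecidableEq α] [Fintype d] [DecidableEq d]

/-- The sum of a representation over the pointwise stabilizer of the column space of `W`. -/
noncomputable def fixSum (R : Matrix ι ι F → Matrix d d ℂ) (W : Matrix ι α F) : Matrix d d ℂ :=
  ∑ h : Matrix ι ι F, if h * W = W then R h else 0

/-- The order of the pointwise stabilizer of the column space of `W`. -/
noncomputable def fixCard (W : Matrix ι α F) : ℕ :=
  (Finset.univ.filter fun h : Matrix ι ι F => h * W = W ∧ h.det ≠ 0).card

lemma fixCard_pos (W : Matrix ι α F) : 0 < fixCard W :=
  Finset.card_pos.mpr ⟨1, by simp⟩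

lemma exists_inv_of_det_ne_zero {X : Matrix ι ι F} (h : X.det ≠ 0) : ∃ X', X * X' = 1 ∧ X' * X = 1 :=
  ⟨X⁻¹, Matrix.mul_nonsing_inv X (Ne.isUnit h), Matrix.nonsing_inv_mul X (Ne.isUnit h)⟩

lemma det_ne_zero_of_mul {X Y : Matrix ι ι F} (h : X * Y = 1) : X.det ≠ 0 := by
  intro h0
  have := congrArg Matrix.det h
  simp [h0] at this

lemma mul_fixSum_of_conj (R : Matrix ι ι F →* Matrix d d ℂ) (W : Matrix ι α F)
    (g g' : Matrix ι ι F) (x x' : Matrix α α F) (hg : g * g' = 1) (hx : x * x' = 1)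
    (hW : g * W = W * x) : R g * fixSum R W = fixSum R W * R g := by
  have hg' := mul_eq_one_comm.mp hg
  have hW' : g' * W = W * x' := by
    calc g' * W = g' * (W * (x * x')) := by rw [hx, Matrix.mul_one]
      _ = g' * (g * W) * x' := by rw [hW]; simp only [Matrix.mul_assoc]
      _ = W * x' := by rw [← Matrix.mul_assoc g', hg', Matrix.one_mul]
  unfold fixSum
  rw [Finset.mul_sum, Finset.sum_mul]
  refine Finset.sum_bij' (fun h _ => g * h * g') (fun h _ => g' * h * g) (by simp) (by simp)
    ?_ ?_ ?_
  · intro h _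
    calc g' * (g * h * g') * g = (g' * g) * h * (g' * g) := by simp only [Matrix.mul_assoc]
      _ = h := by rw [hg', Matrix.one_mul, Matrix.mul_one]
  · intro h _
    calc g * (g' * h * g) * g' = (g * g') * h * (g * g') := by simp only [Matrix.mul_assoc]
      _ = h := by rw [hg, Matrix.one_mul, Matrix.mul_one]
  · intro h _
    have e1 : g * h * g' * W = W ↔ h * W = W := by
      constructor
      · intro e
        calc h * W = h * W * (x' * x) := by rw [mul_eq_one_comm.mp hx, Matrix.mul_one]
          _ = h * (g' * W) * x := by rw [hW']; simp only [Matrix.mul_assoc]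
          _ = g' * (g * h * g' * W) * x := by
            rw [show g' * (g * h * g' * W) = (g' * g) * (h * (g' * W)) by
              simp only [Matrix.mul_assoc], hg', Matrix.one_mul]
          _ = W := by rw [e, hW', Matrix.mul_assoc, mul_eq_one_comm.mp hx, Matrix.mul_one]
      · intro e
        rw [Matrix.mul_assoc, Matrix.mul_assoc, hW', ← Matrix.mul_assoc h, e, ← Matrix.mul_assoc,
          hW, Matrix.mul_assoc, hx, Matrix.mul_one]
    simp only [e1]
    split_ifs
    · rw [← map_mul, ← map_mul, Matrix.mul_assoc, hg', Matrix.mul_one]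
    · simp

lemma mul_fixSum_of_fix (R : Matrix ι ι F →* Matrix d d ℂ) (W : Matrix ι α F)
    (g g' : Matrix ι ι F) (hg : g * g' = 1) (hW : g * W = W) :
    R g * fixSum R W = fixSum R W := by
  have hg' := mul_eq_one_comm.mp hg
  unfold fixSum
  rw [Finset.mul_sum]
  refine Finset.sum_bij' (fun h _ => g * h) (fun h _ => g' * h) (by simp) (by simp)
    ?_ ?_ ?_
  · intro h _
    rw [← Matrix.mul_assoc, hg', Matrix.one_mul]
  · intro h _
    rw [← Matrix.mul_assoc, hg, Matrix.one_mul]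
  · intro h _
    have e1 : g * h * W = W ↔ h * W = W := by
      constructor
      · intro e
        rw [← Matrix.one_mul (h * W), ← hg', Matrix.mul_assoc, ← Matrix.mul_assoc g, e]
        nth_rw 1 [← hW]
        rw [← Matrix.mul_assoc, hg', Matrix.one_mul]
      · intro e
        rw [Matrix.mul_assoc, e, hW]
    simp only [e1]
    split_ifs
    · rw [← map_mul]
    · simp

lemma fixSum_mul_self (R : Matrix ι ι F →* Matrix d d ℂ) (hR : ∀ X, X.det = 0 → R X = 0)
    (W : Matrix ι α F) : fixSum R W * fixSum R W = (fixCard W : ℂ) • fixSum R W := by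
  conv_lhs => enter [1]; unfold fixSum
  rw [Finset.sum_mul]
  have h1 : ∀ h : Matrix ι ι F, (if h * W = W then R h else 0) * fixSum R W =
      if h * W = W ∧ h.det ≠ 0 then fixSum R W else 0 := by
    intro h
    by_cases hd : h.det = 0
    · simp [hd, hR h hd]
    · by_cases hW : h * W = W
      · obtain ⟨h', e, -⟩ := exists_inv_of_det_ne_zero hd
        simp [hW, hd, mul_fixSum_of_fix R W h h' e hW]
      · simp [hW]
  rw [Finset.sum_congr rfl fun h _ => h1 h, ← Finset.sum_filter, Finset.sum_const, fixCard,
    Nat.cast_smul_eq_nsmul]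

lemma fixSum_conjTranspose (R : Matrix ι ι F →* Matrix d d ℂ) (hR : ∀ X, X.det = 0 → R X = 0)
    (hu : ∀ X X', X * X' = 1 → (R X)ᴴ = R X') (W : Matrix ι α F) :
    (fixSum R W)ᴴ = fixSum R W := by
  unfold fixSum
  have hz : ∀ h : Matrix ι ι F, h.det = 0 → (if h * W = W then R h else 0) = 0 := by
    intro h hd
    simp [hR h hd]
  rw [conjTranspose_sum, sum_eq_sum_units _ hz, sum_eq_sum_units]
  · refine Finset.sum_bij' (fun g _ => g⁻¹) (fun g _ => g⁻¹) (by simp) (by simp) (by simp) (by simp)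
      fun g _ => ?_
    have e : ((g⁻¹ : GL ι F) : Matrix ι ι F) * W = W ↔ (g : Matrix ι ι F) * W = W := by
      constructor
      · intro h
        nth_rw 1 [← h]
        rw [← Matrix.mul_assoc, ← Units.val_mul, mul_inv_cancel, Units.val_one, Matrix.one_mul]
      · intro h
        nth_rw 1 [← h]
        rw [← Matrix.mul_assoc, ← Units.val_mul, inv_mul_cancel, Units.val_one, Matrix.one_mul]
    simp only [e]
    split_ifs
    · exact hu _ _ (by rw [← Units.val_mul, mul_inv_cancel, Units.val_one])
    · simp
  · intro X hX
    simp [hR X hX]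

/-- Sums over matrices with prescribed restriction as matrix coefficients. -/
lemma restr_mul_eq (R : Matrix ι ι F →* Matrix d d ℂ) (W x : Matrix ι α F) (N N' : Matrix ι ι F)
    (hN : N * N' = 1) : restr (fun X => (R X).trace) W (N * x) =
      ∑ X : Matrix ι ι F, if X * W = x then (R (N * X)).trace else 0 := by
  have hN' := mul_eq_one_comm.mp hN
  unfold restr
  refine Finset.sum_bij' (fun X _ => N' * X) (fun X _ => N * X) (by simp) (by simp) ?_ ?_ ?_
  · intro X _
    rw [← Matrix.mul_assoc, hN, Matrix.one_mul]
  · intro X _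
    rw [← Matrix.mul_assoc, hN', Matrix.one_mul]
  · intro X _
    have e : X * W = N * x ↔ N' * X * W = x := by
      constructor
      · intro e
        rw [Matrix.mul_assoc, e, ← Matrix.mul_assoc, hN', Matrix.one_mul]
      · intro e
        rw [← e, ← Matrix.mul_assoc, ← Matrix.mul_assoc, hN, Matrix.one_mul]
    simp only [e, ← Matrix.mul_assoc, hN, Matrix.one_mul]

lemma restr_eq_trace_fixSum (R : Matrix ι ι F →* Matrix d d ℂ) (W : Matrix ι α F)
    (N N' : Matrix ι ι F) (hN : N * N' = 1) :
    restr (fun X => (R X).trace) W (N * W) = (R N * fixSum R W).trace := by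
  rw [restr_mul_eq R W W N N' hN, fixSum, Finset.mul_sum, Matrix.trace_sum]
  refine Finset.sum_congr rfl fun X _ => ?_
  split_ifs
  · rw [map_mul]
  · simp

end FixSum

section Unitary
variable {F : Type} [Field F] [Fintype F] {ι d : Type} [Fintype ι] [DecidableEq ι]
  [Fintype d] [DecidableEq d]

open scoped ComplexOrder MatrixOrder in
/-- Every representation is equivalent to a unitary one. -/
lemma exists_unitary (R : Matrix ι ι F →* Matrix d d ℂ) :
    ∃ (R' : Matrix ι ι F →* Matrix d d ℂ) (T T' : Matrix d d ℂ), T * T' = 1 ∧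
      (∀ X, R' X = T * R X * T') ∧ ∀ X X', X * X' = 1 → (R' X)ᴴ = R' X' := by
  let S : Matrix d d ℂ := ∑ X : Matrix ι ι F, (R X)ᴴ * R X
  have hinv : ∀ g g' : Matrix ι ι F, g * g' = 1 → (R g)ᴴ * S * R g = S := by
    intro g g' hg
    have hg' := mul_eq_one_comm.mp hg
    simp only [S, Finset.mul_sum, Finset.sum_mul]
    refine Finset.sum_bij' (fun X _ => X * g) (fun X _ => X * g') (by simp) (by simp) ?_ ?_ ?_
    · intro X _
      rw [Matrix.mul_assoc, hg, Matrix.mul_one]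
    · intro X _
      rw [Matrix.mul_assoc, hg', Matrix.mul_one]
    · intro X _
      rw [map_mul, conjTranspose_mul]
      simp only [Matrix.mul_assoc]
  have hS : S.PosDef := by
    have h1 : S = 1 + ∑ X ∈ Finset.univ.erase (1 : Matrix ι ι F), (R X)ᴴ * R X := by
      simp only [S]
      rw [← Finset.add_sum_erase _ _ (Finset.mem_univ (1 : Matrix ι ι F)), map_one]
      simp
    rw [h1]
    exact PosDef.one.add_posSemidef
      (posSemidef_sum _ fun X _ => posSemidef_conjTranspose_mul_self _)
  obtain ⟨T, hT⟩ : ∃ T : Matrix d d ℂ, S = Tᴴ * T := by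
    have := CStarAlgebra.nonneg_iff_eq_star_mul_self.mp (Matrix.nonneg_iff_posSemidef.mpr hS.posSemidef)
    exact this
  obtain ⟨T', hT'⟩ : ∃ T', T * T' = 1 := by
    have h1 : IsUnit (Tᴴ * T) := hT ▸ hS.isUnit
    obtain ⟨u, hu⟩ := h1
    refine ⟨((u⁻¹ : (Matrix d d ℂ)ˣ) : Matrix d d ℂ) * Tᴴ, ?_⟩
    rw [mul_eq_one_comm, Matrix.mul_assoc, ← hu, ← Units.val_mul, inv_mul_cancel, Units.val_one]
  have hT'' := mul_eq_one_comm.mp hT'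
  refine ⟨⟨⟨fun X => T * R X * T', by rw [map_one, Matrix.mul_one, hT']⟩, fun X Y => ?_⟩, T, T',
    hT', fun X => rfl, fun X X' e => ?_⟩
  · show T * R (X * Y) * T' = T * R X * T' * (T * R Y * T')
    rw [map_mul, show T * R X * T' * (T * R Y * T') = T * R X * (T' * T) * R Y * T' by
      simp only [Matrix.mul_assoc], hT'', Matrix.mul_one]
    simp only [Matrix.mul_assoc]
  · show (T * R X * T')ᴴ = T * R X' * T'
    have h1 := hinv X X' e
    have h2 : R X * R X' = 1 := by rw [← map_mul, e, map_one]
    have h3 : T'ᴴ * Tᴴ = 1 := by rw [← conjTranspose_mul, hT', conjTranspose_one]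
    rw [conjTranspose_mul, conjTranspose_mul]
    calc T'ᴴ * ((R X)ᴴ * Tᴴ) = T'ᴴ * ((R X)ᴴ * Tᴴ) * (T * (R X * R X') * T') := by
          rw [h2, Matrix.mul_one, hT', Matrix.mul_one]
      _ = T'ᴴ * ((R X)ᴴ * (Tᴴ * T) * R X) * R X' * T' := by simp only [Matrix.mul_assoc]
      _ = (T'ᴴ * Tᴴ) * T * R X' * T' := by rw [← hT, h1, hT]; simp only [Matrix.mul_assoc]
      _ = T * R X' * T' := by rw [h3, Matrix.one_mul]

end Unitary

section Corner
variable {F : Type} [Field F] [Fintype F] {ι α β κ σ d : Type} [Fintype ι] [DecidableEq ι]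
  [Fintype α] [DecidableEq α] [Fintype β] [DecidableEq β] [Fintype κ] [DecidableEq κ] [Fintype σ]
  [DecidableEq σ] [Fintype d] [DecidableEq d]

lemma sum_fromBlocks {E : Type} [AddCommMonoid E] (f : Matrix (κ ⊕ σ) (κ ⊕ σ) F → E) :
    ∑ A, f A = ∑ A₂ : Matrix σ (κ ⊕ σ) F, ∑ A₁ : Matrix κ (κ ⊕ σ) F, f (fromRows A₁ A₂) := by
  rw [sum_fromRows, Finset.sum_comm]

/-- The coefficients of a killed function against the degenerate corners. -/
lemma KilledFn.degenerate {ψ : AddChar F ℂ} (hψ : ψ ≠ 1) {p : ℕ} {φ : Matrix ι ι F → ℂ}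
    (h : KilledFn ψ p φ) (hp : Fintype.card κ + Fintype.card σ = p)
    (Y : Matrix ι (κ ⊕ σ) F) (Z : Matrix (κ ⊕ σ) ι F) (hY : LInv Y) (hZ : RInv Z) (hZY : Z * Y = 0)
    (C : Matrix σ σ F) (hC : C.det ≠ 0) (X : Matrix ι ι F) :
    ∑ A₂ : Matrix σ σ F, ∑ A₁ : Matrix κ (κ ⊕ σ) F, ψ (-A₁.toCols₁.trace) * ψ (-(C * A₂).trace) *
      φ (X * (1 + Y * fromRows A₁ (fromCols 0 A₂) * Z)) = 0 := by
  obtain ⟨C', e, e'⟩ := exists_inv_of_det_ne_zero hC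
  have h1 : ∀ y : Matrix κ σ F, ∑ A₂ : Matrix σ (κ ⊕ σ) F, ∑ A₁ : Matrix κ (κ ⊕ σ) F,
      ψ (-(y * A₂.toCols₁).trace) * (ψ (-A₁.toCols₁.trace) * ψ (-(C * A₂.toCols₂).trace) *
      φ (X * (1 + Y * fromRows A₁ A₂ * Z))) = 0 := by
    intro y
    rw [← h.apply (κ := κ ⊕ σ) (by simpa using hp) Y Z hY hZ hZY (fromBlocks 1 y 0 C)
      (fromBlocks 1 (-(y * C')) 0 C') (by
        rw [fromBlocks_multiply, ← fromBlocks_one]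
        congr 1
        all_goals simp [e]) X, sum_fromBlocks]
    refine Finset.sum_congr rfl fun A₂ _ => Finset.sum_congr rfl fun A₁ _ => ?_
    have h2 : (fromBlocks 1 y 0 C * fromRows A₁ A₂).trace =
        A₁.toCols₁.trace + (y * A₂.toCols₁).trace + (C * A₂.toCols₂).trace := by
      rw [fromBlocks_mul_fromRows]
      simp [Matrix.trace, Matrix.mul_apply, Finset.sum_add_distrib, Matrix.toCols₁, Matrix.toCols₂]
    rw [h2, smul_eq_mul, neg_add, neg_add, AddChar.map_add_eq_mul, AddChar.map_add_eq_mul]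
    ring
  have h3 : ∑ y : Matrix κ σ F, ∑ A₂ : Matrix σ (κ ⊕ σ) F, ∑ A₁ : Matrix κ (κ ⊕ σ) F,
      ψ (-(y * A₂.toCols₁).trace) * (ψ (-A₁.toCols₁.trace) * ψ (-(C * A₂.toCols₂).trace) *
      φ (X * (1 + Y * fromRows A₁ A₂ * Z))) = 0 := Finset.sum_eq_zero fun y _ => h1 y
  rw [Finset.sum_comm] at h3
  have h4 : ∀ A₂ : Matrix σ (κ ⊕ σ) F, (∑ y : Matrix κ σ F, ∑ A₁ : Matrix κ (κ ⊕ σ) F,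
      ψ (-(y * A₂.toCols₁).trace) * (ψ (-A₁.toCols₁.trace) * ψ (-(C * A₂.toCols₂).trace) *
      φ (X * (1 + Y * fromRows A₁ A₂ * Z)))) =
      (if A₂.toCols₁ = 0 then (Fintype.card (Matrix κ σ F) : ℂ) else 0) *
      ∑ A₁ : Matrix κ (κ ⊕ σ) F, ψ (-A₁.toCols₁.trace) * ψ (-(C * A₂.toCols₂).trace) *
      φ (X * (1 + Y * fromRows A₁ A₂ * Z)) := by
    intro A₂
    rw [← sum_psi_trace hψ, Finset.sum_mul]
    exact Finset.sum_congr rfl fun y _ => by rw [Finset.mul_sum]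
  rw [Finset.sum_congr rfl fun A₂ _ => h4 A₂, sum_fromCols, Finset.sum_eq_single 0] at h3
  · simp only [toCols₁_fromCols, toCols₂_fromCols, if_true, ← Finset.mul_sum] at h3
    exact (mul_eq_zero.mp h3).resolve_left (by simp)
  · intro b _ hb
    exact Finset.sum_eq_zero fun _ _ => by simp [hb]
  · simp

/-- The character sum over the stabilizer of a killed function. -/
lemma killed_restr_sum {ψ : AddChar F ℂ} (hψ : ψ ≠ 1) {p : ℕ} (R : Matrix ι ι F →* Matrix d d ℂ)
    (h : KilledFn ψ p (fun X => (R X).trace)) (hp : Fintype.card κ + Fintype.card β = p)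
    (W : Matrix ι α F) (W' : Matrix α ι F) (U : Matrix ι σ F) (U' : Matrix σ ι F)
    (hW : W' * W = 1) (hU : U' * U = 1) (hWU : W' * U = 0) (hUW : U' * W = 0)
    (Y : Matrix α κ F) (Z : Matrix κ α F) (Z₁ : Matrix β α F) (hY : LInv Y)
    (hZ : RInv (fromRows Z Z₁)) (hZY : Z * Y = 0) (hZY₁ : Z₁ * Y = 0)
    (K : Matrix σ β F) (hK : LInv K) (C : Matrix β β F) (hC : C.det ≠ 0) :
    ∑ A₂ : Matrix β β F, ∑ A₁ : Matrix κ (κ ⊕ β) F, ψ (-A₁.toCols₁.trace) * ψ (-(C * A₂).trace) *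
      restr (fun X => (R X).trace) W (W * (1 + Y * A₁ * fromRows Z Z₁) + U * (K * A₂ * Z₁)) = 0 := by
  obtain ⟨Y', hY'⟩ := hY
  obtain ⟨K', hK'⟩ := hK
  have hZY0 : fromRows Z Z₁ * W' * fromCols (W * Y) (U * K) = 0 := by
    rw [Matrix.mul_assoc, mul_fromCols, ← Matrix.mul_assoc, hW, Matrix.one_mul, ← Matrix.mul_assoc,
      hWU, Matrix.zero_mul, fromRows_mul_fromCols, hZY, hZY₁]
    simp
  have hLY : LInv (fromCols (W * Y) (U * K)) := by
    refine ⟨fromRows (Y' * W') (K' * U'), ?_⟩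
    rw [fromRows_mul_fromCols, ← fromBlocks_one]
    congr 1
    · rw [Matrix.mul_assoc, ← Matrix.mul_assoc W', hW, Matrix.one_mul, hY']
    · rw [Matrix.mul_assoc, ← Matrix.mul_assoc W', hWU, Matrix.zero_mul, Matrix.mul_zero]
    · rw [Matrix.mul_assoc, ← Matrix.mul_assoc U', hUW, Matrix.zero_mul, Matrix.mul_zero]
    · rw [Matrix.mul_assoc, ← Matrix.mul_assoc U', hU, Matrix.one_mul, hK']
  have hRZ : RInv (fromRows Z Z₁ * W') := hZ.mul ⟨W, hW⟩
  have key := fun X => h.degenerate hψ hp _ _ hLY hRZ hZY0 C hC X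
  have h1 : ∀ (A₂ : Matrix β β F) (A₁ : Matrix κ (κ ⊕ β) F),
      restr (fun X => (R X).trace) W (W * (1 + Y * A₁ * fromRows Z Z₁) + U * (K * A₂ * Z₁)) =
      ∑ X : Matrix ι ι F, if X * W = W then (R (X * (1 + fromCols (W * Y) (U * K) *
        fromRows A₁ (fromCols 0 A₂) * (fromRows Z Z₁ * W')))).trace else 0 := by
    intro A₂ A₁
    have e := one_add_mul_mul _ _ hZY0 (fromRows A₁ (fromCols 0 A₂)) (-fromRows A₁ (fromCols 0 A₂))
    rw [add_neg_cancel] at e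
    have e1 := restr_mul_eq R W W (1 + fromCols (W * Y) (U * K) *
      fromRows A₁ (fromCols 0 A₂) * (fromRows Z Z₁ * W')) _ (by rw [← e]; simp)
    have e2 : (1 + fromCols (W * Y) (U * K) * fromRows A₁ (fromCols 0 A₂) *
        (fromRows Z Z₁ * W')) * W =
        W * (1 + Y * A₁ * fromRows Z Z₁) + U * (K * A₂ * Z₁) := by
      rw [Matrix.add_mul, Matrix.mul_assoc, Matrix.mul_assoc _ W' W, hW, Matrix.mul_one,
        fromCols_mul_fromRows, Matrix.add_mul, Matrix.mul_add, Matrix.one_mul, Matrix.mul_one,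
        add_assoc]
      congr 2
      · simp only [Matrix.mul_assoc]
      · simp only [Matrix.mul_assoc, fromCols_mul_fromRows, Matrix.zero_mul, zero_add]
    rw [← e2, e1]
    refine Finset.sum_congr rfl fun X _ => ?_
    split_ifs
    · rw [map_mul, Matrix.trace_mul_comm, ← map_mul]
    · rfl
  simp only [h1, Finset.mul_sum]
  rw [Finset.sum_congr rfl fun A₂ _ => Finset.sum_comm, Finset.sum_comm]
  refine Finset.sum_eq_zero fun X _ => ?_
  split_ifs with hX
  · exact key X
  · simp

end Corner

section Levi
variable {F : Type} [Field F] [Fintype F] {ι α β κ σ τ d : Type} [Fintype ι] [DecidableEq ι]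
  [Fintype α] [DecidableEq α] [Fintype β] [DecidableEq β] [Fintype κ] [DecidableEq κ] [Fintype σ]
  [DecidableEq σ] [Fintype τ] [DecidableEq τ] [Fintype d] [DecidableEq d]

lemma exists_sum_one_add_mul (Z : Matrix τ α F) (hZ : RInv Z) :
    ∃ (s : ℕ) (N : Matrix α (Fin s) F), ∀ f : Matrix α α F → Matrix d d ℂ,
      ∑ B : Matrix α τ F, f (1 + B * Z) = fixSum f N := by
  obtain ⟨V, hV⟩ := hZ
  obtain ⟨s, hs⟩ : ∃ s, Fintype.card τ + s = Fintype.card α := by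
    have h1 : Fintype.card τ ≤ Fintype.card α := by
      have h2 := Matrix.rank_mul_le_right V.transpose Z.transpose
      rw [← Matrix.transpose_mul, hV, Matrix.transpose_one, Matrix.rank_one] at h2
      exact h2.trans (Matrix.rank_le_card_height _)
    exact ⟨_, Nat.add_sub_cancel' h1⟩
  obtain ⟨U, U', h1, h2, h3, h4⟩ := exists_split V Z hV s hs
  refine ⟨s, U, fun f => ?_⟩
  unfold fixSum
  rw [← Finset.sum_filter]
  refine Finset.sum_bij' (fun B _ => 1 + B * Z) (fun g _ => (g - 1) * V) ?_ (by simp) ?_ ?_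
    (fun _ _ => rfl)
  · intro B _
    simp [Matrix.add_mul, Matrix.mul_assoc, h2]
  · intro B _
    rw [add_sub_cancel_left, Matrix.mul_assoc, hV, Matrix.mul_one]
  · intro g hg
    have hg' : g * U = U := by simpa using hg
    have h5 : (g - 1) * (V * Z + U * U') = (g - 1) * V * Z := by
      rw [Matrix.mul_add, ← Matrix.mul_assoc, ← Matrix.mul_assoc, Matrix.sub_mul g 1 U, hg',
        Matrix.one_mul, sub_self, Matrix.zero_mul, add_zero]
    rw [← h5, h4, Matrix.mul_one]
    abel

/-- A decomposition of the column space into two complementary blocks. -/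
structure Split (W : Matrix ι α F) (W' : Matrix α ι F) (U : Matrix ι σ F) (U' : Matrix σ ι F) :
    Prop where
  hW : W' * W = 1
  hU : U' * U = 1
  hWU : W' * U = 0
  hUW : U' * W = 0
  hsum : W * W' + U * U' = 1

variable {W : Matrix ι α F} {W' : Matrix α ι F} {U : Matrix ι σ F} {U' : Matrix σ ι F}

lemma Split.levi_mul (h : Split W W' U U') (X X₂ : Matrix α α F) :
    (W * X * W' + U * U') * (W * X₂ * W' + U * U') = W * (X * X₂) * W' + U * U' := by
  rw [Matrix.add_mul, Matrix.mul_add, Matrix.mul_add]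
  rw [show W * X * W' * (W * X₂ * W') = W * X * (W' * W) * X₂ * W' by simp only [Matrix.mul_assoc],
    show W * X * W' * (U * U') = W * X * (W' * U) * U' by simp only [Matrix.mul_assoc],
    show U * U' * (W * X₂ * W') = U * (U' * W) * X₂ * W' by simp only [Matrix.mul_assoc],
    show U * U' * (U * U') = U * (U' * U) * U' by simp only [Matrix.mul_assoc], h.hW, h.hU, h.hWU,
    h.hUW]
  simp [Matrix.mul_assoc]

lemma Split.levi_mul_W (h : Split W W' U U') (X : Matrix α α F) :
    (W * X * W' + U * U') * W = W * X := by
  rw [Matrix.add_mul, Matrix.mul_assoc, h.hW, Matrix.mul_one, Matrix.mul_assoc, h.hUW]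
  simp

lemma Split.levi_one (h : Split W W' U U') : W * (1 : Matrix α α F) * W' + U * U' = 1 := by
  rw [Matrix.mul_one, h.hsum]

/-- The restriction of a representation to a block of a Levi subgroup. -/
def leviRep (h : Split W W' U U') (R : Matrix ι ι F →* Matrix d d ℂ) :
    Matrix α α F →* Matrix d d ℂ where
  toFun X := R (W * X * W' + U * U')
  map_one' := by rw [h.levi_one, map_one]
  map_mul' X Y := by rw [← map_mul, h.levi_mul]

lemma leviRep_apply (h : Split W W' U U') (R : Matrix ι ι F →* Matrix d d ℂ) (X : Matrix α α F) :
    leviRep h R X = R (W * X * W' + U * U') := rfl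

lemma leviRep_sing (h : Split W W' U U') (R : Matrix ι ι F →* Matrix d d ℂ)
    (hR : ∀ X, X.det = 0 → R X = 0) (X : Matrix α α F) (hX : X.det = 0) : leviRep h R X = 0 := by
  apply hR
  by_contra hd
  obtain ⟨N, -, hN⟩ := exists_inv_of_det_ne_zero hd
  have h1 : W' * N * W * X = 1 := by
    rw [Matrix.mul_assoc, ← h.levi_mul_W, ← Matrix.mul_assoc, Matrix.mul_assoc W', hN,
      Matrix.mul_one, h.hW]
  exact det_ne_zero_of_mul (mul_eq_one_comm.mp h1) hX

lemma leviRep_conjTranspose (h : Split W W' U U') (R : Matrix ι ι F →* Matrix d d ℂ)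
    (hu : ∀ X X', X * X' = 1 → (R X)ᴴ = R X') (X X' : Matrix α α F) (e : X * X' = 1) :
    (leviRep h R X)ᴴ = leviRep h R X' := by
  apply hu
  rw [h.levi_mul, e, h.levi_one]

lemma leviRep_comm (h : Split W W' U U') (R : Matrix ι ι F →* Matrix d d ℂ)
    (hR : ∀ X, X.det = 0 → R X = 0) (X : Matrix α α F) :
    leviRep h R X * fixSum R W = fixSum R W * leviRep h R X := by
  by_cases hX : X.det = 0
  · rw [leviRep_sing h R hR X hX, Matrix.zero_mul, Matrix.mul_zero]
  · obtain ⟨X', e, -⟩ := exists_inv_of_det_ne_zero hX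
    exact mul_fixSum_of_conj R W _ (W * X' * W' + U * U') X X' (by rw [h.levi_mul, e, h.levi_one]) e
      (h.levi_mul_W X)

lemma trace_mem_CF (R : Matrix ι ι F →* Matrix d d ℂ) (hR : ∀ X, X.det = 0 → R X = 0) :
    (fun X => (R X).trace) ∈ CF ι F := by
  refine ⟨fun X hX => by simp [hR X hX], fun h h' X e => ?_⟩
  dsimp only
  rw [map_mul, Matrix.trace_mul_comm, ← map_mul, ← Matrix.mul_assoc, mul_eq_one_comm.mp e,
    Matrix.one_mul]

lemma restr_eq_trace_leviRep (h : Split W W' U U') (R : Matrix ι ι F →* Matrix d d ℂ)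
    (hR : ∀ X, X.det = 0 → R X = 0) (X : Matrix α α F) :
    restr (fun X => (R X).trace) W (W * X) = (leviRep h R X * fixSum R W).trace := by
  by_cases hX : X.det = 0
  · have h1 := (restr_mem_CF (trace_mem_CF R hR) W ⟨W', h.hW⟩).1 X hX
    dsimp only at h1
    rw [leviRep_sing h R hR X hX, h1]
    simp
  · obtain ⟨X', e, -⟩ := exists_inv_of_det_ne_zero hX
    rw [← h.levi_mul_W, restr_eq_trace_fixSum R W _ (W * X' * W' + U * U')
      (by rw [h.levi_mul, e, h.levi_one]), leviRep_apply]

/-- The character sum of a representation along a possibly degenerate corner. -/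
noncomputable def wideSum (ψ : AddChar F ℂ) (R : Matrix α α F → Matrix d d ℂ) (Y : Matrix α κ F)
    (Z : Matrix (κ ⊕ β) α F) : Matrix d d ℂ :=
  ∑ A : Matrix κ (κ ⊕ β) F, ψ (-A.toCols₁.trace) • R (1 + Y * A * Z)

lemma one_add_mul_mul' (Y : Matrix α κ F) (Z : Matrix σ α F) (h : Z * Y = 0) (A B : Matrix κ σ F) :
    (1 + Y * (A + B) * Z) = (1 + Y * A * Z) * (1 + Y * B * Z) := by
  have : Y * A * Z * (Y * B * Z) = Y * A * (Z * Y) * B * Z := by simp only [Matrix.mul_assoc]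
  rw [Matrix.add_mul, Matrix.mul_add, Matrix.mul_add, Matrix.mul_add, Matrix.add_mul, this, h]
  simp only [Matrix.one_mul, Matrix.mul_one, Matrix.mul_zero, Matrix.zero_mul, add_zero]
  abel

lemma trace_toCols₁_add (A B : Matrix κ (κ ⊕ β) F) :
    (A + B).toCols₁.trace = A.toCols₁.trace + B.toCols₁.trace := by
  simp [Matrix.trace, Matrix.toCols₁, Finset.sum_add_distrib]

lemma wideSum_mul_self (ψ : AddChar F ℂ) (R : Matrix α α F →* Matrix d d ℂ) (Y : Matrix α κ F)
    (Z : Matrix (κ ⊕ β) α F) (h : Z * Y = 0) : wideSum ψ R Y Z * wideSum ψ R Y Z =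
      (Fintype.card (Matrix κ (κ ⊕ β) F) : ℂ) • wideSum ψ R Y Z := by
  apply twisted_sum_mul (fun A : Matrix κ (κ ⊕ β) F => ψ (-A.toCols₁.trace))
    (T := fun A => R (1 + Y * A * Z))
  · intro a b
    rw [one_add_mul_mul' Y Z h, map_mul]
  · intro a b
    rw [trace_toCols₁_add, neg_add, AddChar.map_add_eq_mul]

lemma wideSum_conjTranspose (ψ : AddChar F ℂ) (R : Matrix α α F →* Matrix d d ℂ)
    (hu : ∀ X X', X * X' = 1 → (R X)ᴴ = R X') (Y : Matrix α κ F)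
    (Z : Matrix (κ ⊕ β) α F) (h : Z * Y = 0) : (wideSum ψ R Y Z)ᴴ = wideSum ψ R Y Z := by
  unfold wideSum
  rw [conjTranspose_sum, ← Equiv.sum_comp (Equiv.neg _)]
  refine Finset.sum_congr rfl fun A _ => ?_
  rw [Equiv.neg_apply, conjTranspose_smul, hu (1 + Y * (-A) * Z) (1 + Y * A * Z)]
  · congr 1
    rw [show (star (ψ (-(-A).toCols₁.trace)) : ℂ) =
      (starRingEnd ℂ) (ψ (-(-A).toCols₁.trace)) from rfl, ← AddChar.map_neg_eq_conj]
    congr 1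
    simp [Matrix.trace, Matrix.toCols₁]
  · rw [← one_add_mul_mul' Y Z h, neg_add_cancel]
    simp

end Levi

section Main
variable {F : Type} [Field F] [Fintype F] {ι α β κ σ d : Type} [Fintype ι] [DecidableEq ι]
  [Fintype α] [DecidableEq α] [Fintype β] [DecidableEq β] [Fintype κ] [DecidableEq κ] [Fintype σ]
  [DecidableEq σ] [Fintype d] [DecidableEq d]
  {W : Matrix ι α F} {W' : Matrix α ι F} {U : Matrix ι σ F} {U' : Matrix σ ι F}

lemma glSum_mul_lam_pos {ψ : AddChar F ℂ} (hψ : ψ ≠ 1) (t s j : ℕ) (K : Matrix κ (Fin t) F)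
    (Z : Matrix (Fin t) κ F) (hK : LInv K) (hZ : RInv Z) (hs : Fintype.card κ ≤ s) :
    ∃ r : ℝ, 0 < r ∧ glSum ψ (K * Z) * lam (Fintype.card F) s j t = r := by
  have hq : 1 < Fintype.card F := Fintype.one_lt_card
  have ht : t ≤ Fintype.card κ := by
    obtain ⟨K', hK'⟩ := hK
    have h2 := Matrix.rank_mul_le_right K' K
    rw [hK', Matrix.rank_one, Fintype.card_fin] at h2
    exact h2.trans (Matrix.rank_le_card_height _)
  have h1 := lam_sign (Fintype.card F) (Fintype.card κ) (Fintype.card κ) hq t ht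
  have h2 := lam_sign (Fintype.card F) s j hq t (ht.trans hs)
  refine ⟨((-1) ^ t * lam (Fintype.card F) (Fintype.card κ) (Fintype.card κ) t) *
    ((-1) ^ t * lam (Fintype.card F) s j t) * ((Fintype.card (Matrix κ (Fin t) F) *
        ((Finset.univ.filter fun C : Matrix κ κ F => C.det ≠ 0).card))), ?_, ?_⟩
  · apply mul_pos (mul_pos h1 h2)
    apply mul_pos
    · exact_mod_cast Fintype.card_pos
    · exact_mod_cast Finset.card_pos.mpr ⟨1, by simp⟩
  · rw [glSum_eq hψ t K Z hK hZ]
    push_cast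
    have : ((-1 : ℂ) ^ t) * (-1) ^ t = 1 := by rw [← mul_pow]; simp
    linear_combination (-(lam (Fintype.card F) (Fintype.card κ) (Fintype.card κ) t : ℂ) *
      lam (Fintype.card F) s j t * ((Fintype.card (Matrix κ (Fin t) F) *
        ((Finset.univ.filter fun C : Matrix κ κ F => C.det ≠ 0).card)))) * this

open scoped ComplexOrder in
/-- The wide corner sums annihilate the vectors fixed by a stabilizer. -/
lemma wideSum_mul_fixSum_eq_zero {ψ : AddChar F ℂ} (hψ : ψ ≠ 1) {p : ℕ}
    (R : Matrix ι ι F →* Matrix d d ℂ) (hR : ∀ X, X.det = 0 → R X = 0)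
    (hu : ∀ X X', X * X' = 1 → (R X)ᴴ = R X')
    (h : KilledFn ψ p (fun X => (R X).trace)) (hp : Fintype.card κ + Fintype.card β = p)
    (hs : Split W W' U U')
    (hv : ∀ l, l + 1 = Fintype.card α → FixVanish l (fun X => (R X).trace))
    (Y : Matrix α κ F) (Z : Matrix κ α F) (Z₁ : Matrix β α F) (hY : LInv Y)
    (hZ : RInv (fromRows Z Z₁)) (hZY : Z * Y = 0) (hZY₁ : Z₁ * Y = 0)
    (K : Matrix σ β F) (hK : LInv K) :
    wideSum ψ (leviRep hs R) Y (fromRows Z Z₁) * fixSum R W = 0 := by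
  set ρ := leviRep hs R with hρ
  set Q := fixSum R W with hQ
  set P := wideSum ψ ρ Y (fromRows Z Z₁) with hP
  have hZY' : fromRows Z Z₁ * Y = 0 := by rw [fromRows_mul, hZY, hZY₁, fromRows_zero]
  have hcomm : P * Q = Q * P := by
    rw [hP, wideSum, Finset.sum_mul, Finset.mul_sum]
    refine Finset.sum_congr rfl fun A _ => ?_
    rw [Matrix.smul_mul, Matrix.mul_smul, leviRep_comm hs R hR]
  have hPP : P * P = (Fintype.card (Matrix κ (κ ⊕ β) F) : ℂ) • P := wideSum_mul_self ψ ρ Y _ hZY'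
  have hQQ : Q * Q = (fixCard W : ℂ) • Q := fixSum_mul_self R hR W
  have hGG : (P * Q) * (P * Q) =
      (((Fintype.card (Matrix κ (κ ⊕ β) F) : ℝ) * (fixCard W : ℝ) : ℝ) : ℂ) • (P * Q) := by
    rw [show P * Q * (P * Q) = P * (Q * P) * Q by simp only [Matrix.mul_assoc], ← hcomm,
      show P * (P * Q) * Q = (P * P) * (Q * Q) by simp only [Matrix.mul_assoc], hPP, hQQ,
      Matrix.smul_mul, Matrix.mul_smul, smul_smul]
    push_cast
    rfl
  have hGpos : (0 : ℝ) < (Fintype.card (Matrix κ (κ ⊕ β) F) : ℝ) * (fixCard W : ℝ) := by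
    apply mul_pos
    · exact_mod_cast Fintype.card_pos
    · exact_mod_cast fixCard_pos W
  have hPh : Pᴴ = P := wideSum_conjTranspose ψ ρ (leviRep_conjTranspose hs R hu) Y _ hZY'
  have hG : (P * Q)ᴴ = P * Q := by
    rw [conjTranspose_mul, hPh, fixSum_conjTranspose R hR hu W, hcomm]
  obtain ⟨V, hV⟩ := hZ
  have hZ₁ : RInv Z₁ := by
    refine ⟨V.toCols₂, ?_⟩
    rw [← fromCols_toCols V, fromRows_mul_fromCols, ← fromBlocks_one] at hV
    exact (Matrix.fromBlocks_inj.mp hV).2.2.2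
  have hcard : Fintype.card β ≤ Fintype.card σ := by
    obtain ⟨K', hK'⟩ := hK
    have h2 := Matrix.rank_mul_le_right K' K
    rw [hK', Matrix.rank_one] at h2
    exact h2.trans (Matrix.rank_le_card_height _)
  -- the contribution of each matrix to the twisted sum is nonnegative
  let Θ : Matrix β β F → ℂ := fun A₂ => ∑ A₁ : Matrix κ (κ ⊕ β) F, ψ (-A₁.toCols₁.trace) *
      restr (fun X => (R X).trace) W (W * (1 + Y * A₁ * fromRows Z Z₁) + U * (K * A₂ * Z₁))
  have hΘ0 : Θ 0 = (P * Q).trace := by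
    simp only [Θ, hP, wideSum, Finset.sum_mul, Matrix.trace_sum]
    refine Finset.sum_congr rfl fun A₁ _ => ?_
    rw [Matrix.mul_zero, Matrix.zero_mul, Matrix.mul_zero, add_zero,
      restr_eq_trace_leviRep hs R hR, Matrix.smul_mul, Matrix.trace_smul, smul_eq_mul]
  have hΘ : ∀ A₂, 0 ≤ glSum ψ A₂ * Θ A₂ := by
    intro A₂
    obtain ⟨t, K', Z', hK', hZ', rfl⟩ := exists_rank_factorization A₂
    obtain ⟨s', N, hN⟩ := exists_sum_one_add_mul (d := d) (Z' * Z₁) (hZ'.mul hZ₁)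
    obtain ⟨r, hr, hr'⟩ := glSum_mul_lam_pos hψ t (Fintype.card σ) (Fintype.card α) K' Z' hK' hZ'
      hcard
    have h1 : Θ (K' * Z') = lam (Fintype.card F) (Fintype.card σ) (Fintype.card α) t *
        (fixSum ρ N * (P * Q)).trace := by
      have h2 : ∀ A₁ : Matrix κ (κ ⊕ β) F, restr (fun X => (R X).trace) W
          (W * (1 + Y * A₁ * fromRows Z Z₁) + U * (K * (K' * Z') * Z₁)) =
          lam (Fintype.card F) (Fintype.card σ) (Fintype.card α) t *
          (fixSum ρ N * (ρ (1 + Y * A₁ * fromRows Z Z₁) * Q)).trace := by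
        intro A₁
        have h3 := restr_formula (trace_mem_CF R hR) W W' U U' hs.hW hs.hU hs.hWU hs.hUW hs.hsum hv
          t (Fin t) (by simp) (1 + Y * A₁ * fromRows Z Z₁) (K * K') (Z' * Z₁) (hK.mul hK')
          (hZ'.mul hZ₁)
        rw [show K * (K' * Z') * Z₁ = K * K' * (Z' * Z₁) by simp only [Matrix.mul_assoc], h3,
          ← hN, Finset.sum_mul, Matrix.trace_sum]
        congr 1
        refine Finset.sum_congr rfl fun B _ => ?_
        rw [restr_eq_trace_leviRep hs R hR, ← Matrix.mul_assoc (ρ _), ← map_mul]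
        congr 3
        rw [Matrix.add_mul, Matrix.one_mul, Matrix.mul_add, Matrix.mul_one,
          show B * (Z' * Z₁) * (Y * A₁ * fromRows Z Z₁) = B * Z' * (Z₁ * Y) * A₁ * fromRows Z Z₁ by
            simp only [Matrix.mul_assoc], hZY₁]
        simp [add_assoc]
      simp only [Θ, h2, hP, wideSum, Finset.sum_mul, Finset.mul_sum, Matrix.trace_sum]
      refine Finset.sum_congr rfl fun A₁ _ => ?_
      rw [Matrix.smul_mul, Matrix.mul_smul, Matrix.trace_smul, smul_eq_mul]
      ring
    rw [h1, ← mul_assoc, hr']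
    have hρR : ∀ X, X.det = 0 → ρ X = 0 := leviRep_sing hs R hR
    refine mul_nonneg (by exact_mod_cast hr.le) (trace_mul_nonneg _ _ (fixCard N) _ ?_ hGpos
      (fixSum_conjTranspose ρ hρR (leviRep_conjTranspose hs R hu) N) hG ?_ hGG)
    · exact_mod_cast fixCard_pos N
    · exact_mod_cast fixSum_mul_self ρ hρR N
  have hsum : ∑ A₂, glSum ψ A₂ * Θ A₂ = 0 := by
    have h1 : ∀ C : Matrix β β F, (if C.det ≠ 0 then
        ∑ A₂, ψ (-(C * A₂).trace) * Θ A₂ else 0) = 0 := by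
      intro C
      split_ifs with hC
      · rw [← killed_restr_sum hψ R h hp W W' U U' hs.hW hs.hU hs.hWU hs.hUW Y Z Z₁ hY ⟨V, hV⟩ hZY
          hZY₁ K hK C hC]
        refine Finset.sum_congr rfl fun A₂ _ => ?_
        simp only [Θ, Finset.mul_sum]
        refine Finset.sum_congr rfl fun A₁ _ => ?_
        ring
      · rfl
    rw [← Finset.sum_eq_zero fun C (_ : C ∈ Finset.univ) => h1 C]
    simp only [glSum, Finset.sum_mul]
    rw [Finset.sum_comm]
    refine Finset.sum_congr rfl fun C _ => ?_
    split_ifs <;> simp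
  have h0 := (Finset.sum_eq_zero_iff_of_nonneg fun A₂ _ => hΘ A₂).mp hsum 0 (Finset.mem_univ _)
  have hg0 : glSum ψ (0 : Matrix β β F) ≠ 0 := by
    simp only [glSum, Matrix.mul_zero, Matrix.trace_zero, neg_zero, AddChar.map_zero_eq_one,
      Finset.sum_boole]
    exact_mod_cast (Finset.card_pos.mpr ⟨1, by simp⟩).ne'
  rw [hΘ0] at h0
  refine eq_zero_of_quasi_idem _ _ ?_ hGG ((mul_eq_zero.mp h0).resolve_left hg0)
  exact_mod_cast hGpos.ne'

/-- The restriction of the character of a killed representation is killed at a lower level. -/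
theorem killed_restr {ψ : AddChar F ℂ} (hψ : ψ ≠ 1) {p p₀ b : ℕ}
    (R : Matrix ι ι F →* Matrix d d ℂ) (hR : ∀ X, X.det = 0 → R X = 0)
    (h : KilledFn ψ p (R : Matrix ι ι F → Matrix d d ℂ)) (hp : p₀ + b = p)
    (W : Matrix ι α F) (hW : LInv W)
    (hv : ∀ l, l + 1 = Fintype.card α → FixVanish l (fun X => (R X).trace))
    (hb : Fintype.card α + b ≤ Fintype.card ι) (hα : p + p₀ ≤ Fintype.card α) :
    KilledFn ψ p₀ (fun X => restr (fun X => (R X).trace) W (W * X)) := by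
  obtain ⟨R', T, T', hT, hR', hu⟩ := exists_unitary R
  have hT' := mul_eq_one_comm.mp hT
  have htr : (fun X => (R X).trace) = fun X => (R' X).trace := by
    ext X
    rw [hR', Matrix.trace_mul_comm, ← Matrix.mul_assoc, hT', Matrix.one_mul]
  have hRR : ∀ X, X.det = 0 → R' X = 0 := by
    intro X hX
    rw [hR', hR X hX]
    simp
  have hk : KilledFn ψ p (fun X => (R' X).trace) := by
    rw [← htr]
    exact h.comp (Matrix.traceLinearMap d ℂ ℂ)
  rw [htr] at hv ⊢
  obtain ⟨W', hW'⟩ := hW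
  obtain ⟨s, hs⟩ := Nat.exists_eq_add_of_le (show Fintype.card α ≤ Fintype.card ι by omega)
  obtain ⟨U, U', h1, h2, h3, h4⟩ := exists_split W W' hW' s hs.symm
  have hS : Split W W' U U' := ⟨hW', h1, h2, h3, h4⟩
  obtain ⟨K, hK⟩ := exists_lInv_fin (F := F) (show b ≤ s by omega)
  intro Y Z hY hZ hZY X
  obtain ⟨Z₁, hZY₁, hZ₁⟩ := exists_rows (b := b) Y Z hY hZ hZY (by omega)
  have key : ∀ z : Matrix (Fin b) (Fin p₀) F, ∑ A₁ : Matrix (Fin p₀) (Fin b) F,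
      ∑ A₀ : Matrix (Fin p₀) (Fin p₀) F, ψ (-(z * A₁).trace) * (ψ (-A₀.trace) *
        restr (fun X => (R' X).trace) W (W * (X * (1 + Y * (A₀ * Z + A₁ * Z₁))))) = 0 := by
    intro z
    have h5 := wideSum_mul_fixSum_eq_zero hψ R' hRR hu hk (by simpa using hp) hS hv Y Z (Z₁ - z * Z)
      hY (by
        obtain ⟨V, hV⟩ := hZ₁
        refine ⟨V * fromBlocks (1 : Matrix (Fin p₀) (Fin p₀) F) 0 z (1 : Matrix (Fin b) (Fin b) F), ?_⟩
        have e : fromRows Z (Z₁ - z * Z) = fromBlocks (1 : Matrix (Fin p₀) (Fin p₀) F) 0 (-z)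
            (1 : Matrix (Fin b) (Fin b) F) * fromRows Z Z₁ := by
          rw [fromBlocks_mul_fromRows]
          congr 1
          · simp
          · simp [sub_eq_add_neg, add_comm]
        rw [e, Matrix.mul_assoc, ← Matrix.mul_assoc (fromRows Z Z₁), hV, Matrix.one_mul,
          fromBlocks_multiply, ← fromBlocks_one]
        congr 1
        all_goals simp) hZY (by rw [Matrix.sub_mul, hZY₁, Matrix.mul_assoc, hZY]; simp) K hK
    have h6 := congrArg (fun M => (leviRep hS R' X * M).trace) h5
    simp only [Matrix.mul_zero, Matrix.trace_zero] at h6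
    rw [← h6, wideSum, Finset.sum_mul, Finset.mul_sum, Matrix.trace_sum, sum_fromCols]
    conv_rhs => rw [Finset.sum_comm]
    refine Finset.sum_congr rfl fun A₁ _ => ?_
    conv_rhs => rw [← Equiv.sum_comp (Equiv.addRight (A₁ * z))]
    refine Finset.sum_congr rfl fun A₀ _ => ?_
    rw [Equiv.coe_addRight]
    dsimp only
    rw [toCols₁_fromCols, Matrix.smul_mul, Matrix.mul_smul, Matrix.trace_smul,
      ← Matrix.mul_assoc (leviRep hS R' X), ← map_mul, ← restr_eq_trace_leviRep hS R' hRR, Matrix.mul_assoc Y,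
      fromCols_mul_fromRows, Matrix.trace_add, neg_add, AddChar.map_add_eq_mul,
      Matrix.trace_mul_comm z, smul_eq_mul,
      show (A₀ + A₁ * z) * Z + A₁ * (Z₁ - z * Z) = A₀ * Z + A₁ * Z₁ by
        rw [Matrix.add_mul, Matrix.mul_sub, Matrix.mul_assoc]; abel]
    ring
  have h7 : ∑ z : Matrix (Fin b) (Fin p₀) F, ∑ A₁ : Matrix (Fin p₀) (Fin b) F,
      ∑ A₀ : Matrix (Fin p₀) (Fin p₀) F, ψ (-(z * A₁).trace) * (ψ (-A₀.trace) *
        restr (fun X => (R' X).trace) W (W * (X * (1 + Y * (A₀ * Z + A₁ * Z₁))))) = 0 :=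
    Finset.sum_eq_zero fun z _ => key z
  rw [Finset.sum_comm] at h7
  have h8 : ∀ A₁ : Matrix (Fin p₀) (Fin b) F, (∑ z : Matrix (Fin b) (Fin p₀) F,
      ∑ A₀ : Matrix (Fin p₀) (Fin p₀) F, ψ (-(z * A₁).trace) * (ψ (-A₀.trace) *
        restr (fun X => (R' X).trace) W (W * (X * (1 + Y * (A₀ * Z + A₁ * Z₁)))))) =
      (if A₁ = 0 then (Fintype.card (Matrix (Fin b) (Fin p₀) F) : ℂ) else 0) *
      ∑ A₀ : Matrix (Fin p₀) (Fin p₀) F, ψ (-A₀.trace) *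
        restr (fun X => (R' X).trace) W (W * (X * (1 + Y * (A₀ * Z + A₁ * Z₁)))) := by
    intro A₁
    rw [← sum_psi_trace hψ, Finset.sum_mul]
    exact Finset.sum_congr rfl fun y _ => by rw [Finset.mul_sum]
  rw [Finset.sum_congr rfl fun A₂ _ => h8 A₂, Finset.sum_eq_single 0] at h7
  · rw [if_pos rfl] at h7
    have h9 := (mul_eq_zero.mp h7).resolve_left (by simp)
    refine Eq.trans (Finset.sum_congr rfl fun A _ => ?_) h9
    simp only [Matrix.zero_mul, add_zero, Matrix.mul_assoc Y, smul_eq_mul]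
    congr!
  · intro A₁ _ hA
    simp [hA]
  · simp

end Main

section Transvections
variable {F : Type} [Field F] {σ d : Type} [Fintype σ] [DecidableEq σ] [Fintype d] [DecidableEq d]

lemma tv_mul_left (c c' γ : σ → F) (h : γ ⬝ᵥ c' = 0) :
    (1 + vecMulVec c γ : Matrix σ σ F) * (1 + vecMulVec c' γ) = 1 + vecMulVec (c + c') γ := by
  rw [Matrix.add_mul, Matrix.mul_add, Matrix.mul_add, vecMulVec_mul_vecMulVec, h, add_vecMulVec]
  simp only [zero_smul, vecMulVec_zero, Matrix.one_mul, Matrix.mul_one]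
  abel

lemma tv_mul_right (c γ γ' : σ → F) (h : γ' ⬝ᵥ c = 0) :
    (1 + vecMulVec c γ' : Matrix σ σ F) * (1 + vecMulVec c γ) = 1 + vecMulVec c (γ + γ') := by
  rw [Matrix.add_mul, Matrix.mul_add, Matrix.mul_add, vecMulVec_mul_vecMulVec, h, vecMulVec_add]
  simp only [zero_smul, vecMulVec_zero, Matrix.one_mul, Matrix.mul_one]
  abel

variable (ρ : Matrix σ σ F →* Matrix d d ℂ) (e : Matrix d d ℂ)

lemma tv_change_left
    (htv : ∀ c γ : σ → F, γ ⬝ᵥ c = 0 → ρ (1 + vecMulVec c γ) * e = e)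
    (c c' γ : σ → F) (h : γ ⬝ᵥ c' = 0) :
    ρ (1 + vecMulVec (c + c') γ) * e = ρ (1 + vecMulVec c γ) * e := by
  rw [← tv_mul_left c c' γ h, map_mul, Matrix.mul_assoc, htv c' γ h]

lemma tv_change_right
    (hcomm : ∀ g : Matrix σ σ F, g.det ≠ 0 → ρ g * e = e * ρ g)
    (htv : ∀ c γ : σ → F, γ ⬝ᵥ c = 0 → ρ (1 + vecMulVec c γ) * e = e)
    (c γ γ' : σ → F) (h : γ' ⬝ᵥ c = 0) (hd : (1 + vecMulVec c γ).det ≠ 0) :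
    ρ (1 + vecMulVec c (γ + γ')) * e = ρ (1 + vecMulVec c γ) * e := by
  rw [← tv_mul_right c γ γ' h, map_mul, Matrix.mul_assoc, hcomm _ hd, ← Matrix.mul_assoc, htv c γ' h]

lemma diagonal_update_one (i : σ) (a : F) : diagonal (Function.update (1 : σ → F) i a) =
    1 + vecMulVec (Pi.single i 1) ((a - 1) • Pi.single i (1 : F)) := by
  ext x y
  by_cases hx : x = i <;> by_cases hy : y = i <;> by_cases hxy : x = y <;>
    simp_all [Matrix.one_apply, vecMulVec_apply, diagonal_apply, Function.update_apply, Pi.single_apply]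

lemma det_tv (c γ : σ → F) : (1 + vecMulVec c γ : Matrix σ σ F).det = 1 + γ ⬝ᵥ c := by
  rw [vecMulVec_eq Unit, det_one_add_replicateCol_mul_replicateRow]

lemma diagonal_update_eq
    (hcomm : ∀ g : Matrix σ σ F, g.det ≠ 0 → ρ g * e = e * ρ g)
    (htv : ∀ c γ : σ → F, γ ⬝ᵥ c = 0 → ρ (1 + vecMulVec c γ) * e = e)
    (i j : σ) (a : F) (ha : a ≠ 0) :
    ρ (diagonal (Function.update 1 i a)) * e = ρ (diagonal (Function.update 1 j a)) * e := by
  by_cases hij : i = j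
  · rw [hij]
  have hij' : j ≠ i := fun h => hij h.symm
  have h1 := tv_change_left ρ e htv (Pi.single i (1 : F)) (Pi.single j (1 : F))
    ((a - 1) • Pi.single i (1 : F)) (by simp [hij])
  have h2 := tv_change_right ρ e hcomm htv (Pi.single i (1 : F) + Pi.single j (1 : F))
    ((a - 1) • Pi.single i (1 : F)) ((a - 1) • (Pi.single j (1 : F) - Pi.single i (1 : F)))
    (by simp [hij, hij', sub_dotProduct]) (by rw [det_tv]; simp [hij, hij', ha])
  have h3 := tv_change_left ρ e htv (Pi.single j (1 : F)) (Pi.single i (1 : F))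
    ((a - 1) • Pi.single j (1 : F)) (by simp [hij'])
  rw [← smul_add, add_sub_cancel] at h2
  rw [diagonal_update_one, diagonal_update_one, ← h1, ← h2, add_comm (Pi.single i 1), h3]

/-- A commuting element fixed by all transvections is fixed by the whole special linear group. -/
theorem mul_eq_of_det_eq_one
    (hcomm : ∀ g : Matrix σ σ F, g.det ≠ 0 → ρ g * e = e * ρ g)
    (htv : ∀ c γ : σ → F, γ ⬝ᵥ c = 0 → ρ (1 + vecMulVec c γ) * e = e)
    (g : Matrix σ σ F) (hg : g.det = 1) : ρ g * e = e := by
  rcases isEmpty_or_nonempty σ with hσ | ⟨⟨i₀⟩⟩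
  · have : g = 1 + vecMulVec 0 0 := Subsingleton.elim _ _
    rw [this, htv _ _ (by simp)]
  set D : F → Matrix σ σ F := fun a => diagonal (Function.update 1 i₀ a) with hD
  have hDmul (a b : F) : D a * D b = D (a * b) := by
    simp only [hD, diagonal_mul_diagonal]
    congr 1
    ext x
    by_cases hx : x = i₀ <;> simp [hx]
  have hDdet (a : F) (ha : a ≠ 0) : (D a).det ≠ 0 := by
    rw [hD]
    dsimp only
    rw [det_diagonal]
    refine Finset.prod_ne_zero_iff.mpr fun x _ => ?_
    by_cases hx : x = i₀ <;> simp [hx, ha]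
  have hD1 : D 1 = 1 := by
    rw [hD]
    dsimp only
    rw [show Function.update (1 : σ → F) i₀ 1 = 1 from Function.update_eq_self i₀ _]
    exact diagonal_one
  have mulP (A B : Matrix σ σ F) (a b : F) (hB : B.det ≠ 0) (hb : b ≠ 0)
      (h1 : ρ A * e = ρ (D a) * e) (h2 : ρ B * e = ρ (D b) * e) :
      ρ (A * B) * e = ρ (D (a * b)) * e := by
    rw [map_mul, Matrix.mul_assoc, h2, hcomm _ (hDdet b hb), ← Matrix.mul_assoc, h1,
      Matrix.mul_assoc, ← hcomm _ (hDdet b hb), ← Matrix.mul_assoc, ← map_mul, hDmul]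
  have key : ρ g * e = ρ (D g.det) * e := by
    apply diagonal_transvection_induction_of_det_ne_zero (fun g => ρ g * e = ρ (D g.det) * e) g
      (by rw [hg]; exact one_ne_zero)
    · intro v hv
      have hv' : ∀ i, v i ≠ 0 := by
        rw [det_diagonal] at hv
        exact fun i => Finset.prod_ne_zero_iff.mp hv i (Finset.mem_univ _)
      have main (S : Finset σ) : ρ (diagonal fun i => if i ∈ S then v i else 1) * e =
          ρ (D (∏ i ∈ S, v i)) * e := by
        induction S using Finset.induction_on with
        | empty => simp [hD1]
        | insert i S hi ih =>
          rw [Finset.prod_insert hi]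
          have : (diagonal fun x => if x ∈ insert i S then v x else 1) =
              diagonal (Function.update 1 i (v i)) * diagonal fun x => if x ∈ S then v x else 1 := by
            rw [diagonal_mul_diagonal]
            congr 1
            ext x
            by_cases hx : x = i
            · subst hx
              simp [hi]
            · simp [hx]
          rw [this]
          refine mulP _ _ _ _ ?_ (Finset.prod_ne_zero_iff.mpr fun j _ => hv' j)
            (diagonal_update_eq ρ e hcomm htv i i₀ _ (hv' i)) ih
          rw [det_diagonal]
          refine Finset.prod_ne_zero_iff.mpr fun x _ => ?_
          split_ifs
          exacts [hv' x, one_ne_zero]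
      simpa [det_diagonal] using main Finset.univ
    · intro t
      rw [TransvectionStruct.det, hD1, TransvectionStruct.toMatrix, transvection,
        show single t.i t.j t.c = vecMulVec (Pi.single t.i 1) (t.c • Pi.single t.j (1 : F)) by
          rw [vecMulVec_smul, ← single_eq_single_vecMulVec_single, smul_single, smul_eq_mul, mul_one],
        htv _ _ (by simp [t.hij]), map_one, Matrix.one_mul]
    · intro A B _ hB h1 h2
      rw [det_mul]
      exact mulP A B _ _ hB hB h1 h2
  rw [key, hg, hD1, map_one, Matrix.one_mul]

end Transvections

section Wide
variable {F : Type} [Field F] [Fintype F] {ι α β κ σ τ d : Type} [Fintype ι] [DecidableEq ι]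
  [Fintype α] [DecidableEq α] [Fintype β] [DecidableEq β] [Fintype κ] [DecidableEq κ] [Fintype σ]
  [DecidableEq σ] [Fintype d] [DecidableEq d] {ψ : AddChar F ℂ}

lemma sum_wideSum (hψ : ψ ≠ 1) (R : Matrix ι ι F → Matrix d d ℂ) (Y : Matrix ι κ F)
    (Z : Matrix κ ι F) (Γ : Matrix σ ι F) :
    ∑ z : Matrix σ κ F, wideSum ψ R Y (fromRows Z (Γ - z * Z)) =
      (Fintype.card (Matrix σ κ F) : ℂ) • cornerSum ψ R Y Z := by
  have h1 (z : Matrix σ κ F) : wideSum ψ R Y (fromRows Z (Γ - z * Z)) =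
      ∑ A₁ : Matrix κ σ F, ψ (-(z * A₁).trace) • ∑ A₀ : Matrix κ κ F, ψ (-A₀.trace) •
        R (1 + Y * (A₀ * Z + A₁ * Γ)) := by
    rw [wideSum, sum_fromCols, Finset.sum_comm]
    refine Finset.sum_congr rfl fun A₁ _ => ?_
    rw [← Equiv.sum_comp (Equiv.addRight (A₁ * z)), Finset.smul_sum]
    refine Finset.sum_congr rfl fun A₀ _ => ?_
    rw [Equiv.coe_addRight]
    dsimp only
    rw [toCols₁_fromCols, Matrix.mul_assoc Y, fromCols_mul_fromRows, Matrix.trace_add, neg_add,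
      AddChar.map_add_eq_mul, Matrix.trace_mul_comm z, smul_smul, mul_comm,
      show (A₀ + A₁ * z) * Z + A₁ * (Γ - z * Z) = A₀ * Z + A₁ * Γ by
        rw [Matrix.add_mul, Matrix.mul_sub, Matrix.mul_assoc]; abel]
  rw [Finset.sum_congr rfl fun z _ => h1 z, Finset.sum_comm]
  rw [Finset.sum_congr rfl fun A₁ _ => (Finset.sum_smul (f := fun z : Matrix σ κ F =>
    ψ (-(z * A₁).trace))).symm, Finset.sum_eq_single 0]
  · rw [sum_psi_trace hψ, if_pos rfl]
    simp [cornerSum, Matrix.mul_assoc]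
  · intro A₁ _ hA
    rw [sum_psi_trace hψ, if_neg hA, zero_smul]
  · simp

lemma mul_wideSum (R : Matrix ι ι F →* Matrix d d ℂ) (Y : Matrix ι κ F)
    (Z : Matrix (κ ⊕ σ) ι F) (h : Z * Y = 0) (A : Matrix κ (κ ⊕ σ) F) :
    R (1 + Y * A * Z) * wideSum ψ R Y Z = ψ A.toCols₁.trace • wideSum ψ R Y Z := by
  unfold wideSum
  rw [Finset.mul_sum, Finset.smul_sum, ← Equiv.sum_comp (Equiv.addLeft A)
    (fun B => ψ A.toCols₁.trace • _)]
  refine Finset.sum_congr rfl fun B _ => ?_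
  rw [Equiv.coe_addLeft]
  dsimp only
  rw [one_add_mul_mul' Y Z h, map_mul, smul_smul, trace_toCols₁_add, neg_add,
    AddChar.map_add_eq_mul, ← mul_assoc, ← AddChar.map_add_eq_mul, add_neg_cancel,
    AddChar.map_zero_eq_one, one_mul, Matrix.mul_smul]

lemma wideSum_comm (R : Matrix ι ι F →* Matrix d d ℂ) (Y : Matrix ι κ F)
    (Z : Matrix κ ι F) (Γ : Matrix σ ι F) (g g' : Matrix ι ι F) (hg : g * g' = 1) (hY : g * Y = Y)
    (x : Matrix κ σ F) (y y' : Matrix σ σ F) (hy : y * y' = 1) (hZ : Z * g' = Z + x * Γ)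
    (hΓ : Γ * g' = y * Γ) :
    R g * wideSum ψ R Y (fromRows Z Γ) = wideSum ψ R Y (fromRows Z Γ) * R g := by
  have hy' : y' * y = 1 := mul_eq_one_comm.mp hy
  let E : Matrix κ σ F × Matrix κ κ F ≃ Matrix κ σ F × Matrix κ κ F :=
    { toFun := fun P => (P.2 * x + P.1 * y, P.2)
      invFun := fun P => ((P.1 - P.2 * x) * y', P.2)
      left_inv := fun P => by ext1 <;> simp [Matrix.mul_assoc, hy]
      right_inv := fun P => by ext1 <;> simp [Matrix.mul_assoc, hy'] }
  have hw : wideSum ψ R Y (fromRows Z Γ) = ∑ P : Matrix κ σ F × Matrix κ κ F, ψ (-P.2.trace) •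
      R (1 + Y * (P.2 * Z + P.1 * Γ)) := by
    rw [wideSum, sum_fromCols, Finset.sum_comm, ← Finset.univ_product_univ, Finset.sum_product]
    simp only [toCols₁_fromCols, Matrix.mul_assoc, fromCols_mul_fromRows]
  have h1 : R g * wideSum ψ R Y (fromRows Z Γ) * R g' = wideSum ψ R Y (fromRows Z Γ) := by
    conv_rhs => rw [hw, ← Equiv.sum_comp E]
    rw [hw, Finset.mul_sum, Finset.sum_mul]
    refine Finset.sum_congr rfl fun P _ => ?_
    rw [Matrix.mul_smul, Matrix.smul_mul, ← map_mul, ← map_mul]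
    congr 2
    change _ = 1 + Y * (P.2 * Z + (P.2 * x + P.1 * y) * Γ)
    rw [Matrix.mul_add, Matrix.mul_one, Matrix.add_mul, hg, ← Matrix.mul_assoc g, hY,
      Matrix.mul_assoc Y, Matrix.add_mul, Matrix.mul_assoc P.2, hZ, Matrix.mul_assoc P.1, hΓ]
    simp only [Matrix.mul_add, Matrix.add_mul, Matrix.mul_assoc, add_assoc]
  rw [← h1, Matrix.mul_assoc _ (R g'), ← map_mul, mul_eq_one_comm.mp hg, map_one, Matrix.mul_one, h1]

/-- A non-vanishing corner sum extends to a non-vanishing wide sum adapted to a splitting. -/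
lemma exists_wide_split (hψ : ψ ≠ 1) (R : Matrix ι ι F → Matrix d d ℂ) (Y : Matrix ι κ F)
    (Z : Matrix κ ι F) (hY : LInv Y) (hZ : RInv Z) (hZY : Z * Y = 0)
    (h : cornerSum ψ R Y Z ≠ 0) (s : ℕ) (hs : Fintype.card κ + Fintype.card κ + s = Fintype.card ι) :
    ∃ (Y' : Matrix κ ι F) (V : Matrix ι κ F) (U : Matrix ι (Fin s) F) (Γ : Matrix (Fin s) ι F),
      Split (fromCols Y V) (fromRows Y' Z) U Γ ∧ wideSum ψ R Y (fromRows Z Γ) ≠ 0 := by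
  obtain ⟨Y₀, hY₀⟩ := hY
  obtain ⟨V, hV⟩ := hZ
  obtain ⟨U, U', h1, h2, h3, h4⟩ := exists_split (fromCols Y V) (fromRows (Y₀ - Y₀ * V * Z) Z) (by
    rw [fromRows_mul_fromCols, Matrix.sub_mul, Matrix.sub_mul, Matrix.mul_assoc _ Z,
      Matrix.mul_assoc _ Z, hZY, hV, hY₀]
    simp) s (by simpa using hs)
  rw [fromRows_mul, ← fromRows_zero, fromRows_inj.eq_iff] at h2
  rw [mul_fromCols, ← fromCols_zero, fromCols_inj.eq_iff] at h3
  obtain ⟨z, hz⟩ : ∃ z : Matrix (Fin s) κ F, wideSum ψ R Y (fromRows Z (U' - z * Z)) ≠ 0 := by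
    by_contra! hc
    have := sum_wideSum hψ R Y Z U'
    rw [Finset.sum_eq_zero fun z _ => hc z] at this
    rcases smul_eq_zero.mp this.symm with h5 | h5
    · simp at h5
    · exact h h5
  refine ⟨Y₀ - Y₀ * V * Z, V + U * z, U, U' - z * Z, ⟨?_, ?_, ?_, ?_, ?_⟩, hz⟩
  · rw [fromRows_mul_fromCols, Matrix.mul_add, Matrix.mul_add, ← Matrix.mul_assoc _ U,
      ← Matrix.mul_assoc Z U, h2.1, h2.2, Matrix.sub_mul, Matrix.sub_mul, Matrix.mul_assoc _ Z,
      Matrix.mul_assoc _ Z, hZY, hV, hY₀]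
    simp
  · rw [Matrix.sub_mul, h1, Matrix.mul_assoc, h2.2]
    simp
  · rw [fromRows_mul, h2.1, h2.2, fromRows_zero]
  · rw [mul_fromCols, ← fromCols_zero, fromCols_inj.eq_iff, Matrix.sub_mul, Matrix.sub_mul, h3.1,
      Matrix.mul_add, Matrix.mul_add, h3.2, ← Matrix.mul_assoc U', h1, Matrix.mul_assoc z Z,
      Matrix.mul_assoc z Z, hZY, hV, Matrix.mul_assoc z Z, ← Matrix.mul_assoc Z, h2.2]
    simp
  · rw [← h4]
    simp only [fromCols_mul_fromRows, Matrix.add_mul, Matrix.mul_sub, Matrix.mul_assoc]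
    abel

end Wide

section Fix
variable {F : Type} [Field F] [Fintype F] {ι α β κ σ τ d : Type} [Fintype ι] [DecidableEq ι]
  [Fintype α] [DecidableEq α] [Fintype β] [DecidableEq β] [Fintype κ] [DecidableEq κ] [Fintype σ]
  [DecidableEq σ] [Fintype τ] [DecidableEq τ] [Fintype d] [DecidableEq d] {ψ : AddChar F ℂ}

lemma sum_fromBlocks' {E : Type} [AddCommMonoid E] (f : Matrix (κ ⊕ τ) (κ ⊕ τ) F → E) :
    ∑ A, f A = ∑ P : Matrix τ κ F × Matrix τ τ F, ∑ A₀ : Matrix κ (κ ⊕ τ) F,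
      f (fromRows A₀ (fromCols P.1 P.2)) := by
  rw [sum_fromRows, Finset.sum_comm, sum_fromCols, ← Finset.univ_product_univ, Finset.sum_product]

/-- Fourier inversion: a function on matrices with vanishing nonconstant coefficients is constant. -/
lemma eq_of_fourier_eq_zero {E : Type} [AddCommGroup E] [Module ℂ E] (hψ : ψ ≠ 1)
    (f : Matrix κ σ F → E)
    (h : ∀ a : Matrix σ κ F, a ≠ 0 → ∑ T, ψ (-(a * T).trace) • f T = 0) (T₁ T₂ : Matrix κ σ F) :
    f T₁ = f T₂ := by
  have key (T₀ : Matrix κ σ F) : (Fintype.card (Matrix σ κ F) : ℂ) • f T₀ = ∑ T, f T := by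
    have h1 : ∑ a : Matrix σ κ F, ψ (a * T₀).trace • ∑ T, ψ (-(a * T).trace) • f T = ∑ T, f T := by
      rw [Finset.sum_eq_single 0]
      · simp
      · intro a _ ha
        rw [h a ha, smul_zero]
      · simp
    rw [← h1]
    have h2 (T : Matrix κ σ F) : ∑ a : Matrix σ κ F, ψ (a * T₀).trace • ψ (-(a * T).trace) • f T =
        (if T - T₀ = 0 then (Fintype.card (Matrix σ κ F) : ℂ) else 0) • f T := by
      rw [← sum_psi_trace hψ, Finset.sum_smul]
      refine Finset.sum_congr rfl fun a _ => ?_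
      rw [smul_smul, ← AddChar.map_add_eq_mul, Matrix.mul_sub, Matrix.trace_sub]
      congr 2
      abel
    simp only [Finset.smul_sum]
    rw [Finset.sum_comm, Finset.sum_congr rfl fun T _ => h2 T, Finset.sum_eq_single T₀]
    · rw [if_pos (sub_self _)]
    · intro T _ hT
      rw [if_neg (sub_ne_zero.mpr hT), zero_smul]
    · simp
  have hc : (Fintype.card (Matrix σ κ F) : ℂ) ≠ 0 := by simp
  exact smul_right_injective E hc ((key T₁).trans (key T₂).symm)

lemma rInv_of_ne_zero (N : Matrix Unit σ F) (hN : N ≠ 0) : RInv N := by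
  rw [rInv_iff]
  intro x hx
  by_contra h
  apply hN
  ext i j
  have h1 := congrFun hx j
  simp only [vecMul, dotProduct, Finset.univ_unique, Finset.sum_singleton, Pi.zero_apply,
    mul_eq_zero] at h1
  rcases h1 with h1 | h1
  · exact absurd (funext fun i => h1) h
  · exact h1

/-- Transvections killing the left part act trivially on a wide sum at the edge of vanishing. -/
lemma transvection_mul_wideSum (hψ : ψ ≠ 1) {p : ℕ} (R : Matrix ι ι F →* Matrix d d ℂ)
    (h : KilledFn ψ p R) (hp : Fintype.card κ + 1 = p) (Y : Matrix ι κ F) (Z : Matrix κ ι F)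
    (Γ : Matrix σ ι F) (hY : LInv Y) (hZ : RInv (fromRows Z Γ)) (hZY : Z * Y = 0)
    (hΓY : Γ * Y = 0) (C : Matrix ι Unit F) (N : Matrix Unit σ F) (hC : Z * C = 0)
    (hN : N * Γ * C = 0) :
    R (1 + C * (N * Γ)) * wideSum ψ R Y (fromRows Z Γ) = wideSum ψ R Y (fromRows Z Γ) := by
  set e := wideSum ψ R Y (fromRows Z Γ) with he
  have hZΓY : fromRows Z Γ * Y = 0 := by rw [fromRows_mul, hZY, hΓY, fromRows_zero]
  have habs (A : Matrix κ κ F) (B : Matrix κ σ F) :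
      R (1 + Y * (A * Z + B * Γ)) * e = ψ A.trace • e := by
    have := mul_wideSum (ψ := ψ) R Y (fromRows Z Γ) hZΓY (fromCols A B)
    rwa [toCols₁_fromCols, Matrix.mul_assoc, fromCols_mul_fromRows] at this
  by_cases hCY : ∃ x : Matrix κ Unit F, C = Y * x
  · obtain ⟨x, rfl⟩ := hCY
    have := habs 0 (x * N)
    rw [Matrix.zero_mul, zero_add, Matrix.trace_zero, AddChar.map_zero_eq_one, one_smul] at this
    simpa only [Matrix.mul_assoc] using this
  by_cases hN0 : N = 0
  · rw [hN0, Matrix.zero_mul, Matrix.mul_zero, add_zero, map_one, Matrix.one_mul]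
  have hY' : LInv (fromCols Y C) := by
    rw [lInv_iff] at hY ⊢
    intro x hx
    rw [← Sum.elim_comp_inl_inr x, fromCols_mulVec_sumElim] at hx
    have hxr : x (Sum.inr ()) = 0 := by
      by_contra h0
      apply hCY
      refine ⟨Matrix.of fun i _ => -(x (Sum.inr ()))⁻¹ * x (Sum.inl i), ?_⟩
      ext i u
      have h1 := congrFun hx i
      simp only [Pi.add_apply, mulVec, dotProduct, Finset.univ_unique, Finset.sum_singleton,
        Function.comp, Pi.zero_apply, PUnit.default_eq_unit] at h1
      rw [mul_apply]
      simp only [of_apply]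
      rw [Finset.sum_congr rfl fun j _ => (show Y i j * (-(x (Sum.inr ()))⁻¹ * x (Sum.inl j)) =
        -(x (Sum.inr ()))⁻¹ * (Y i j * x (Sum.inl j)) by ring), ← Finset.mul_sum,
        eq_neg_of_add_eq_zero_left h1]
      field_simp
    have h2 : x ∘ Sum.inr = 0 := funext fun _ => hxr
    rw [h2, mulVec_zero, add_zero] at hx
    have h3 := hY _ hx
    rw [← Sum.elim_comp_inl_inr x, h2, h3]
    simp
  have hZ' : RInv (fromRows Z (N * Γ)) := by
    have h1 : fromRows Z (N * Γ) = fromBlocks (1 : Matrix κ κ F) 0 0 N * fromRows Z Γ := by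
      rw [fromBlocks_mul_fromRows]
      simp
    rw [h1]
    obtain ⟨M, hM⟩ := rInv_of_ne_zero N hN0
    refine RInv.mul ⟨fromBlocks 1 0 0 M, ?_⟩ hZ
    rw [fromBlocks_multiply, ← fromBlocks_one]
    simp [hM]
  have hZY' : fromRows Z (N * Γ) * fromCols Y C = 0 := by
    rw [fromRows_mul_fromCols, hZY, hC, Matrix.mul_assoc N, hΓY, hN]
    simp
  have hfac (a : Matrix Unit κ F) (b : Matrix Unit Unit F) (A₀ : Matrix κ (κ ⊕ Unit) F) :
      R (1 + fromCols Y C * fromRows A₀ (fromCols a b) * fromRows Z (N * Γ)) * e =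
      ψ A₀.toCols₁.trace • (R (1 + C * (a * Z + b * (N * Γ))) * e) := by
    have h1 : 1 + fromCols Y C * fromRows A₀ (fromCols a b) * fromRows Z (N * Γ) =
        (1 + C * (a * Z + b * (N * Γ))) * (1 + Y * (A₀.toCols₁ * Z + A₀.toCols₂ * N * Γ)) := by
      have h2 : C * (a * Z + b * (N * Γ)) * (Y * (A₀.toCols₁ * Z + A₀.toCols₂ * N * Γ)) = 0 := by
        rw [Matrix.mul_assoc, ← Matrix.mul_assoc _ Y, Matrix.add_mul, Matrix.mul_assoc a, hZY,
          Matrix.mul_assoc b, Matrix.mul_assoc N, hΓY]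
        simp
      rw [Matrix.add_mul 1 _ (1 + _), Matrix.mul_add (C * _) 1, h2, add_zero, Matrix.mul_one, Matrix.one_mul,
        fromCols_mul_fromRows, Matrix.add_mul, Matrix.mul_assoc C, fromCols_mul_fromRows,
        Matrix.mul_assoc Y]
      conv_lhs => rw [← fromCols_toCols A₀, fromCols_mul_fromRows]
      simp only [Matrix.mul_assoc]
      abel
    rw [h1, map_mul, Matrix.mul_assoc, habs, Matrix.mul_smul]
  have key1 (x : Matrix κ Unit F) (t : Matrix Unit Unit F) (ht : t ≠ 0) :
      ∑ P : Matrix Unit κ F × Matrix Unit Unit F, ψ (-(x * P.1).trace) • ψ (-(t * P.2).trace) •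
        (R (1 + C * (P.1 * Z + P.2 * (N * Γ))) * e) = 0 := by
    obtain ⟨t', ht'⟩ := rInv_of_ne_zero t ht
    have h1 := h.apply (κ := κ ⊕ Unit) (by simpa using hp) (fromCols Y C) (fromRows Z (N * Γ)) hY' hZ'
      hZY' (fromBlocks 1 x 0 t) (fromBlocks 1 (-(x * t')) 0 t') (by
        rw [fromBlocks_multiply, ← fromBlocks_one]
        simp [ht']) 1
    have h2 := congrArg (fun M => M * e) h1
    rw [Matrix.zero_mul, sum_fromBlocks'] at h2
    simp only [Finset.sum_mul, Matrix.one_mul, Matrix.smul_mul, hfac] at h2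
    have h3 (P : Matrix Unit κ F × Matrix Unit Unit F) (A₀ : Matrix κ (κ ⊕ Unit) F) :
        ψ (-(fromBlocks 1 x 0 t * fromRows A₀ (fromCols P.1 P.2)).trace) • ψ A₀.toCols₁.trace •
          (R (1 + C * (P.1 * Z + P.2 * (N * Γ))) * e) = ψ (-(x * P.1).trace) •
          ψ (-(t * P.2).trace) • (R (1 + C * (P.1 * Z + P.2 * (N * Γ))) * e) := by
      rw [smul_smul, smul_smul, ← AddChar.map_add_eq_mul, ← AddChar.map_add_eq_mul]
      congr 2
      conv_lhs => rw [← fromCols_toCols A₀, fromRows_fromCols_eq_fromBlocks, fromBlocks_multiply,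
        Matrix.trace, Fintype.sum_sum_type]
      simp [Matrix.trace, Finset.sum_add_distrib]
      abel
    simp only [h3, Finset.sum_const] at h2
    rw [← Finset.smul_sum, ← Nat.cast_smul_eq_nsmul ℂ] at h2
    exact (smul_eq_zero.mp h2).resolve_left (by simp)
  have key2 (t : Matrix Unit Unit F) (ht : t ≠ 0) :
      ∑ b : Matrix Unit Unit F, ψ (-(t * b).trace) • (R (1 + C * (b * (N * Γ))) * e) = 0 := by
    have h1 : ∑ x : Matrix κ Unit F, ∑ a : Matrix Unit κ F, ∑ b : Matrix Unit Unit F,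
        ψ (-(x * a).trace) • ψ (-(t * b).trace) •
        (R (1 + C * (a * Z + b * (N * Γ))) * e) = 0 := by
      refine Finset.sum_eq_zero fun x _ => ?_
      rw [← key1 x t ht, ← Finset.univ_product_univ, Finset.sum_product]
    rw [Finset.sum_comm] at h1
    simp only [← Finset.smul_sum] at h1
    simp only [← Finset.sum_smul, sum_psi_trace hψ] at h1
    rw [Finset.sum_eq_single 0] at h1
    · have h2 := (smul_eq_zero.mp h1).resolve_left (by simp)
      simpa using h2
    · intro a _ ha
      rw [if_neg ha, zero_smul]
    · simp
  have h4 := eq_of_fourier_eq_zero hψ (fun b : Matrix Unit Unit F => R (1 + C * (b * (N * Γ))) * e)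
    key2 1 0
  simpa using h4

end Fix

section Fix
variable {F : Type} [Field F] [Fintype F] {ι α β κ σ τ d : Type} [Fintype ι] [DecidableEq ι]
  [Fintype α] [DecidableEq α] [Fintype β] [DecidableEq β] [Fintype κ] [DecidableEq κ] [Fintype σ]
  [DecidableEq σ] [Fintype τ] [DecidableEq τ] [Fintype d] [DecidableEq d] {ψ : AddChar F ℂ}

lemma Split.symm {W : Matrix ι α F} {W' : Matrix α ι F} {U : Matrix ι σ F} {U' : Matrix σ ι F}
    (h : Split W W' U U') : Split U U' W W' :=
  ⟨h.hU, h.hW, h.hUW, h.hWU, by rw [add_comm, h.hsum]⟩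

lemma Split.fixing {W : Matrix ι α F} {W' : Matrix α ι F} {U : Matrix ι σ F} {U' : Matrix σ ι F}
    (h : Split W W' U U') (g : Matrix ι ι F) (hg : g.det = 1) (hW : g * W = W) :
    ∃ (a : Matrix α σ F) (x : Matrix σ σ F), x.det = 1 ∧
      g = (1 + W * a * U') * (U * x * U' + W * W') := by
  obtain ⟨g', h1, h2⟩ := exists_inv_of_det_ne_zero (X := g) (by rw [hg]; exact one_ne_zero)
  have hW' : g' * W = W := by
    conv_lhs => rw [← hW, ← Matrix.mul_assoc, h2, Matrix.one_mul]
  have hUU : U * U' = 1 - W * W' := by rw [← h.hsum]; abel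
  have h3 : U' * g * U * (U' * g' * U) = 1 := by
    rw [show U' * g * U * (U' * g' * U) = U' * g * (U * U') * (g' * U) by simp only [Matrix.mul_assoc],
      hUU, Matrix.mul_sub, Matrix.mul_one, Matrix.sub_mul, Matrix.mul_assoc U' g (g' * U),
      ← Matrix.mul_assoc g, h1, Matrix.one_mul, h.hU, Matrix.mul_assoc U' g, ← Matrix.mul_assoc g W,
      hW, ← Matrix.mul_assoc U' W, h.hUW]
    simp
  set x := U' * g * U with hx
  set x' := U' * g' * U with hx'
  have h3' : x' * x = 1 := mul_eq_one_comm.mp h3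
  have hfac : g = (1 + W * (W' * g * U * x') * U') * (U * x * U' + W * W') := by
    have e1 : W * (W' * g * U * x') * U' * (U * x * U' + W * W') = W * (W' * g * U) * U' := by
      rw [Matrix.mul_add, show W * (W' * g * U * x') * U' * (U * x * U') =
        W * (W' * g * U) * x' * (U' * U) * x * U' by simp only [Matrix.mul_assoc],
        show W * (W' * g * U * x') * U' * (W * W') = W * (W' * g * U * x') * (U' * W) * W' by
        simp only [Matrix.mul_assoc], h.hU, h.hUW, Matrix.mul_one, Matrix.mul_assoc _ x' x, h3']
      simp
    rw [Matrix.add_mul, Matrix.one_mul, e1, hx]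
    have e2 : U * (U' * g * U) * U' + W * (W' * g * U) * U' = g * U * U' := by
      rw [show U * (U' * g * U) * U' = U * U' * (g * U * U') by simp only [Matrix.mul_assoc],
        show W * (W' * g * U) * U' = W * W' * (g * U * U') by simp only [Matrix.mul_assoc],
        ← Matrix.add_mul, add_comm, h.hsum, Matrix.one_mul]
    rw [add_right_comm, e2, Matrix.mul_assoc g, hUU, Matrix.mul_sub, Matrix.mul_one,
      ← Matrix.mul_assoc g, hW, sub_add_cancel]
  refine ⟨W' * g * U * x', x, ?_, hfac⟩
  have h4 := congrArg Matrix.det hfac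
  rw [hg, det_mul, det_one_add_mul_comm, ← Matrix.mul_assoc, h.hUW, Matrix.zero_mul, add_zero, det_one,
    one_mul, show U * x * U' + W * W' = 1 + U * (x - 1) * U' by
      rw [← h.hsum, Matrix.mul_sub, Matrix.sub_mul, Matrix.mul_one]; abel,
    Matrix.mul_assoc, det_one_add_mul_comm, Matrix.mul_assoc, h.hU, Matrix.mul_one,
    add_sub_cancel] at h4
  exact h4.symm

/-- The special stabiliser of the left part acts trivially on a wide sum at the edge of vanishing. -/
lemma mul_wideSum_of_fixing (hψ : ψ ≠ 1) {p : ℕ} (R : Matrix ι ι F →* Matrix d d ℂ)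
    (h : KilledFn ψ p R) (hp : Fintype.card κ + 1 = p) {Y V : Matrix ι κ F} {Y' Z : Matrix κ ι F}
    {U : Matrix ι σ F} {Γ : Matrix σ ι F} (hS : Split (fromCols Y V) (fromRows Y' Z) U Γ)
    (hσ : 2 ≤ Fintype.card σ) (g : Matrix ι ι F) (hg : g.det = 1)
    (hW : g * fromCols Y V = fromCols Y V) :
    R g * wideSum ψ R Y (fromRows Z Γ) = wideSum ψ R Y (fromRows Z Γ) := by
  set e := wideSum ψ R Y (fromRows Z Γ) with he
  have hWW := hS.hW
  rw [fromRows_mul_fromCols, ← fromBlocks_one, fromBlocks_inj] at hWW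
  obtain ⟨hY'Y, hY'V, hZY, hZV⟩ := hWW
  have hWU := hS.hWU
  rw [fromRows_mul, ← fromRows_zero, fromRows_inj.eq_iff] at hWU
  obtain ⟨-, hZU⟩ := hWU
  have hUW := hS.hUW
  rw [mul_fromCols, ← fromCols_zero, fromCols_inj.eq_iff] at hUW
  obtain ⟨hΓY, hΓV⟩ := hUW
  have hZΓ : RInv (fromRows Z Γ) := by
    refine ⟨fromCols V U, ?_⟩
    rw [fromRows_mul_fromCols, hZV, hZU, hΓV, hS.hU, fromBlocks_one]
  have hL (x : Matrix σ σ F) : U * x * Γ + fromCols Y V * fromRows Y' Z = 1 + U * (x - 1) * Γ := by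
    rw [← hS.hsum, Matrix.mul_sub, Matrix.sub_mul, Matrix.mul_one]; abel
  set ρ := leviRep hS.symm R with hρ
  have hρx (x : Matrix σ σ F) : ρ x = R (1 + U * (x - 1) * Γ) := by
    rw [hρ, leviRep_apply, hL]
  have hcomm (x : Matrix σ σ F) (hx : x.det ≠ 0) : ρ x * e = e * ρ x := by
    obtain ⟨x', h1, h2⟩ := exists_inv_of_det_ne_zero hx
    rw [hρ, leviRep_apply]
    refine wideSum_comm R Y Z Γ _ (U * x' * Γ + fromCols Y V * fromRows Y' Z) ?_ ?_ 0 x' x h2 ?_ ?_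
    · rw [hS.symm.levi_mul, h1, hS.symm.levi_one]
    · rw [hL, Matrix.add_mul, Matrix.mul_assoc, hΓY]
      simp
    · rw [hL, Matrix.mul_add, Matrix.mul_assoc U, ← Matrix.mul_assoc Z, hZU]
      simp
    · rw [hL, Matrix.mul_add, Matrix.mul_assoc U, ← Matrix.mul_assoc Γ, hS.hU, Matrix.sub_mul]
      simp
  have hSL (x : Matrix σ σ F) (hx : x.det = 1) : ρ x * e = e := by
    refine mul_eq_of_det_eq_one ρ e hcomm (fun c γ hγ => ?_) x hx
    rw [hρx, add_sub_cancel_left]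
    have := transvection_mul_wideSum hψ R h hp Y Z Γ ⟨Y', hY'Y⟩ hZΓ hZY hΓY
      (U * replicateCol Unit c) (replicateRow Unit γ) (by rw [← Matrix.mul_assoc, hZU, Matrix.zero_mul])
      (by
        rw [Matrix.mul_assoc, ← Matrix.mul_assoc Γ, hS.hU, Matrix.one_mul]
        ext i j
        rw [replicateRow_mul_replicateCol_apply, hγ]
        rfl)
    rwa [Matrix.mul_assoc U, ← Matrix.mul_assoc (replicateCol Unit c), ← vecMulVec_eq,
      ← Matrix.mul_assoc U] at this
  have hYfix (y : Matrix κ σ F) : R (1 + Y * y * Γ) * e = e := by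
    have := mul_wideSum (ψ := ψ) R Y (fromRows Z Γ) (by rw [fromRows_mul, hZY, hΓY, fromRows_zero])
      (fromCols 0 y)
    rwa [toCols₁_fromCols, Matrix.mul_assoc, fromCols_mul_fromRows, Matrix.zero_mul, zero_add,
      Matrix.trace_zero, AddChar.map_zero_eq_one, one_smul, ← Matrix.mul_assoc] at this
  have hVmul (a b : Matrix κ σ F) : (1 + V * a * Γ) * (1 + V * b * Γ) = 1 + V * (a + b) * Γ := by
    rw [Matrix.add_mul, Matrix.mul_add, show V * a * Γ * (1 + V * b * Γ) =
      V * a * Γ + V * a * (Γ * V) * b * Γ by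
        rw [Matrix.mul_add, Matrix.mul_one]; simp only [Matrix.mul_assoc], hΓV, Matrix.mul_add,
      Matrix.add_mul]
    simp
    abel
  have hVcomm (a : Matrix κ σ F) : R (1 + V * a * Γ) * e = e * R (1 + V * a * Γ) := by
    refine wideSum_comm R Y Z Γ _ (1 + V * (-a) * Γ) (by rw [hVmul]; simp) ?_ (-a) 1 1 (by simp) ?_ ?_
    · rw [Matrix.add_mul, Matrix.mul_assoc _ Γ, hΓY]
      simp
    · rw [Matrix.mul_add, Matrix.mul_assoc V, ← Matrix.mul_assoc Z, hZV]
      simp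
    · rw [Matrix.mul_add, Matrix.mul_assoc V, ← Matrix.mul_assoc Γ, hΓV]
      simp
  have hVg (a : Matrix κ σ F) (x : Matrix σ σ F) (hx : x.det = 1) :
      R (1 + V * (a * x - a) * Γ) * e = e := by
    obtain ⟨x', h1, h2⟩ := exists_inv_of_det_ne_zero (X := x) (by rw [hx]; exact one_ne_zero)
    have hx' : x'.det = 1 := by
      have := congrArg Matrix.det h1
      rwa [det_mul, hx, one_mul, det_one] at this
    have e1 : 1 + V * (a * x - a) * Γ = (1 + V * (-a) * Γ) * ((1 + U * (x' - 1) * Γ) *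
        ((1 + V * a * Γ) * (1 + U * (x - 1) * Γ))) := by
      have e2 : (1 + V * a * Γ) * (1 + U * (x - 1) * Γ) = 1 + U * (x - 1) * Γ + V * (a * x) * Γ := by
        rw [Matrix.add_mul, Matrix.one_mul, show V * a * Γ * (1 + U * (x - 1) * Γ) =
          V * a * Γ + V * a * (Γ * U) * (x - 1) * Γ by
            rw [Matrix.mul_add, Matrix.mul_one]; simp only [Matrix.mul_assoc], hS.hU]
        simp only [Matrix.mul_sub, Matrix.sub_mul, Matrix.mul_one, Matrix.one_mul, Matrix.mul_assoc]
        abel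
      have e3 : (1 + U * (x' - 1) * Γ) * (1 + U * (x - 1) * Γ) = 1 := by
        rw [← hL, ← hL, hS.symm.levi_mul, h2, hS.symm.levi_one]
      have e4 : (1 + U * (x' - 1) * Γ) * (V * (a * x) * Γ) = V * (a * x) * Γ := by
        rw [Matrix.add_mul, show U * (x' - 1) * Γ * (V * (a * x) * Γ) =
          U * (x' - 1) * (Γ * V) * (a * x) * Γ by simp only [Matrix.mul_assoc], hΓV]
        simp
      rw [e2, Matrix.mul_add, e3, e4, hVmul]
      congr 3
      abel
    rw [e1, map_mul, map_mul, map_mul, ← hρx, ← hρx, Matrix.mul_assoc (R _) _ e,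
      Matrix.mul_assoc (ρ x') _ e, Matrix.mul_assoc (R _) (ρ x) e, hSL x hx, hVcomm,
      ← Matrix.mul_assoc (ρ x') e, hSL x' hx', ← Matrix.mul_assoc (R _) e, hVcomm,
      Matrix.mul_assoc e, ← map_mul, hVmul]
    simp
  have hVfix (a : Matrix κ σ F) : R (1 + V * a * Γ) * e = e := by
    induction a using Matrix.induction_on' with
    | h_zero => simp
    | h_add a b ha hb => rw [← hVmul, map_mul, Matrix.mul_assoc, hb, ha]
    | h_std_basis k j t =>
      have : Nontrivial σ := Fintype.one_lt_card_iff_nontrivial.mp hσ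
      obtain ⟨i, hi⟩ := exists_ne j
      have := hVg (single k i 1) (transvection i j t) (det_transvection_of_ne i j hi t)
      rwa [transvection, Matrix.mul_add, Matrix.mul_one, add_sub_cancel_left,
        single_mul_single_same, one_mul] at this
  obtain ⟨a, x, hx, rfl⟩ := hS.fixing g hg hW
  have hWa : 1 + fromCols Y V * a * Γ = (1 + Y * a.toRows₁ * Γ) * (1 + V * a.toRows₂ * Γ) := by
    conv_lhs => rw [← fromRows_toRows a, fromCols_mul_fromRows]
    rw [Matrix.add_mul 1 _ (1 + _), Matrix.one_mul, show Y * a.toRows₁ * Γ * (1 + V * a.toRows₂ * Γ) =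
      Y * a.toRows₁ * Γ + Y * a.toRows₁ * (Γ * V) * a.toRows₂ * Γ by
        rw [Matrix.mul_add, Matrix.mul_one]; simp only [Matrix.mul_assoc], hΓV, Matrix.add_mul]
    simp
    abel
  rw [map_mul, Matrix.mul_assoc, show R (U * x * Γ + fromCols Y V * fromRows Y' Z) = ρ x from rfl,
    hSL x hx, hWa, map_mul, Matrix.mul_assoc, hVfix, hYfix]

end Fix

section Twist
variable {F : Type} [Field F] [Fintype F] {ι α κ d : Type} [Fintype ι] [DecidableEq ι]
  [Fintype α] [DecidableEq α] [Fintype κ] [DecidableEq κ] [Fintype d] [DecidableEq d]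
  {ψ : AddChar F ℂ}

noncomputable instance : Fintype (MulChar F ℂ) := Fintype.ofFinite _

lemma card_mulChar : Fintype.card (MulChar F ℂ) = Fintype.card F - 1 := by
  rw [← Nat.card_eq_fintype_card, MulChar.card_eq_card_units_of_hasEnoughRootsOfUnity,
    Nat.card_eq_fintype_card, Fintype.card_units]

lemma sum_mulChar (a : F) :
    ∑ χ : MulChar F ℂ, χ a = if a = 1 then (Fintype.card (MulChar F ℂ) : ℂ) else 0 := by
  split_ifs with ha
  · simp [ha]
  · obtain ⟨χ, hχ⟩ := MulChar.exists_apply_ne_one_of_hasEnoughRootsOfUnity F ℂ ha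
    refine eq_zero_of_mul_eq_self_left hχ ?_
    simp only [Finset.mul_sum, ← MulChar.mul_apply]
    exact Fintype.sum_bijective _ (Group.mulLeft_bijective χ) _ _ fun χ' => rfl

/-- The twist of a representation by a character of the determinant. -/
noncomputable def twist (χ : MulChar F ℂ) (R : Matrix ι ι F →* Matrix d d ℂ) :
    Matrix ι ι F →* Matrix d d ℂ where
  toFun X := χ X.det • R X
  map_one' := by simp
  map_mul' X Y := by rw [det_mul, map_mul, map_mul, smul_mul_smul_comm]

lemma twist_apply (χ : MulChar F ℂ) (R : Matrix ι ι F →* Matrix d d ℂ) (X : Matrix ι ι F) :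
    twist χ R X = χ X.det • R X := rfl

lemma twist_sing (χ : MulChar F ℂ) (R : Matrix ι ι F →* Matrix d d ℂ) (X : Matrix ι ι F)
    (hX : X.det = 0) : twist χ R X = 0 := by
  rw [twist_apply, hX, MulChar.map_zero, zero_smul]

lemma sum_fixSum_twist (R : Matrix ι ι F →* Matrix d d ℂ) (W : Matrix ι α F) :
    ∑ χ : MulChar F ℂ, fixSum (twist χ R) W = (Fintype.card (MulChar F ℂ) : ℂ) •
      ∑ g : Matrix ι ι F, if g * W = W ∧ g.det = 1 then R g else 0 := by
  unfold fixSum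
  rw [Finset.sum_comm, Finset.smul_sum]
  refine Finset.sum_congr rfl fun g _ => ?_
  by_cases h : g * W = W
  · simp only [h, if_true, true_and, twist_apply]
    rw [← Finset.sum_smul, sum_mulChar]
    split_ifs <;> simp
  · simp [h]

lemma KilledFn.twist {p : ℕ} {R : Matrix ι ι F →* Matrix d d ℂ} (h : KilledFn ψ p R)
    (χ : MulChar F ℂ) : KilledFn ψ p (twist χ R) := by
  intro Y Z hY hZ hZY X
  have h1 := congrArg (χ X.det • ·) (h Y Z hY hZ hZY X)
  simp only [smul_zero, Finset.smul_sum] at h1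
  rw [← h1]
  refine Finset.sum_congr rfl fun A _ => ?_
  rw [twist_apply, det_mul, Matrix.mul_assoc Y, det_one_add_mul_comm, Matrix.mul_assoc A, hZY,
    Matrix.mul_zero, add_zero, det_one, mul_one, smul_comm]

lemma fixSum_eq_zero_of_fixVanish (R : Matrix ι ι F →* Matrix d d ℂ) (hR : ∀ X, X.det = 0 → R X = 0)
    {j : ℕ} (h : FixVanish j (fun X => (R X).trace)) (hα : Fintype.card α = j) (W : Matrix ι α F)
    (hW : LInv W) : fixSum R W = 0 := by
  refine eq_zero_of_quasi_idem _ (fixCard W : ℂ) (by exact_mod_cast (fixCard_pos W).ne')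
    (fixSum_mul_self R hR W) ?_
  have := restr_eq_trace_fixSum R W 1 1 (Matrix.one_mul 1)
  rw [map_one, Matrix.one_mul, Matrix.one_mul] at this
  rw [← this]
  exact h.restr_eq_zero hα W hW _

/-- A nonzero representation killed at level `p` has, after a twist, a vector fixed by the
pointwise stabiliser of a subspace of dimension at most `2 * (p - 1)`. -/
lemma exists_not_fixVanish (hψ : ψ ≠ 1) [Nonempty d] (R : Matrix ι ι F →* Matrix d d ℂ) {p : ℕ}
    (h : KilledFn ψ p R) (hp : 2 * p ≤ Fintype.card ι) :
    0 < p ∧ ∃ χ : MulChar F ℂ, ∃ j, j + 2 ≤ 2 * p ∧ ¬ FixVanish j (fun X => (twist χ R X).trace) := by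
  have h0 : ¬ KilledFn ψ 0 R := by
    rw [killedFn_rep_iff]
    intro h0
    have := h0 (0 : Matrix ι (Fin 0) F) (0 : Matrix (Fin 0) ι F) ⟨0, by ext i; exact i.elim0⟩
      ⟨0, by ext i; exact i.elim0⟩ (by ext i; exact i.elim0)
    simp [cornerSum, Matrix.trace] at this
    obtain ⟨i⟩ := ‹Nonempty d›
    have h1 := congrFun (congrFun this i) i
    rw [Matrix.natCast_apply, if_pos rfl] at h1
    exact Nat.cast_ne_zero.mpr Fintype.card_ne_zero h1
  have hex : ∃ r, KilledFn ψ r R := ⟨p, h⟩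
  obtain ⟨r, hr⟩ : ∃ r, Nat.find hex = r + 1 := by
    refine Nat.exists_eq_succ_of_ne_zero fun h1 => h0 ?_
    have := Nat.find_spec hex
    rwa [h1] at this
  have hk : KilledFn ψ (r + 1) R := hr ▸ Nat.find_spec hex
  have hnk : ¬ KilledFn ψ r R := Nat.find_min hex (by omega)
  have hrp : r + 1 ≤ p := hr ▸ Nat.find_min' hex h
  refine ⟨by omega, ?_⟩
  rw [killedFn_rep_iff] at hnk
  push Not at hnk
  obtain ⟨Y, Z, hY, hZ, hZY, hne⟩ := hnk
  obtain ⟨Y', V, U, Γ, hS, he⟩ := exists_wide_split hψ R Y Z hY hZ hZY hne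
    (Fintype.card ι - 2 * r) (by simp; omega)
  by_contra hcon
  push Not at hcon
  apply he
  set e := wideSum ψ R Y (fromRows Z Γ)
  set W := fromCols Y V
  have h1 : ∑ χ : MulChar F ℂ, fixSum (twist χ R) W = 0 :=
    Finset.sum_eq_zero fun χ _ => fixSum_eq_zero_of_fixVanish _ (twist_sing χ R)
      (hcon χ (r + r) (by omega)) (by simp) W ⟨_, hS.hW⟩
  have hc : (Fintype.card (MulChar F ℂ) : ℂ) ≠ 0 := by
    exact_mod_cast Fintype.card_ne_zero
  rw [sum_fixSum_twist, smul_eq_zero_iff_right hc] at h1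
  have h2 : (∑ g : Matrix ι ι F, if g * W = W ∧ g.det = 1 then R g else 0) * e =
      ((Finset.univ.filter fun g : Matrix ι ι F => g * W = W ∧ g.det = 1).card : ℂ) • e := by
    rw [Finset.sum_mul, Nat.cast_smul_eq_nsmul, ← Finset.sum_const, Finset.sum_filter]
    refine Finset.sum_congr rfl fun g _ => ?_
    split_ifs with hg
    · exact mul_wideSum_of_fixing hψ R hk (by simp) hS (by simp; omega) g hg.2 hg.1
    · rw [Matrix.zero_mul]
  rw [h1, Matrix.zero_mul, eq_comm, smul_eq_zero_iff_right] at h2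
  · exact h2
  · have : (1 : Matrix ι ι F) ∈ Finset.univ.filter fun g : Matrix ι ι F => g * W = W ∧ g.det = 1 := by
      simp
    exact_mod_cast (Finset.card_pos.mpr ⟨_, this⟩).ne'

end Twist

section Upper
variable {F : Type} [Field F] [Fintype F] {ι α σ d : Type} [Fintype ι] [DecidableEq ι]
  [Fintype α] [DecidableEq α] [Fintype σ] [DecidableEq σ] [Fintype d] [DecidableEq d]
  {ψ : AddChar F ℂ}

lemma fixVanish_of_restr_self (R : Matrix ι ι F →* Matrix d d ℂ) (hR : ∀ X, X.det = 0 → R X = 0)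
    {j : ℕ} (W : Matrix ι (Fin j) F) (hW : LInv W) (h : restr (fun X => (R X).trace) W W = 0) :
    FixVanish j (fun X => (R X).trace) := by
  obtain ⟨W', hW'⟩ := hW
  intro V hV x
  by_cases hx : LInv x
  · obtain ⟨V', hV'⟩ := hV
    obtain ⟨x', hx'⟩ := hx
    obtain ⟨g, g', hg, -, rfl, -⟩ := exists_conj W V W' V' hW' hV'
    obtain ⟨N, N', hN, -, rfl, -⟩ := exists_conj (g * W) x V' x' hV' hx'
    have h1 := restr_eq_trace_fixSum R (g * W) 1 1 (Matrix.one_mul 1)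
    rw [map_one, Matrix.one_mul, Matrix.one_mul, restr_conj (trace_mem_CF R hR) W W g g' hg, h] at h1
    have h2 : fixSum R (g * W) = 0 :=
      eq_zero_of_quasi_idem _ (fixCard (g * W) : ℂ) (by exact_mod_cast (fixCard_pos _).ne')
        (fixSum_mul_self R hR _) h1.symm
    rw [restr_eq_trace_fixSum R (g * W) N N' hN, h2, Matrix.mul_zero, Matrix.trace_zero]
  · exact restr_eq_zero_of_not_lInv (trace_mem_CF R hR) V x hV hx

/-- Members of the family with the same twist and the same minimal level have linearly
independent restrictions at that level. -/
lemma linearIndepOn_restr (I : IrrFam ι F) (χ : MulChar F ℂ) {j : ℕ} (W : Matrix ι (Fin j) F)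
    (W' : Matrix (Fin j) ι F) (U : Matrix ι σ F) (U' : Matrix σ ι F) (hS : Split W W' U U')
    (S : Finset (Fin I.N))
    (h : ∀ i ∈ S, ¬ FixVanish j (fun X => (twist χ (I.R i) X).trace))
    (hv : ∀ i ∈ S, ∀ l, l < j → FixVanish l (fun X => (twist χ (I.R i) X).trace)) :
    LinearIndependent ℂ (fun (i : S) (X : Matrix (Fin j) (Fin j) F) =>
      restr (fun X => (twist χ (I.R i) X).trace) W (W * X)) := by
  rw [Fintype.linearIndependent_iff]
  intro a ha
  let b : Fin I.N → ℂ := fun i => if hi : i ∈ S then a ⟨i, hi⟩ else 0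
  have hb (f : Fin I.N → ℂ) : ∑ i, b i * f i = ∑ i : S, a i * f i := by
    rw [← Finset.sum_subset (Finset.subset_univ S), ← Finset.sum_coe_sort S]
    · refine Finset.sum_congr rfl fun i _ => ?_
      simp [b]
    · intro i _ hi
      simp [b, hi]
  have hx (x : Matrix ι (Fin j) F) :
      ∑ i : S, a i * restr (fun X => (twist χ (I.R i) X).trace) W x = 0 := by
    obtain ⟨t, K, L, hK, hL, hKL⟩ := exists_rank_factorization (U' * x)
    have e : x = W * (W' * x) + U * (K * L) := by
      rw [← hKL, ← Matrix.mul_assoc, ← Matrix.mul_assoc, ← Matrix.add_mul, hS.hsum, Matrix.one_mul]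
    have h1 (i : S) : restr (fun X => (twist χ (I.R i) X).trace) W x =
        lam (Fintype.card F) (Fintype.card σ) (Fintype.card (Fin j)) t * ∑ B : Matrix (Fin j) (Fin t) F,
          restr (fun X => (twist χ (I.R i) X).trace) W (W * (W' * x + B * L)) := by
      conv_lhs => rw [e]
      exact restr_formula (trace_mem_CF _ (twist_sing χ _)) W W' U U' hS.hW hS.hU hS.hWU hS.hUW hS.hsum
        (fun l hl => hv i i.2 l (by rw [Fintype.card_fin] at hl; omega)) t (Fin t) (by simp) _ K L hK hL
    simp only [h1, Finset.mul_sum]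
    rw [Finset.sum_comm]
    refine Finset.sum_eq_zero fun B _ => ?_
    have h2 := congrFun ha (W' * x + B * L)
    simp only [Finset.sum_apply, Pi.smul_apply, smul_eq_mul, Pi.zero_apply] at h2
    rw [← mul_zero (lam (Fintype.card F) (Fintype.card σ) (Fintype.card (Fin j)) t : ℂ), ← h2,
      Finset.mul_sum]
    exact Finset.sum_congr rfl fun i _ => by ring
  intro i
  by_contra hi
  apply h i i.2
  apply fixVanish_of_restr_self _ (twist_sing χ _) W ⟨W', hS.hW⟩
  have h3 := I.indep (fun i => b i • fixSum (twist χ (I.R i)) W) (fun X hX => by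
    obtain ⟨X', hX', -⟩ := exists_inv_of_det_ne_zero hX
    have h4 := hx (X * W)
    have hχ : χ X.det ≠ 0 := by
      have : IsUnit X.det := Ne.isUnit hX
      exact (this.map χ).ne_zero
    rw [← hb fun i => restr (fun X => (twist χ (I.R i) X).trace) W (X * W)] at h4
    refine (mul_eq_zero.mp (?_ : χ X.det * _ = 0)).resolve_left hχ
    rw [← h4, Finset.mul_sum]
    refine Finset.sum_congr rfl fun i _ => ?_
    rw [restr_eq_trace_fixSum _ W X X' hX', twist_apply, Matrix.mul_smul, Matrix.smul_mul,
      Matrix.trace_smul, Matrix.trace_smul, smul_eq_mul, smul_eq_mul]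
    ring) i 1
  have h5 := restr_eq_trace_fixSum (twist χ (I.R i)) W 1 1 (Matrix.one_mul 1)
  rw [map_one, Matrix.one_mul, Matrix.one_mul] at h5
  rw [h5]
  rw [map_one, Matrix.one_mul, Matrix.trace_smul, smul_eq_mul] at h3
  exact (mul_eq_zero.mp h3).resolve_left (by simpa [b] using hi)

lemma card_le_finrank_of_restr_mem (I : IrrFam ι F) (χ : MulChar F ℂ) {j : ℕ}
    (W : Matrix ι (Fin j) F)
    (W' : Matrix (Fin j) ι F) (U : Matrix ι σ F) (U' : Matrix σ ι F) (hS : Split W W' U U')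
    (S : Finset (Fin I.N))
    (h : ∀ i ∈ S, ¬ FixVanish j (fun X => (twist χ (I.R i) X).trace))
    (hv : ∀ i ∈ S, ∀ l, l < j → FixVanish l (fun X => (twist χ (I.R i) X).trace))
    (T : Submodule ℂ (Matrix (Fin j) (Fin j) F → ℂ))
    (hT : ∀ i ∈ S, (fun X => restr (fun X => (twist χ (I.R i) X).trace) W (W * X)) ∈ T) :
    S.card ≤ Module.finrank ℂ T := by
  have h1 := linearIndepOn_restr I χ W W' U U' hS S h hv
  rw [← Fintype.card_coe, ← finrank_span_eq_card h1]
  apply Submodule.finrank_mono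
  rw [Submodule.span_le]
  rintro _ ⟨i, rfl⟩
  exact hT i i.2

/-- The recursive bound for the number of irreducible representations killed at level `p`. -/
theorem finrank_KCF_le (hψ : ψ ≠ 1) (n p : ℕ) (hp : 2 * p ≤ n) :
    Module.finrank ℂ (KCF (Fin n) ψ p) ≤ (Fintype.card F - 1) * ∑ j ∈ Finset.range (2 * p - 1),
      if j < p then Module.finrank ℂ (CF (Fin j) F) else
        Module.finrank ℂ (KCF (Fin j) ψ (p - min (n - j) p)) := by
  obtain ⟨I, -⟩ := exists_irrFam (Fin n) F
  rw [← I.card_killed, Nat.card_eq_fintype_card, Fintype.card_subtype]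
  set S : MulChar F ℂ → ℕ → Finset (Fin I.N) := fun χ j => Finset.univ.filter fun i =>
    KilledFn ψ p (I.R i) ∧ ¬ FixVanish j (fun X => (twist χ (I.R i) X).trace) ∧
      ∀ l, l < j → FixVanish l (fun X => (twist χ (I.R i) X).trace) with hSdef
  have hsub : (Finset.univ.filter fun i => KilledFn ψ p (I.R i)) ⊆
      (Finset.univ : Finset (MulChar F ℂ)).biUnion fun χ =>
        (Finset.range (2 * p - 1)).biUnion fun j => S χ j := by
    intro i hi
    rw [Finset.mem_filter] at hi
    have : Nonempty (Fin (I.d i)) := ⟨⟨0, I.d_pos i⟩⟩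
    obtain ⟨-, χ, j, hj, hnv⟩ := exists_not_fixVanish hψ (I.R i) hi.2 (by simpa using hp)
    have hex : ∃ j, ¬ FixVanish j (fun X => (twist χ (I.R i) X).trace) := ⟨j, hnv⟩
    simp only [Finset.mem_biUnion, Finset.mem_univ, true_and, Finset.mem_range]
    refine ⟨χ, Nat.find hex, ?_, ?_⟩
    · have := Nat.find_min' hex hnv
      omega
    · rw [hSdef, Finset.mem_filter]
      exact ⟨Finset.mem_univ _, hi.2, Nat.find_spec hex, fun l hl => not_not.mp (Nat.find_min hex hl)⟩
  refine (Finset.card_le_card hsub).trans (Finset.card_biUnion_le.trans ?_)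
  rw [← card_mulChar, ← Finset.card_univ]
  refine Finset.sum_le_card_nsmul _ _ _ fun χ _ => Finset.card_biUnion_le.trans (Finset.sum_le_sum fun j hj => ?_)
  rw [Finset.mem_range] at hj
  obtain ⟨W, W', hW⟩ := exists_lInv_fin (F := F) (show j ≤ n by omega)
  obtain ⟨U, U', h1, h2, h3, h4⟩ := exists_split W W' hW (n - j) (by simp; omega)
  have hm (i) (hi : i ∈ S χ j) := (Finset.mem_filter.mp hi).2
  split_ifs with hjp
  · exact card_le_finrank_of_restr_mem I χ W W' U U' ⟨hW, h1, h2, h3, h4⟩ _ (fun i hi => (hm i hi).2.1)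
      (fun i hi => (hm i hi).2.2) _ fun i _ => restr_mem_CF (trace_mem_CF _ (twist_sing χ _)) W ⟨W', hW⟩
  · refine card_le_finrank_of_restr_mem I χ W W' U U' ⟨hW, h1, h2, h3, h4⟩ _ (fun i hi => (hm i hi).2.1)
      (fun i hi => (hm i hi).2.2) _ fun i hi => ⟨restr_mem_CF (trace_mem_CF _ (twist_sing χ _)) W ⟨W', hW⟩,
      killed_restr hψ (b := min (n - j) p) (twist χ (I.R i)) (twist_sing χ _) ((hm i hi).1.twist χ)
        (by omega) W ⟨W', hW⟩ (fun l hl => (hm i hi).2.2 l (by rw [Fintype.card_fin] at hl; omega))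
        (by simp; omega) (by simp; omega)⟩

end Upper

section Unip
variable {F : Type} [Field F] [Fintype F] {ι κ σ d : Type} [Fintype ι] [DecidableEq ι]
  [Fintype κ] [DecidableEq κ] [Fintype σ] [DecidableEq σ] [Fintype d] [DecidableEq d]
  {ψ : AddChar F ℂ}

/-- The sum over a unipotent radical, twisted by the character attached to `B`. -/
noncomputable def unipSum (ψ : AddChar F ℂ) (R : Matrix ι ι F → Matrix d d ℂ) (Y : Matrix ι κ F)
    (Z : Matrix σ ι F) (B : Matrix κ σ F) : Matrix d d ℂ :=
  ∑ A : Matrix κ σ F, ψ (-(Bᵀ * A).trace) • R (1 + Y * A * Z)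

lemma unipSum_mul_self (R : Matrix ι ι F →* Matrix d d ℂ) (Y : Matrix ι κ F) (Z : Matrix σ ι F)
    (h : Z * Y = 0) (B : Matrix κ σ F) :
    unipSum ψ R Y Z B * unipSum ψ R Y Z B =
      (Fintype.card (Matrix κ σ F) : ℂ) • unipSum ψ R Y Z B := by
  apply twisted_sum_mul (fun A : Matrix κ σ F => ψ (-(Bᵀ * A).trace))
    (T := fun A => R (1 + Y * A * Z))
  · intro a b
    rw [one_add_mul_mul' Y Z h, map_mul]
  · intro a b
    rw [Matrix.mul_add, Matrix.trace_add, neg_add, AddChar.map_add_eq_mul]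

lemma exists_minor {p : ℕ} (B : Matrix κ σ F) (hB : p ≤ B.rank) :
    ∃ (P : Matrix κ (Fin p) F) (Q : Matrix (Fin p) σ F), Q * Bᵀ * P = 1 := by
  obtain ⟨t, K, L, ⟨K', hK⟩, ⟨L', hL⟩, rfl⟩ := exists_rank_factorization B
  have ht : p ≤ t := by
    have h1 := Matrix.rank_mul_le_left K L
    have h2 := Matrix.rank_le_card_width K
    rw [Fintype.card_fin] at h2
    omega
  obtain ⟨J, J', hJ⟩ := exists_lInv_fin (F := F) ht
  refine ⟨K'ᵀ * J, J' * L'ᵀ, ?_⟩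
  rw [transpose_mul, show J' * L'ᵀ * (Lᵀ * Kᵀ) * (K'ᵀ * J) = J' * ((L'ᵀ * Lᵀ) * (Kᵀ * K'ᵀ)) * J by
    simp only [Matrix.mul_assoc], ← transpose_mul, ← transpose_mul, hK, hL]
  simpa using hJ

lemma KilledFn.unipSum_eq_zero {p : ℕ} {R : Matrix ι ι F →* Matrix d d ℂ} (h : KilledFn ψ p R)
    (Y : Matrix ι κ F) (Z : Matrix σ ι F) (hY : LInv Y) (hZ : RInv Z) (hZY : Z * Y = 0)
    (B : Matrix κ σ F) (hB : p ≤ B.rank) : unipSum ψ R Y Z B = 0 := by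
  obtain ⟨P, Q, hPQ⟩ := exists_minor B hB
  have hcor : cornerSum ψ R (Y * P) (Q * Z) = 0 := by
    refine (killedFn_rep_iff ψ R).mp h _ _ (hY.mul ⟨Q * Bᵀ, hPQ⟩) (RInv.mul ⟨Bᵀ * P, ?_⟩ hZ) ?_
    · rw [← Matrix.mul_assoc, hPQ]
    · rw [Matrix.mul_assoc Q, ← Matrix.mul_assoc Z, hZY, Matrix.zero_mul, Matrix.mul_zero]
  have h1 : cornerSum ψ R (Y * P) (Q * Z) * unipSum ψ R Y Z B =
      (Fintype.card (Matrix (Fin p) (Fin p) F) : ℂ) • unipSum ψ R Y Z B := by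
    unfold cornerSum
    rw [Finset.sum_mul, Nat.cast_smul_eq_nsmul, ← Finset.card_univ, ← Finset.sum_const]
    refine Finset.sum_congr rfl fun a _ => ?_
    unfold unipSum
    rw [Matrix.smul_mul, Finset.mul_sum, Finset.smul_sum]
    refine Fintype.sum_equiv (Equiv.addLeft (P * a * Q)) _ _ fun A => ?_
    rw [Equiv.coe_addLeft, one_add_mul_mul' Y Z hZY, map_mul, Matrix.mul_smul, smul_smul,
      ← AddChar.map_add_eq_mul]
    congr 2
    · rw [Matrix.mul_add, Matrix.trace_add, neg_add, ← Matrix.mul_assoc, Matrix.trace_mul_comm _ Q,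
        show Q * (Bᵀ * (P * a)) = Q * Bᵀ * P * a by simp only [Matrix.mul_assoc], hPQ, Matrix.one_mul]
    · simp only [Matrix.mul_assoc]
  rw [hcor, Matrix.zero_mul, eq_comm, smul_eq_zero_iff_right] at h1
  · exact h1
  · exact Nat.cast_ne_zero.mpr Fintype.card_ne_zero

/-- Fourier inversion on a unipotent radical. -/
lemma sum_unipSum (hψ : ψ ≠ 1) (R : Matrix ι ι F → Matrix d d ℂ) (Y : Matrix ι κ F)
    (Z : Matrix σ ι F) (A : Matrix κ σ F) :
    ∑ B, ψ (Bᵀ * A).trace • unipSum ψ R Y Z B =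
      (Fintype.card (Matrix σ κ F) : ℂ) • R (1 + Y * A * Z) := by
  unfold unipSum
  simp only [Finset.smul_sum, smul_smul, ← AddChar.map_add_eq_mul]
  rw [Finset.sum_comm, Finset.sum_eq_single A]
  · rw [← Finset.sum_smul]
    simp only [add_neg_cancel, AddChar.map_zero_eq_one, Finset.sum_const, Finset.card_univ,
      nsmul_eq_mul, mul_one]
    rw [Fintype.card_congr (Matrix.transposeAddEquiv κ σ F).toEquiv]
  · intro A' _ hA
    rw [← Finset.sum_smul]
    have := sum_psi_trace hψ (A' - A)
    rw [if_neg (sub_ne_zero.mpr hA)] at this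
    rw [← Equiv.sum_comp (Matrix.transposeAddEquiv κ σ F).toEquiv] at this
    rw [show ∑ B : Matrix κ σ F, ψ ((Bᵀ * A).trace + -(Bᵀ * A').trace) = 0 by
      rw [← this]
      refine Finset.sum_congr rfl fun B _ => ?_
      simp only [AddEquiv.toEquiv_eq_coe, EquivLike.coe_coe, transposeAddEquiv_apply, Matrix.mul_sub,
        Matrix.trace_sub, neg_sub]
      rw [sub_eq_add_neg], zero_smul]
  · simp

lemma killedFn_of_unipSum_eq_zero (hψ : ψ ≠ 1) {p : ℕ} (R : Matrix ι ι F →* Matrix d d ℂ)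
    (Y : Matrix ι κ F) (Z : Matrix σ ι F) (hY : LInv Y) (hZ : RInv Z) (hZY : Z * Y = 0)
    (hκ : p ≤ Fintype.card κ) (hσ : p ≤ Fintype.card σ)
    (h : ∀ B : Matrix κ σ F, p ≤ B.rank → unipSum ψ R Y Z B = 0) : KilledFn ψ p R := by
  obtain ⟨J, hJ⟩ := exists_lInv_fin (F := F) hκ
  obtain ⟨J₁, hJ₁⟩ := exists_lInv_fin (F := F) hσ
  set P : Matrix κ (Fin p) F := J.submatrix (Fintype.equivFin κ) id
  set Q : Matrix (Fin p) σ F := J₁ᵀ.submatrix id (Fintype.equivFin σ)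
  have hP : LInv P := by
    obtain ⟨J', hJ'⟩ := hJ
    refine ⟨J'.submatrix id (Fintype.equivFin κ), ?_⟩
    rw [Matrix.submatrix_mul_equiv, hJ']
    simp
  have hQ : RInv Q := by
    obtain ⟨J', hJ'⟩ := hJ₁
    refine ⟨J'ᵀ.submatrix (Fintype.equivFin σ) id, ?_⟩
    rw [Matrix.submatrix_mul_equiv, ← transpose_mul, hJ']
    simp
  have hcor : cornerSum ψ R (Y * P) (Q * Z) = 0 := by
    have hc : (Fintype.card (Matrix σ κ F) : ℂ) ≠ 0 := Nat.cast_ne_zero.mpr Fintype.card_ne_zero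
    refine (smul_eq_zero_iff_right hc).mp ?_
    unfold cornerSum
    rw [Finset.smul_sum]
    have h1 (a : Matrix (Fin p) (Fin p) F) : (Fintype.card (Matrix σ κ F) : ℂ) •
        ψ (-a.trace) • R (1 + Y * P * a * (Q * Z)) =
        ∑ B : Matrix κ σ F, ψ (-((1 - Q * Bᵀ * P) * a).trace) • unipSum ψ R Y Z B := by
      rw [smul_comm, show 1 + Y * P * a * (Q * Z) = 1 + Y * (P * a * Q) * Z by
        simp only [Matrix.mul_assoc], ← sum_unipSum hψ, Finset.smul_sum]
      refine Finset.sum_congr rfl fun B _ => ?_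
      rw [smul_smul, ← AddChar.map_add_eq_mul]
      congr 2
      rw [Matrix.sub_mul, Matrix.trace_sub, Matrix.one_mul, ← Matrix.mul_assoc,
        Matrix.trace_mul_comm _ Q]
      simp only [Matrix.mul_assoc]
      abel
    rw [Finset.sum_congr rfl fun a _ => h1 a, Finset.sum_comm]
    refine Finset.sum_eq_zero fun B _ => ?_
    by_cases hB : Q * Bᵀ * P = 1
    · rw [h B]
      · simp
      · rw [← Matrix.rank_transpose, ← Fintype.card_fin p, ← Matrix.rank_one (R := F) (n := Fin p), ← hB]
        exact (Matrix.rank_mul_le_left _ _).trans (Matrix.rank_mul_le_right _ _)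
    · rw [← Finset.sum_smul]
      have h2 := sum_psi_trace hψ (1 - Q * Bᵀ * P)
      rw [if_neg (sub_ne_zero.mpr (Ne.symm hB))] at h2
      rw [Finset.sum_congr rfl fun a _ => by rw [Matrix.trace_mul_comm _ a], h2, zero_smul]
  have hframe (Y : Matrix ι (Fin p) F) (Z : Matrix (Fin p) ι F) (hY : LInv Y) (hZ : RInv Z)
      (hZY : Z * Y = 0) : ∃ (V : Matrix ι (Fin p) F) (Y' : Matrix (Fin p) ι F),
      fromRows Y' Z * fromCols Y V = 1 := by
    obtain ⟨Y₀, hY₀⟩ := hY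
    obtain ⟨V, hV⟩ := hZ
    refine ⟨V, Y₀ - Y₀ * V * Z, ?_⟩
    rw [fromRows_mul_fromCols, Matrix.sub_mul, Matrix.sub_mul, Matrix.mul_assoc _ Z,
      Matrix.mul_assoc _ Z, hV, hZY, hY₀, ← fromBlocks_one]
    simp
  rw [killedFn_rep_iff]
  intro Y₁ Z₁ hY₁ hZ₁ hZY₁
  obtain ⟨V₁, Y₁', h₁⟩ := hframe Y₁ Z₁ hY₁ hZ₁ hZY₁
  obtain ⟨V₂, Y₂', h₂⟩ := hframe (Y * P) (Q * Z) (hY.mul hP) (hQ.mul hZ) (by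
    rw [Matrix.mul_assoc Q, ← Matrix.mul_assoc Z, hZY, Matrix.zero_mul, Matrix.mul_zero])
  obtain ⟨g, g', hg, hg', e1, e2⟩ := exists_conj _ _ _ _ h₁ h₂
  rw [mul_fromCols, fromCols_inj.eq_iff] at e1
  rw [fromRows_mul, fromRows_inj.eq_iff] at e2
  have h3 : R g' * cornerSum ψ R (Y * P) (Q * Z) * R g = cornerSum ψ R Y₁ Z₁ := by
    unfold cornerSum
    rw [Finset.mul_sum, Finset.sum_mul]
    refine Finset.sum_congr rfl fun A _ => ?_
    rw [Matrix.mul_smul, Matrix.smul_mul, ← map_mul, ← map_mul, ← e1.1, ← e2.2, Matrix.mul_add,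
      Matrix.add_mul, Matrix.mul_one, hg', show g' * (g * Y₁ * A * (Q * Z)) * g =
        g' * g * Y₁ * A * (Q * Z * g) by simp only [Matrix.mul_assoc], hg', Matrix.one_mul]
  rw [← h3, hcor, Matrix.mul_zero, Matrix.zero_mul]

end Unip

section Rank
variable {F : Type} [Field F] [Fintype F] {d : Type} [Fintype d] [DecidableEq d]
  {ψ : AddChar F ℂ}

lemma uMat_eq (n : ℕ) : ∃ (Y : Matrix (Fin n) (Fin (n / 2)) F) (Z : Matrix (Fin (n - n / 2)) (Fin n) F),
    LInv Y ∧ RInv Z ∧ Z * Y = 0 ∧ ∀ A, uMat F n A = 1 + Y * A * Z := by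
  let e := (blockEquiv n).symm
  refine ⟨(fromRows 1 0).submatrix e id, (fromCols 0 1).submatrix id e,
    ⟨(fromCols 1 0).submatrix id e, ?_⟩, ⟨(fromRows 0 1).submatrix e id, ?_⟩, ?_, fun A => ?_⟩
  · rw [Matrix.submatrix_mul_equiv, fromCols_mul_fromRows]
    simp
  · rw [Matrix.submatrix_mul_equiv, fromCols_mul_fromRows]
    simp
  · rw [Matrix.submatrix_mul_equiv, fromCols_mul_fromRows]
    simp
  · let Y₀ : Matrix (Fin (n / 2) ⊕ Fin (n - n / 2)) (Fin (n / 2)) F := fromRows 1 0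
    let Z₀ : Matrix (Fin (n - n / 2)) (Fin (n / 2) ⊕ Fin (n - n / 2)) F := fromCols 0 1
    have h1 : Y₀.submatrix e id * A * Z₀.submatrix id e = (Y₀ * A * Z₀).submatrix e e := by
      ext i j
      simp [Matrix.mul_apply]
    have h2 : 1 + Y₀ * A * Z₀ = fromBlocks 1 A 0 1 := by
      rw [fromRows_mul, fromRows_mul_fromCols, ← fromBlocks_one, fromBlocks_add]
      simp
    change _ = 1 + Y₀.submatrix e id * A * Z₀.submatrix id e
    rw [h1, uMat, ← h2, ← Matrix.submatrix_one_equiv e]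
    rfl

/-- The representation has `U`-rank `k`, in terms of its character extended by zero. -/
def TraceRank (n : ℕ) (ψ : AddChar F ℂ) (k : ℕ) (φ : GL (Fin n) F → ℂ) : Prop :=
  (∃ B : Matrix (Fin (n / 2)) (Fin (n - n / 2)) F, B.rank = k ∧
    (∑ A : Matrix (Fin (n / 2)) (Fin (n - n / 2)) F, φ (uGL F n A) * ψ (-(Bᵀ * A).trace)) ≠ 0) ∧
  (∀ B : Matrix (Fin (n / 2)) (Fin (n - n / 2)) F, k < B.rank →
    ¬ (∑ A : Matrix (Fin (n / 2)) (Fin (n - n / 2)) F, φ (uGL F n A) * ψ (-(Bᵀ * A).trace)) ≠ 0)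

lemma exists_unipSum_iff (hψ : ψ ≠ 1) (n : ℕ) (R : Matrix (Fin n) (Fin n) F →* Matrix d d ℂ) :
    ∃ E : Matrix (Fin (n / 2)) (Fin (n - n / 2)) F → Matrix d d ℂ,
      (∀ B, E B = 0 ↔ ∑ A, (R (uGL F n A)).trace * ψ (-(Bᵀ * A).trace) = 0) ∧
      ∀ p ≤ n / 2, KilledFn ψ p R ↔ ∀ B, p ≤ B.rank → E B = 0 := by
  obtain ⟨Y, Z, hY, hZ, hZY, hu⟩ := uMat_eq (F := F) n
  refine ⟨unipSum ψ R Y Z, fun B => ?_, fun p hp => ⟨fun h B hB => h.unipSum_eq_zero Y Z hY hZ hZY B hB,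
    fun h => killedFn_of_unipSum_eq_zero hψ R Y Z hY hZ hZY (by simpa using hp)
      (by simp; omega) h⟩⟩
  have h1 : ∑ A, (R (uGL F n A)).trace * ψ (-(Bᵀ * A).trace) = (unipSum ψ R Y Z B).trace := by
    rw [unipSum, Matrix.trace_sum]
    refine Finset.sum_congr rfl fun A _ => ?_
    rw [Matrix.trace_smul, smul_eq_mul, mul_comm, ← hu]
    rfl
  rw [h1]
  exact ⟨fun h => by rw [h, Matrix.trace_zero], fun h => eq_zero_of_quasi_idem _ _
    (Nat.cast_ne_zero.mpr Fintype.card_ne_zero) (unipSum_mul_self R Y Z hZY B) h⟩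

lemma KilledFn.succ (hψ : ψ ≠ 1) {n p : ℕ} {R : Matrix (Fin n) (Fin n) F →* Matrix d d ℂ}
    (h : KilledFn ψ p R) (hp : p + 1 ≤ n / 2) : KilledFn ψ (p + 1) R := by
  obtain ⟨E, -, hE⟩ := exists_unipSum_iff hψ n R
  rw [hE _ hp]
  exact fun B hB => (hE p (by omega)).mp h B (by omega)

lemma traceRank_iff (hψ : ψ ≠ 1) {n k : ℕ} (hk : k ≤ n / 2)
    (R : Matrix (Fin n) (Fin n) F →* Matrix d d ℂ) :
    TraceRank n ψ k (fun g => (R g).trace) ↔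
      ¬ KilledFn ψ k R ∧ (k < n / 2 → KilledFn ψ (k + 1) R) := by
  obtain ⟨E, hE0, hE⟩ := exists_unipSum_iff hψ n R
  unfold TraceRank
  simp only [ne_eq, ← hE0, not_not]
  have hrank (B : Matrix (Fin (n / 2)) (Fin (n - n / 2)) F) : B.rank ≤ n / 2 := by
    simpa using Matrix.rank_le_card_height B
  rw [hE k hk]
  constructor
  · rintro ⟨⟨B, hB, hEB⟩, h⟩
    exact ⟨fun h0 => hEB (h0 B hB.ge), fun hk' => (hE _ hk').mpr fun B hB => h B hB⟩
  · rintro ⟨h1, h2⟩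
    have h3 (B : Matrix (Fin (n / 2)) (Fin (n - n / 2)) F) (hB : k < B.rank) : E B = 0 := by
      have hk' : k < n / 2 := hB.trans_le (hrank B)
      exact (hE _ hk').mp (h2 hk') B hB
    push Not at h1
    obtain ⟨B, hB, hEB⟩ := h1
    exact ⟨⟨B, le_antisymm (not_lt.mp fun h => hEB (h3 B h)) hB, hEB⟩, h3⟩

lemma URankIsoClasses_eq (hψ : ψ ≠ 1) {n k : ℕ} (hk : k ≤ n / 2) :
    (k < n / 2 → URankIsoClasses n F ψ k + Module.finrank ℂ (KCF (Fin n) ψ k) =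
      Module.finrank ℂ (KCF (Fin n) ψ (k + 1))) ∧
    (k = n / 2 → URankIsoClasses n F ψ k + Module.finrank ℂ (KCF (Fin n) ψ k) =
      Module.finrank ℂ (CF (Fin n) F)) := by
  obtain ⟨I, hI⟩ := exists_irrFam (Fin n) F
  have h1 : URankIsoClasses n F ψ k =
      Nat.card {i // ¬ KilledFn ψ k (I.R i) ∧ (k < n / 2 → KilledFn ψ (k + 1) (I.R i))} := by
    simp only [← traceRank_iff hψ hk]
    exact hI (TraceRank n ψ k) _ fun a b => Iff.rfl
  rw [h1, ← I.card_killed, ← I.card_killed, ← I.card_eq_finrank_CF]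
  simp only [Nat.card_eq_fintype_card, Fintype.card_subtype]
  constructor
  · intro hk'
    rw [← Finset.card_union_of_disjoint]
    · congr 1
      ext i
      simp only [Finset.mem_union, Finset.mem_filter, Finset.mem_univ, true_and]
      by_cases h : KilledFn ψ k (I.R i)
      · simp [h, h.succ hψ hk']
      · simp [h, hk']
    · rw [Finset.disjoint_filter]
      tauto
  · intro hk'
    rw [← Finset.card_union_of_disjoint]
    · conv_rhs => rw [← Fintype.card_fin I.N, ← Finset.card_univ]
      congr 1
      ext i
      simp only [Finset.mem_union, Finset.mem_filter, Finset.mem_univ, true_and]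
      have : ¬ k < n / 2 := by omega
      by_cases h : KilledFn ψ k (I.R i) <;> simp [h, this]
    · rw [Finset.disjoint_filter]
      tauto

end Rank

section Codes
open Polynomial
variable {F : Type} [Field F] [Fintype F] {n : ℕ}

lemma exists_equiv_of_map_univ_eq {α β γ : Type} [Fintype α] [Fintype β] {f : α → γ} {g : β → γ}
    (h : Finset.univ.val.map f = Finset.univ.val.map g) : ∃ e : α ≃ β, ∀ a, g (e a) = f a := by
  have key : ∀ y, Nonempty ({a // f a = y} ≃ {b // g b = y}) := by
    intro y
    rw [← Fintype.card_eq, Fintype.card_subtype, Fintype.card_subtype]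
    have := congrArg (Multiset.count y) h
    rw [Multiset.count_map, Multiset.count_map] at this
    simpa [Finset.card_def, eq_comm] using this
  let e := fun y => (key y).some
  refine ⟨(Equiv.sigmaFiberEquiv f).symm.trans ((Equiv.sigmaCongrRight e).trans
    (Equiv.sigmaFiberEquiv g)), fun a => ?_⟩
  exact (e (f a) ⟨a, rfl⟩).2

/-- The elementary divisors of a square matrix: the multiset of prime powers occurring in the
primary decomposition of the associated polynomial module. -/
def IsCode (X : Matrix (Fin n) (Fin n) F) (s : Multiset (F[X] × ℕ)) : Prop :=
  ∃ (ι : Type) (_ : Fintype ι) (f : ι → F[X] × ℕ), s = Finset.univ.val.map f ∧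
    Nonempty (Module.AEval' (Matrix.toLin' X) ≃ₗ[F[X]]
      ∀ i, F[X] ⧸ Ideal.span {(f i).1 ^ (f i).2})

lemma IsCode.conj {X Y : Matrix (Fin n) (Fin n) F} {s : Multiset (F[X] × ℕ)} (hX : IsCode X s)
    (hY : IsCode Y s) : ∃ h h' : Matrix (Fin n) (Fin n) F, h * h' = 1 ∧ Y = h * X * h' := by
  obtain ⟨ι, _, f, hs, ⟨a⟩⟩ := hX
  obtain ⟨κ, _, g, hs', ⟨b⟩⟩ := hY
  obtain ⟨e, he⟩ := exists_equiv_of_map_univ_eq (hs.symm.trans hs')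
  let c : (∀ i, F[X] ⧸ Ideal.span {(f i).1 ^ (f i).2}) ≃ₗ[F[X]]
      (∀ i, F[X] ⧸ Ideal.span {(g i).1 ^ (g i).2}) :=
    (LinearEquiv.piCongrRight fun i =>
      Submodule.quotEquivOfEq _ (Ideal.span {(g (e i)).1 ^ (g (e i)).2}) (by rw [he])).trans
      (LinearEquiv.piCongrLeft F[X] (fun i => F[X] ⧸ Ideal.span {(g i).1 ^ (g i).2}) e)
  let d := a.trans (c.trans b.symm)
  let l : (Fin n → F) ≃ₗ[F] (Fin n → F) :=
    (Module.AEval'.of (Matrix.toLin' X)).trans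
      ((d.restrictScalars F).trans (Module.AEval'.of (Matrix.toLin' Y)).symm)
  have hl : ∀ v, l (X *ᵥ v) = Y *ᵥ l v := by
    intro v
    have h1 := Module.AEval'.X_smul_of (Matrix.toLin' X) v
    have h2 := Module.AEval'.of_symm_X_smul (Matrix.toLin' Y)
      (d (Module.AEval'.of (Matrix.toLin' X) v))
    rw [← map_smul, h1] at h2
    simpa [l] using h2
  have h3 : LinearMap.toMatrix' l.toLinearMap * X = Y * LinearMap.toMatrix' l.toLinearMap := by
    apply Matrix.toLin'.injective
    refine LinearMap.ext fun v => ?_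
    simp [Matrix.toLin'_mul, hl]
  have h4 : LinearMap.toMatrix' l.toLinearMap * LinearMap.toMatrix' l.symm.toLinearMap = 1 := by
    rw [← LinearMap.toMatrix'_comp]
    simp
  refine ⟨_, _, h4, ?_⟩
  rw [h3, Matrix.mul_assoc, h4, Matrix.mul_one]

/-- Prime powers normalised as pairs of a monic irreducible polynomial and a positive exponent. -/
def CodeValid (s : Multiset (F[X] × ℕ)) : Prop :=
  ∀ x ∈ s, x.1.Monic ∧ Irreducible x.1 ∧ 1 ≤ x.2

/-- The degree of the product of the prime powers. -/
def codeWeight (s : Multiset (F[X] × ℕ)) : ℕ := (s.map fun x => x.2 * x.1.natDegree).sum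

lemma exists_code (X : Matrix (Fin n) (Fin n) F) :
    ∃ s, IsCode X s ∧ CodeValid s ∧ codeWeight s = n := by
  have hfin : Module.Finite F[X] (Module.AEval' (Matrix.toLin' X)) := inferInstance
  obtain ⟨ι, _, p, hp, e, ⟨a⟩⟩ := Module.equiv_directSum_of_isTorsion
    (Module.AEval.isTorsion_of_finiteDimensional F (Fin n → F) (Matrix.toLin' X))
  let κ := {i : ι // e i ≠ 0}
  let f : κ → F[X] × ℕ := fun i => (normalize (p i), e i)
  let b : (∀ i, F[X] ⧸ Ideal.span {p i ^ e i}) →ₗ[F[X]]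
      ∀ i : κ, F[X] ⧸ Ideal.span {p i.1 ^ e i.1} := LinearMap.pi fun i => LinearMap.proj i.1
  have hb : Function.Bijective b := by
    constructor
    · rw [← LinearMap.ker_eq_bot, LinearMap.ker_eq_bot']
      intro x hx
      funext i
      by_cases hi : e i = 0
      · have : Subsingleton (F[X] ⧸ Ideal.span {p i ^ e i}) := by
          rw [hi, pow_zero, Ideal.span_singleton_one]
          exact Ideal.Quotient.subsingleton_iff.mpr rfl
        exact Subsingleton.elim _ _
      · exact congrFun hx ⟨i, hi⟩
    · intro y
      refine ⟨fun i => if hi : e i ≠ 0 then y ⟨i, hi⟩ else 0, ?_⟩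
      funext i
      have : b (fun i => if hi : e i ≠ 0 then y ⟨i, hi⟩ else 0) i =
        if hi : e i.1 ≠ 0 then y ⟨i.1, hi⟩ else 0 := rfl
      rw [this, dif_pos i.2]
  let c : (∀ i : κ, F[X] ⧸ Ideal.span {p i.1 ^ e i.1}) ≃ₗ[F[X]]
      ∀ i, F[X] ⧸ Ideal.span {(f i).1 ^ (f i).2} :=
    LinearEquiv.piCongrRight fun i => Submodule.quotEquivOfEq _ _ (by
      change Ideal.span _ = Ideal.span _
      rw [Ideal.span_singleton_eq_span_singleton]
      exact (normalize_associated (p i.1)).symm.pow_pow)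
  let d : Module.AEval' (Matrix.toLin' X) ≃ₗ[F[X]] ∀ i, F[X] ⧸ Ideal.span {(f i).1 ^ (f i).2} :=
    a.trans ((DirectSum.linearEquivFunOnFintype F[X] ι _).trans
      ((LinearEquiv.ofBijective b hb).trans c))
  have hne : ∀ i, p i ≠ 0 := fun i => (hp i).ne_zero
  refine ⟨_, ⟨κ, inferInstance, f, rfl, ⟨d⟩⟩, ?_, ?_⟩
  · intro x hx
    obtain ⟨i, -, rfl⟩ := Multiset.mem_map.mp hx
    exact ⟨Polynomial.monic_normalize (hne _),
      (normalize_associated (p i.1)).irreducible_iff.mpr (hp _), Nat.one_le_iff_ne_zero.mpr i.2⟩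
  · have h1 : Module.finrank F (Module.AEval' (Matrix.toLin' X)) = n := by
      rw [← (Module.AEval'.of (Matrix.toLin' X)).finrank_eq]
      simp
    have hf0 : ∀ i, (f i).1 ≠ 0 := fun i => (Polynomial.monic_normalize (hne _)).ne_zero
    have hfr : ∀ i, Module.finrank F (F[X] ⧸ Ideal.span {(f i).1 ^ (f i).2})
        = (f i).2 * (f i).1.natDegree := by
      intro i
      rw [finrank_quotient_span_eq_natDegree, natDegree_pow]
    have hfd : ∀ i, Module.Finite F (F[X] ⧸ Ideal.span {(f i).1 ^ (f i).2}) := by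
      intro i
      have h0 : 0 < (f i).2 * (f i).1.natDegree := Nat.mul_pos (Nat.pos_of_ne_zero i.2)
        (((normalize_associated (p i.1)).irreducible_iff.mpr (hp i.1)).natDegree_pos)
      exact Module.finite_of_finrank_pos (by rw [hfr]; exact h0)
    have h2 := (d.restrictScalars F).finrank_eq
    rw [h1, Module.finrank_pi_fintype] at h2
    rw [codeWeight, Multiset.map_map, h2]
    exact Finset.sum_congr rfl fun i _ => (hfr i).symm

end Codes

section CountCodes
open Polynomial
variable {F : Type} [Field F] [Fintype F] {n : ℕ}

/-- The monic polynomial with given lower coefficients. -/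
noncomputable def monicPoly {d : ℕ} (f : Fin d → F) : F[X] :=
  X ^ d + ∑ i, C (f i) * X ^ (i : ℕ)

lemma monicPoly_degree_lt {d : ℕ} (f : Fin d → F) :
    (∑ i, C (f i) * X ^ (i : ℕ) : F[X]).degree < d := by
  refine lt_of_le_of_lt (degree_sum_le _ _) ?_
  rw [Finset.sup_lt_iff (by exact WithBot.bot_lt_coe d)]
  intro i _
  exact lt_of_le_of_lt (degree_C_mul_X_pow_le _ _) (by exact_mod_cast i.2)

lemma monicPoly_monic {d : ℕ} (f : Fin d → F) : (monicPoly f).Monic :=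
  monic_X_pow_add (monicPoly_degree_lt f)

lemma monicPoly_natDegree {d : ℕ} (f : Fin d → F) : (monicPoly f).natDegree = d := by
  rw [monicPoly, natDegree_add_eq_left_of_degree_lt, natDegree_X_pow]
  rw [degree_X_pow]
  exact monicPoly_degree_lt f

lemma monicPoly_coeff {d : ℕ} (f : Fin d → F) (i : Fin d) : (monicPoly f).coeff i = f i := by
  rw [monicPoly, coeff_add, coeff_X_pow, if_neg i.2.ne, zero_add, finsetSum_coeff]
  simp [coeff_X_pow, Fin.val_inj]

lemma monicPoly_injective {d : ℕ} : Function.Injective (monicPoly : (Fin d → F) → F[X]) := by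
  intro f g h
  funext i
  rw [← monicPoly_coeff f, h, monicPoly_coeff]

lemma exists_monicPoly_eq {P : F[X]} {d : ℕ} (hP : P.Monic) (hd : P.natDegree = d) :
    ∃ f : Fin d → F, monicPoly f = P := by
  subst hd
  refine ⟨fun i => P.coeff i, ?_⟩
  conv_rhs => rw [hP.as_sum]
  rw [monicPoly, Finset.sum_range]

/-- The monic polynomials of degree `d`. -/
noncomputable def monicFinset (F : Type) [Field F] [Fintype F] (d : ℕ) : Finset F[X] :=
  Finset.univ.image (monicPoly : (Fin d → F) → F[X])

lemma card_monicFinset_le (d : ℕ) : (monicFinset F d).card ≤ Fintype.card F ^ d := by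
  refine Finset.card_image_le.trans ?_
  simp

lemma mem_monicFinset {P : F[X]} {d : ℕ} (hP : P.Monic) (hd : P.natDegree = d) :
    P ∈ monicFinset F d := by
  obtain ⟨f, rfl⟩ := exists_monicPoly_eq hP hd
  exact Finset.mem_image_of_mem _ (Finset.mem_univ _)

lemma CodeValid.of_cons {x : F[X] × ℕ} {s : Multiset (F[X] × ℕ)} (h : CodeValid (x ::ₘ s)) :
    CodeValid s := fun y hy => h y (Multiset.mem_cons_of_mem hy)

lemma codeWeight_cons (x : F[X] × ℕ) (s : Multiset (F[X] × ℕ)) :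
    codeWeight (x ::ₘ s) = x.2 * x.1.natDegree + codeWeight s := by
  simp [codeWeight]

lemma exists_cover_codes (m : ℕ) : ∃ C : ℕ, ∀ j ≤ m, ∀ (F : Type) [Field F] [Fintype F],
    ∃ T : Finset (Multiset (F[X] × ℕ)), T.card ≤ C * Fintype.card F ^ j ∧
      ∀ s, CodeValid s → codeWeight s = j → s ∈ T := by
  induction m with
  | zero =>
    refine ⟨1, fun j hj F _ _ => ⟨{0}, ?_, fun s hs hw => ?_⟩⟩
    · obtain rfl : j = 0 := by omega
      simp
    · obtain rfl : j = 0 := by omega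
      rw [Finset.mem_singleton]
      by_contra hne
      obtain ⟨x, hx⟩ := Multiset.exists_mem_of_ne_zero hne
      obtain ⟨t, rfl⟩ := Multiset.exists_cons_of_mem hx
      obtain ⟨h1, h2, h3⟩ := hs x hx
      rw [codeWeight_cons] at hw
      have := Nat.mul_pos (show 0 < x.2 from h3) h2.natDegree_pos
      omega
  | succ m ih =>
    obtain ⟨C, hC⟩ := ih
    refine ⟨C + (m + 2) * ((m + 2) * C), fun j hj F _ _ => ?_⟩
    rcases Nat.lt_or_ge j (m + 1) with hj' | hj'
    · obtain ⟨T, hT, hT'⟩ := hC j (by omega) F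
      exact ⟨T, hT.trans (Nat.mul_le_mul_right _ (Nat.le_add_right _ _)), hT'⟩
    · obtain rfl : j = m + 1 := by omega
      have h0 : ∀ i : ℕ, ∃ T : Finset (Multiset (F[X] × ℕ)), i ≤ m →
          T.card ≤ C * Fintype.card F ^ i ∧ ∀ s, CodeValid s → codeWeight s = i → s ∈ T := by
        intro i
        by_cases hi : i ≤ m
        · obtain ⟨T, hT⟩ := hC i hi F
          exact ⟨T, fun _ => hT⟩
        · exact ⟨∅, fun h => absurd h hi⟩
      choose T hT using h0
      have hq : 1 ≤ Fintype.card F := Fintype.card_pos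
      refine ⟨(Finset.range (m + 2)).biUnion fun d => (Finset.range (m + 2)).biUnion fun e =>
        if 1 ≤ d ∧ 1 ≤ e ∧ e * d ≤ m + 1 then
          (monicFinset F d ×ˢ T (m + 1 - e * d)).image fun x => (x.1, e) ::ₘ x.2 else ∅, ?_, ?_⟩
      · have h1 : ∀ d ∈ Finset.range (m + 2), ∀ e ∈ Finset.range (m + 2),
            (if 1 ≤ d ∧ 1 ≤ e ∧ e * d ≤ m + 1 then
              (monicFinset F d ×ˢ T (m + 1 - e * d)).image fun x => (x.1, e) ::ₘ x.2
              else ∅).card ≤ C * Fintype.card F ^ (m + 1) := by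
          intro d _ e _
          split_ifs with h
          · have hde : d ≤ e * d := Nat.le_mul_of_pos_left d h.2.1
            refine Finset.card_image_le.trans ?_
            rw [Finset.card_product]
            refine (Nat.mul_le_mul (card_monicFinset_le d) (hT _ (by omega)).1).trans ?_
            calc Fintype.card F ^ d * (C * Fintype.card F ^ (m + 1 - e * d))
                = C * Fintype.card F ^ (d + (m + 1 - e * d)) := by rw [pow_add]; ring
              _ ≤ _ := Nat.mul_le_mul_left _ (Nat.pow_le_pow_right hq (by omega))
          · simp
        refine (Finset.card_biUnion_le_card_mul _ _ _ fun d hd =>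
          Finset.card_biUnion_le_card_mul _ _ _ (h1 d hd)).trans ?_
        simp only [Finset.card_range]
        nlinarith [Nat.zero_le (C * Fintype.card F ^ (m + 1))]
      · intro s hs hw
        have hne : s ≠ 0 := by rintro rfl; simp [codeWeight] at hw
        obtain ⟨x, hx⟩ := Multiset.exists_mem_of_ne_zero hne
        obtain ⟨t, rfl⟩ := Multiset.exists_cons_of_mem hx
        obtain ⟨h1, h2, h3⟩ := hs x hx
        rw [codeWeight_cons] at hw
        have hd := h2.natDegree_pos
        have hle : x.1.natDegree ≤ x.2 * x.1.natDegree := Nat.le_mul_of_pos_left _ h3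
        have hle' : x.2 ≤ x.2 * x.1.natDegree := Nat.le_mul_of_pos_right _ hd
        simp only [Finset.mem_biUnion, Finset.mem_range]
        refine ⟨x.1.natDegree, by omega, x.2, by omega, ?_⟩
        rw [if_pos ⟨hd, h3, by omega⟩, Finset.mem_image]
        exact ⟨(x.1, t), Finset.mem_product.mpr ⟨mem_monicFinset h1 rfl,
          (hT _ (by omega)).2 t hs.of_cons (by omega)⟩, rfl⟩

/-- The prime powers of a polynomial, as a multiset of pairs. -/
noncomputable def decode (P : F[X]) : Multiset (F[X] × ℕ) :=
  (UniqueFactorizationMonoid.normalizedFactors P).toFinset.val.map fun p =>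
    (p, (UniqueFactorizationMonoid.normalizedFactors P).count p)

/-- The product of the prime powers. -/
noncomputable def codeProd (s : Multiset (F[X] × ℕ)) : F[X] := (s.map fun x => x.1 ^ x.2).prod

lemma codeProd_monic {s : Multiset (F[X] × ℕ)} (hs : CodeValid s) : (codeProd s).Monic :=
  monic_multiset_prod_of_monic _ _ fun x hx => (hs x hx).1.pow _

lemma codeProd_natDegree {s : Multiset (F[X] × ℕ)} (hs : CodeValid s) :
    (codeProd s).natDegree = codeWeight s := by
  rw [codeProd, natDegree_multiset_prod_of_monic, codeWeight, Multiset.map_map]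
  · simp [natDegree_pow]
  · intro f hf
    obtain ⟨x, hx, rfl⟩ := Multiset.mem_map.mp hf
    exact (hs x hx).1.pow _

lemma normalizedFactors_codeProd {s : Multiset (F[X] × ℕ)} (hs : CodeValid s) :
    UniqueFactorizationMonoid.normalizedFactors (codeProd s) =
      s.bind fun x => Multiset.replicate x.2 x.1 := by
  induction s using Multiset.induction_on with
  | empty => simp [codeProd]
  | cons x s ih =>
    have h0 := codeProd_monic hs.of_cons
    obtain ⟨h1, h2, h3⟩ := hs x (Multiset.mem_cons_self _ _)
    have : codeProd (x ::ₘ s) = x.1 ^ x.2 * codeProd s := by simp [codeProd]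
    rw [this, UniqueFactorizationMonoid.normalizedFactors_mul (pow_ne_zero _ h1.ne_zero)
      h0.ne_zero, ih hs.of_cons, UniqueFactorizationMonoid.normalizedFactors_pow,
      UniqueFactorizationMonoid.normalizedFactors_irreducible h2, h1.normalize_eq_self,
      Multiset.nsmul_singleton, Multiset.cons_bind]

lemma count_bind_replicate {α : Type} [DecidableEq α] (s : Multiset (α × ℕ)) (hnd : (s.map Prod.fst).Nodup)
    {p : α} {e : ℕ} (h : (p, e) ∈ s) :
    (s.bind fun x => Multiset.replicate x.2 x.1).count p = e := by
  obtain ⟨t, rfl⟩ := Multiset.exists_cons_of_mem h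
  rw [Multiset.map_cons, Multiset.nodup_cons] at hnd
  rw [Multiset.cons_bind, Multiset.count_add, Multiset.count_replicate_self,
    Nat.add_eq_left, Multiset.count_eq_zero, Multiset.mem_bind]
  rintro ⟨x, hx, hp⟩
  exact hnd.1 (Multiset.mem_map.mpr ⟨x, hx, (Multiset.eq_of_mem_replicate hp).symm⟩)

lemma decode_codeProd {s : Multiset (F[X] × ℕ)} (hs : CodeValid s)
    (hnd : (s.map Prod.fst).Nodup) : decode (codeProd s) = s := by
  have hn2 : s.Nodup := hnd.of_map
  have hn1 : (decode (codeProd s)).Nodup :=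
    Multiset.Nodup.map (fun a b h => (Prod.ext_iff.mp h).1) (Finset.nodup _)
  rw [Multiset.Nodup.ext hn1 hn2]
  rintro ⟨p, e⟩
  have hmem : ∀ p, p ∈ UniqueFactorizationMonoid.normalizedFactors (codeProd s) ↔
      ∃ e, (p, e) ∈ s := by
    intro p
    rw [normalizedFactors_codeProd hs, Multiset.mem_bind]
    constructor
    · rintro ⟨x, hx, hp⟩
      obtain rfl := Multiset.eq_of_mem_replicate hp
      exact ⟨x.2, hx⟩
    · rintro ⟨e, he⟩
      refine ⟨_, he, ?_⟩
      rw [Multiset.mem_replicate]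
      have := (hs _ he).2.2
      exact ⟨by simp only at this; omega, rfl⟩
  constructor
  · intro h
    obtain ⟨r, hr, hre⟩ := Multiset.mem_map.mp h
    obtain ⟨rfl, rfl⟩ := Prod.ext_iff.mp hre
    obtain ⟨e, he⟩ := (hmem r).mp (Multiset.mem_toFinset.mp hr)
    rw [show (UniqueFactorizationMonoid.normalizedFactors (codeProd s)).count r = e by
      rw [normalizedFactors_codeProd hs]; exact count_bind_replicate s hnd he]
    exact he
  · intro h
    refine Multiset.mem_map.mpr ⟨p, Multiset.mem_toFinset.mpr ((hmem p).mpr ⟨e, h⟩), ?_⟩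
    rw [normalizedFactors_codeProd hs]
    exact congrArg (Prod.mk p) (count_bind_replicate s hnd h)

lemma exists_cover_codes_sharp (n : ℕ) (hn : 1 ≤ n) : ∃ C : ℕ, ∀ (F : Type) [Field F] [Fintype F],
    ∃ T : Finset (Multiset (F[X] × ℕ)),
      T.card ≤ Fintype.card F ^ n + C * Fintype.card F ^ (n - 1) ∧
      ∀ s, CodeValid s → codeWeight s = n → s ∈ T := by
  obtain ⟨C, hC⟩ := exists_cover_codes n
  refine ⟨(n + 1) * ((n + 1) * ((n + 1) * C)), fun F _ _ => ?_⟩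
  have h0 : ∀ i : ℕ, ∃ T : Finset (Multiset (F[X] × ℕ)), i ≤ n →
      T.card ≤ C * Fintype.card F ^ i ∧ ∀ s, CodeValid s → codeWeight s = i → s ∈ T := by
    intro i
    by_cases hi : i ≤ n
    · obtain ⟨T, hT⟩ := hC i hi F
      exact ⟨T, fun _ => hT⟩
    · exact ⟨∅, fun h => absurd h hi⟩
  choose T hT using h0
  have hq : 1 ≤ Fintype.card F := Fintype.card_pos
  let S : ℕ → ℕ → ℕ → Finset (Multiset (F[X] × ℕ)) := fun d a b =>
    if 1 ≤ d ∧ 1 ≤ a ∧ 1 ≤ b ∧ a * d + b * d ≤ n then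
      (monicFinset F d ×ˢ T (n - (a * d + b * d))).image fun x => (x.1, a) ::ₘ (x.1, b) ::ₘ x.2
      else ∅
  refine ⟨(monicFinset F n).image decode ∪ (Finset.range (n + 1)).biUnion fun d =>
    (Finset.range (n + 1)).biUnion fun a => (Finset.range (n + 1)).biUnion fun b => S d a b, ?_, ?_⟩
  · refine (Finset.card_union_le _ _).trans (Nat.add_le_add
      (Finset.card_image_le.trans (card_monicFinset_le n)) ?_)
    have h1 : ∀ d ∈ Finset.range (n + 1), ∀ a ∈ Finset.range (n + 1), ∀ b ∈ Finset.range (n + 1),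
        (S d a b).card ≤ C * Fintype.card F ^ (n - 1) := by
      intro d _ a _ b _
      simp only [S]
      split_ifs with h
      · obtain ⟨hd, ha, hb, hle⟩ := h
        have hda : d ≤ a * d := Nat.le_mul_of_pos_left d ha
        have hdb : d ≤ b * d := Nat.le_mul_of_pos_left d hb
        refine Finset.card_image_le.trans ?_
        rw [Finset.card_product]
        refine (Nat.mul_le_mul (card_monicFinset_le d) (hT _ (by omega)).1).trans ?_
        calc Fintype.card F ^ d * (C * Fintype.card F ^ (n - (a * d + b * d)))
            = C * Fintype.card F ^ (d + (n - (a * d + b * d))) := by rw [pow_add]; ring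
          _ ≤ _ := Nat.mul_le_mul_left _ (Nat.pow_le_pow_right hq (by omega))
      · simp
    refine (Finset.card_biUnion_le_card_mul _ _ _ fun d hd =>
      Finset.card_biUnion_le_card_mul _ _ _ fun a ha =>
      Finset.card_biUnion_le_card_mul _ _ _ (h1 d hd a ha)).trans ?_
    simp only [Finset.card_range]
    apply le_of_eq
    ring
  · intro s hs hw
    rw [Finset.mem_union]
    by_cases hnd : (s.map Prod.fst).Nodup
    · left
      rw [Finset.mem_image]
      exact ⟨_, mem_monicFinset (codeProd_monic hs) ((codeProd_natDegree hs).trans hw),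
        decode_codeProd hs hnd⟩
    · right
      rw [Multiset.nodup_iff_ne_cons_cons] at hnd
      push Not at hnd
      obtain ⟨p, t, hpt⟩ := hnd
      obtain ⟨x, hx, hxp, hxt⟩ := (Multiset.map_eq_cons _ _ _ _).mpr hpt
      obtain ⟨y, hy, hyp, hyt⟩ := (Multiset.map_eq_cons _ _ _ _).mpr hxt
      obtain ⟨u, hu⟩ := Multiset.exists_cons_of_mem hy
      have hs' : s = (p, x.2) ::ₘ (p, y.2) ::ₘ u := by
        rw [← Multiset.cons_erase hx, hu, ← hxp]
        congr 2
        rw [hxp, ← hyp]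
      rw [hs'] at hs hw ⊢
      obtain ⟨h1, h2, h3⟩ := hs _ (Multiset.mem_cons_self _ _)
      have h4 := (hs.of_cons _ (Multiset.mem_cons_self _ _)).2.2
      simp only at h1 h2 h3 h4
      rw [codeWeight_cons, codeWeight_cons] at hw
      simp only at hw
      have hd := h2.natDegree_pos
      have hle1 : p.natDegree ≤ x.2 * p.natDegree := Nat.le_mul_of_pos_left _ h3
      have hle2 : x.2 ≤ x.2 * p.natDegree := Nat.le_mul_of_pos_right _ hd
      have hle3 : y.2 ≤ y.2 * p.natDegree := Nat.le_mul_of_pos_right _ hd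
      simp only [Finset.mem_biUnion, Finset.mem_range]
      refine ⟨p.natDegree, by omega, x.2, by omega, y.2, by omega, ?_⟩
      simp only [S]
      rw [if_pos ⟨hd, h3, h4, by omega⟩, Finset.mem_image]
      exact ⟨(p, u), Finset.mem_product.mpr ⟨mem_monicFinset h1 rfl,
        (hT _ (by omega)).2 u hs.of_cons.of_cons (by omega)⟩, rfl⟩

lemma finrank_CF_le_card {F : Type} [Field F] [Fintype F] {n : ℕ}
    (T : Finset (Multiset (F[X] × ℕ)))
    (hT : ∀ s, CodeValid s → codeWeight s = n → s ∈ T) :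
    Module.finrank ℂ (CF (Fin n) F) ≤ T.card := by
  let x : T → Matrix (Fin n) (Fin n) F := fun t => if h : ∃ X, IsCode X t.1 then h.choose else 0
  let l : CF (Fin n) F →ₗ[ℂ] (T → ℂ) :=
    (LinearMap.funLeft ℂ ℂ x).comp (CF (Fin n) F).subtype
  have hl : Function.Injective l := by
    rw [← LinearMap.ker_eq_bot, LinearMap.ker_eq_bot']
    rintro ⟨φ, hφ⟩ h
    ext X
    obtain ⟨s, h1, h2, h3⟩ := exists_code X
    have h4 : ∃ X : Matrix (Fin n) (Fin n) F, IsCode X s := ⟨X, h1⟩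
    have h5 : x ⟨s, hT s h2 h3⟩ = h4.choose := dif_pos h4
    obtain ⟨g, g', hg, he⟩ := IsCode.conj h4.choose_spec h1
    have h6 : φ (x ⟨s, hT s h2 h3⟩) = 0 := congrFun h ⟨s, hT s h2 h3⟩
    change φ X = 0
    rw [he, hφ.2 _ _ _ hg, ← h5, h6]
  refine (LinearMap.finrank_le_finrank_of_injective hl).trans ?_
  simp

lemma exists_finrank_CF_le (n : ℕ) : ∃ C : ℕ, ∀ (F : Type) [Field F] [Fintype F],
    (n = 0 → Module.finrank ℂ (CF (Fin n) F) ≤ 1) ∧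
    (1 ≤ n → Module.finrank ℂ (CF (Fin n) F) ≤
      Fintype.card F ^ n + C * Fintype.card F ^ (n - 1)) := by
  rcases Nat.eq_zero_or_pos n with rfl | hn
  · refine ⟨0, fun F _ _ => ⟨fun _ => ?_, fun h => absurd h (by omega)⟩⟩
    refine (Submodule.finrank_le _).trans ?_
    rw [Module.finrank_fintype_fun_eq_card]
    exact Fintype.card_le_one_iff_subsingleton.mpr inferInstance
  · obtain ⟨C, hC⟩ := exists_cover_codes_sharp n hn
    refine ⟨C, fun F _ _ => ⟨fun h => absurd h (by omega), fun _ => ?_⟩⟩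
    obtain ⟨T, h1, h2⟩ := hC F
    exact (finrank_CF_le_card T h2).trans h1

end CountCodes

section LowerCF
open Polynomial
variable {F : Type} [Field F] [Fintype F] {n : ℕ}

lemma card_le_finrank_of_eval {M I : Type} [Fintype M] [Fintype I] (V : Submodule ℂ (M → ℂ))
    (v : I → M → ℂ) (hv : ∀ i, v i ∈ V) (x : I → M) (h : ∀ i j, v i (x j) ≠ 0 ↔ i = j) :
    Fintype.card I ≤ Module.finrank ℂ V := by
  have hli : LinearIndependent ℂ (fun i => (⟨v i, hv i⟩ : V)) := by
    rw [Fintype.linearIndependent_iff]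
    intro g hg j
    have h1 := congrFun (congrArg Subtype.val hg) (x j)
    simp only [AddSubmonoidClass.coe_finsetSum, Submodule.coe_smul, Finset.sum_apply,
      Pi.smul_apply, smul_eq_mul] at h1
    rw [Finset.sum_eq_single j (fun i _ hij => by
      rw [not_not.mp (mt (h i j).mp hij), mul_zero]) (by simp)] at h1
    exact (mul_eq_zero.mp h1).resolve_right ((h j j).mpr rfl)
  exact hli.fintype_card_le_finrank

lemma exists_charpoly_eq {P : F[X]} {d : ℕ} (hP : P.Monic) (hd : P.natDegree = d) :
    ∃ T : Matrix (Fin d) (Fin d) F, T.charpoly = P := by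
  subst hd
  have h1 := charpoly_leftMulMatrix (AdjoinRoot.powerBasis hP.ne_zero)
  rw [AdjoinRoot.minpoly_powerBasis_gen_of_monic hP] at h1
  refine ⟨_, ((Matrix.charpoly_reindex (finCongr (AdjoinRoot.powerBasis_dim hP.ne_zero)) _).trans h1)⟩

/-- A matrix whose characteristic polynomial has the given lower coefficients. -/
noncomputable def companion {d : ℕ} (f : Fin d → F) : Matrix (Fin d) (Fin d) F :=
  (exists_charpoly_eq (monicPoly_monic f) (monicPoly_natDegree f)).choose

lemma companion_charpoly {d : ℕ} (f : Fin d → F) : (companion f).charpoly = monicPoly f :=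
  (exists_charpoly_eq (monicPoly_monic f) (monicPoly_natDegree f)).choose_spec

lemma charpoly_conj {ι : Type} [Fintype ι] [DecidableEq ι] {X Y h h' : Matrix ι ι F}
    (hh : h * h' = 1) (hXY : h * X = Y * h) : X.charpoly = Y.charpoly := by
  have hu : h' * h = 1 := mul_eq_one_comm.mp hh
  have h1 := Matrix.charpoly_units_conj ⟨h, h', hh, hu⟩ X
  rw [← Matrix.coe_units_inv] at h1
  rw [← h1]
  congr 1
  change h * X * h' = Y
  rw [hXY, Matrix.mul_assoc, hh, Matrix.mul_one]

/-- Coefficient vectors of the monic polynomials of degree `d` not vanishing at zero. -/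
abbrev UnitCoeffs (F : Type) [Field F] (d : ℕ) : Type :=
  {f : Fin d → F // (monicPoly f).coeff 0 ≠ 0}

lemma det_companion_ne_zero {d : ℕ} (f : UnitCoeffs F d) : (companion f.1).det ≠ 0 := by
  rw [Matrix.det_eq_sign_charpoly_coeff, companion_charpoly]
  exact mul_ne_zero (pow_ne_zero _ (neg_ne_zero.mpr one_ne_zero)) f.2

lemma card_unitCoeffs_zero : 1 ≤ Fintype.card (UnitCoeffs F 0) := by
  apply Fintype.card_pos_iff.mpr
  exact ⟨⟨0, by simp [monicPoly]⟩⟩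

lemma card_unitCoeffs_succ (d : ℕ) :
    Fintype.card F ^ (d + 1) ≤ Fintype.card (UnitCoeffs F (d + 1)) + Fintype.card F ^ d := by
  have h1 : Fintype.card (Fˣ × (Fin d → F)) ≤ Fintype.card (UnitCoeffs F (d + 1)) := by
    refine Fintype.card_le_of_injective (fun x => ⟨Fin.cons (x.1 : F) x.2, ?_⟩) ?_
    · have := monicPoly_coeff (Fin.cons (x.1 : F) x.2 : Fin (d + 1) → F) 0
      simp only [Fin.cons_zero, Fin.val_zero] at this
      rw [this]
      exact x.1.ne_zero
    · rintro ⟨a, b⟩ ⟨a', b'⟩ h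
      have h2 := Fin.cons_injective2 (Subtype.mk.inj h)
      exact Prod.ext (Units.ext h2.1) h2.2
  rw [Fintype.card_prod, Fintype.card_units, Fintype.card_fun, Fintype.card_fin] at h1
  have hq : 1 ≤ Fintype.card F := Fintype.card_pos
  calc Fintype.card F ^ (d + 1)
      = (Fintype.card F - 1) * Fintype.card F ^ d + Fintype.card F ^ d := by
        rw [pow_succ, ← Nat.succ_mul, Nat.succ_eq_add_one, Nat.sub_add_cancel hq, mul_comm]
    _ ≤ _ := Nat.add_le_add_right h1 _

lemma card_unitCoeffs_le_finrank_CF (n : ℕ) :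
    Fintype.card (UnitCoeffs F n) ≤ Module.finrank ℂ (CF (Fin n) F) := by
  refine card_le_finrank_of_eval _
    (fun f X => if X.charpoly = monicPoly f.1 then 1 else 0) (fun f => ⟨fun X hX => ?_, ?_⟩)
    (fun f => companion f.1) fun f g => ?_
  · refine if_neg fun h => ?_
    rw [Matrix.det_eq_sign_charpoly_coeff, h] at hX
    exact mul_ne_zero (pow_ne_zero _ (neg_ne_zero.mpr one_ne_zero)) f.2 hX
  · intro h h' X hh
    beta_reduce
    rw [charpoly_conj (X := X) (Y := h * X * h') hh
      (by rw [Matrix.mul_assoc, mul_eq_one_comm.mp hh, Matrix.mul_one])]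
  · simp only [companion_charpoly, ne_eq, ite_eq_right_iff, one_ne_zero, imp_false, not_not]
    rw [monicPoly_injective.eq_iff, Subtype.ext_iff, eq_comm]

lemma pow_le_finrank_CF (d : ℕ) :
    Fintype.card F ^ (d + 1) ≤ Module.finrank ℂ (CF (Fin (d + 1)) F) + Fintype.card F ^ d :=
  (card_unitCoeffs_succ d).trans (Nat.add_le_add_right (card_unitCoeffs_le_finrank_CF _) _)

end LowerCF

section Intertwiners
open Polynomial
variable {F : Type} [Field F] [Fintype F] {n k : ℕ}

/-- The number of injective solutions of `X x = x T`, on matrices of determinant `δ`. -/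
noncomputable def embCount {ι : Type} [Fintype ι] [DecidableEq ι] (T : Matrix (Fin k) (Fin k) F)
    (δ : F) (X : Matrix ι ι F) : ℂ :=
  if X.det = δ then ∑ x : Matrix ι (Fin k) F, if LInv x ∧ X * x = x * T then 1 else 0 else 0

lemma embCount_ne_zero {ι : Type} [Fintype ι] [DecidableEq ι] {T : Matrix (Fin k) (Fin k) F}
    {δ : F} {X : Matrix ι ι F} :
    embCount T δ X ≠ 0 ↔ X.det = δ ∧ ∃ x : Matrix ι (Fin k) F, LInv x ∧ X * x = x * T := by
  unfold embCount
  split_ifs with h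
  · rw [Finset.sum_boole, Nat.cast_ne_zero, Finset.card_ne_zero]
    constructor
    · rintro ⟨x, hx⟩
      exact ⟨h, x, (Finset.mem_filter.mp hx).2⟩
    · rintro ⟨-, x, hx⟩
      exact ⟨x, Finset.mem_filter.mpr ⟨Finset.mem_univ _, hx⟩⟩
  · simp [h]

lemma embCount_mem_CF (T : Matrix (Fin k) (Fin k) F) {δ : F} (hδ : δ ≠ 0) :
    embCount T δ ∈ CF (Fin n) F := by
  refine ⟨fun X hX => if_neg (by rw [hX]; exact hδ.symm), fun h h' X hh => ?_⟩
  have hu : h' * h = 1 := mul_eq_one_comm.mp hh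
  have hdet : (h * X * h').det = X.det := by
    rw [Matrix.det_mul, Matrix.det_mul, mul_right_comm, ← Matrix.det_mul, hh, Matrix.det_one,
      one_mul]
  unfold embCount
  rw [hdet]
  split_ifs with hX
  · symm
    refine Fintype.sum_bijective (fun x => h * x) ⟨fun x y hxy => ?_, fun y => ⟨h' * y, ?_⟩⟩ _ _
      fun x => ?_
    · have := congrArg (fun z => h' * z) hxy
      simpa [← Matrix.mul_assoc, hu] using this
    · simp [← Matrix.mul_assoc, hh]
    · have h1 : LInv (h * x) ↔ LInv x := by
        rw [lInv_iff, lInv_iff]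
        refine forall_congr' fun v => ?_
        rw [← Matrix.mulVec_mulVec]
        constructor
        · intro H hv
          exact H (by rw [hv, Matrix.mulVec_zero])
        · intro H hv
          refine H ?_
          have := congrArg (fun z => h' *ᵥ z) hv
          simpa [Matrix.mulVec_mulVec, ← Matrix.mul_assoc, hu] using this
      have h2 : h * X * h' * (h * x) = h * x * T ↔ X * x = x * T := by
        rw [show h * X * h' * (h * x) = h * (X * x) by
          simp only [Matrix.mul_assoc]
          rw [← Matrix.mul_assoc h' h, hu, Matrix.one_mul], Matrix.mul_assoc h x T]
        constructor
        · intro H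
          have := congrArg (fun z => h' * z) H
          simpa only [← Matrix.mul_assoc, hu, Matrix.one_mul] using this
        · intro H
          rw [H]
      simp only [h1, h2]
  · rfl

lemma exists_vecMul_eq_zero (M : Matrix (Fin (k + 1)) (Fin k) F) : ∃ w, w ≠ 0 ∧ w ᵥ* M = 0 := by
  have := LinearMap.ker_ne_bot_of_finrank_lt (f := Matrix.vecMulLinear M) (by simp)
  obtain ⟨w, hw, hw0⟩ := (Submodule.ne_bot_iff _).mp this
  exact ⟨w, hw0, hw⟩

lemma embCount_killed {ψ : AddChar F ℂ} (hψ : ψ ≠ 1) (T : Matrix (Fin k) (Fin k) F) (δ : F) :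
    KilledFn ψ (k + 1) (embCount T δ : Matrix (Fin n) (Fin n) F → ℂ) := by
  intro Y Z _ _ hZY X
  have hdet : ∀ A : Matrix (Fin (k + 1)) (Fin (k + 1)) F, (X * (1 + Y * A * Z)).det = X.det := by
    intro A
    rw [Matrix.det_mul, Matrix.mul_assoc, Matrix.det_one_add_mul_comm, Matrix.mul_assoc, hZY,
      Matrix.mul_zero, add_zero, Matrix.det_one, mul_one]
  unfold embCount
  simp only [hdet]
  split_ifs with hX
  swap
  · simp
  simp only [Finset.smul_sum]
  rw [Finset.sum_comm]
  refine Finset.sum_eq_zero fun x _ => ?_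
  obtain ⟨w, hw, hwM⟩ := exists_vecMul_eq_zero (Z * x)
  obtain ⟨i, hi⟩ := Function.ne_iff.mp hw
  obtain ⟨c, hc⟩ := AddChar.ne_one_iff.mp hψ
  let s : Fin (k + 1) → F := Pi.single i (-c / w i)
  have hsw : (vecMulVec s w).trace = -c := by
    rw [Matrix.trace_vecMulVec]
    simp only [s, single_dotProduct]
    exact div_mul_cancel₀ _ hi
  have hZ : vecMulVec s w * (Z * x) = 0 := by
    rw [Matrix.vecMulVec_mul, hwM]
    ext a b
    simp [vecMulVec_apply]
  set S := ∑ A : Matrix (Fin (k + 1)) (Fin (k + 1)) F, ψ (-A.trace) •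
    (if LInv x ∧ X * (1 + Y * A * Z) * x = x * T then (1 : ℂ) else 0) with hS
  have key : S = ψ c * S := by
    conv_lhs => rw [hS, ← Equiv.sum_comp (Equiv.addRight (vecMulVec s w))]
    rw [hS, Finset.mul_sum]
    refine Finset.sum_congr rfl fun A _ => ?_
    have h1 : X * (1 + Y * (A + vecMulVec s w) * Z) * x = X * (1 + Y * A * Z) * x := by
      have : Y * (vecMulVec s w) * Z * x = 0 := by
        rw [Matrix.mul_assoc, Matrix.mul_assoc, hZ, Matrix.mul_zero]
      rw [Matrix.mul_assoc, Matrix.mul_assoc X]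
      congr 1
      rw [Matrix.mul_add Y, Matrix.add_mul (Y * A), Matrix.add_mul, Matrix.add_mul (Y * A * Z), this,
        add_zero, Matrix.add_mul]
    simp only [Equiv.coe_addRight, h1]
    rw [Matrix.trace_add, hsw, neg_add, neg_neg, AddChar.map_add_eq_mul, smul_eq_mul, smul_eq_mul]
    ring
  have h2 : (1 - ψ c) * S = 0 := by rw [sub_mul, one_mul, ← key, sub_self]
  exact (mul_eq_zero.mp h2).resolve_left (sub_ne_zero.mpr (Ne.symm hc))

lemma embCount_mem_KCF {ψ : AddChar F ℂ} (hψ : ψ ≠ 1) (T : Matrix (Fin k) (Fin k) F) {δ : F}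
    (hδ : δ ≠ 0) : embCount T δ ∈ KCF (Fin n) ψ (k + 1) :=
  ⟨embCount_mem_CF T hδ, embCount_killed hψ T δ⟩

end Intertwiners

section LargeDegree
open Polynomial
variable {F : Type} [Field F] [Fintype F]

lemma exists_norm_eq_of_large_degree {K : Type} [Field K] [Algebra F K] [Finite K] {k : ℕ}
    (hk : k + 1 ≤ Module.finrank F K) (u : Fˣ) :
    ∃ β : K, Algebra.norm F β = u ∧ ∀ g : F[X], g ≠ 0 → g.natDegree ≤ k → aeval β g ≠ 0 := by
  have : Fintype K := Fintype.ofFinite K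
  have hfd : Module.Finite F K := Module.Finite.of_finite
  set q := Fintype.card F with hq
  have hq2 : 2 ≤ q := Fintype.one_lt_card
  have hcardK : Fintype.card K = q ^ Module.finrank F K := Module.card_eq_pow_finrank
  obtain ⟨α, hα⟩ := IsCyclic.exists_generator (α := Kˣ)
  have hord : orderOf α = Fintype.card K - 1 := by
    rw [orderOf_eq_card_of_forall_mem_zpowers hα, Nat.card_eq_fintype_card, Fintype.card_units]
  -- the norm of a generator generates, so `u` is a small positive power of it
  have hgen : ∃ i : ℕ, 1 ≤ i ∧ i ≤ q - 1 ∧ Units.map (Algebra.norm F (S := K)) (α ^ i) = u := by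
    obtain ⟨v, hv⟩ := FiniteField.unitsMap_norm_surjective F K u
    obtain ⟨j, hj⟩ := mem_powers_iff_mem_zpowers.mpr (hα v)
    simp only at hj
    set γ := Units.map (Algebra.norm F (S := K)) α with hγ
    have hγq : γ ^ (q - 1) = 1 := by
      rw [hq, ← Fintype.card_units]; exact pow_card_eq_one
    have hu : u = γ ^ j := by rw [← hv, ← hj, map_pow]
    by_cases h0 : j % (q - 1) = 0
    · refine ⟨q - 1, by omega, le_rfl, ?_⟩
      rw [map_pow, ← hγ, hγq, hu, pow_eq_pow_mod j hγq, h0, pow_zero]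
    · refine ⟨j % (q - 1), by omega, (Nat.mod_lt _ (by omega)).le, ?_⟩
      rw [map_pow, ← hγ, hu, ← pow_eq_pow_mod j hγq]
  obtain ⟨i, hi1, hi2, hi⟩ := hgen
  refine ⟨((α ^ i : Kˣ) : K), congrArg Units.val hi, fun g hg hgk hz => ?_⟩
  set β : K := ((α ^ i : Kˣ) : K) with hβ
  have hβint : IsIntegral F β := IsIntegral.of_finite F β
  have hd1 := minpoly.natDegree_pos hβint
  have hdk : (minpoly F β).natDegree ≤ k :=
    (natDegree_le_of_dvd (minpoly.dvd F β hz) hg).trans hgk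
  set d := (minpoly F β).natDegree with hd
  let L := IntermediateField.adjoin F {β}
  have hL : Module.finrank F L = d := IntermediateField.adjoin.finrank hβint
  have hLc : Fintype.card L = q ^ d := by rw [← hL]; exact Module.card_eq_pow_finrank
  have hβL : β ^ q ^ d = β := by
    have := FiniteField.pow_card (⟨β, IntermediateField.mem_adjoin_simple_self F β⟩ : L)
    rw [hLc] at this
    exact congrArg Subtype.val this
  have hqd : 1 ≤ q ^ d := Nat.one_le_pow _ _ (by omega)
  have hone : α ^ (i * (q ^ d - 1)) = 1 := by
    rw [pow_mul]
    have h1 : (α ^ i) ^ (q ^ d - 1) * α ^ i = 1 * α ^ i := by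
      rw [← pow_succ, Nat.sub_add_cancel hqd, one_mul]
      exact Units.ext (by simpa [hβ] using hβL)
    exact mul_right_cancel h1
  have hdvd := orderOf_dvd_of_pow_eq_one hone
  rw [hord, hcardK] at hdvd
  have hqd2 : 2 ≤ q ^ d := hq2.trans (Nat.le_self_pow (by omega) q)
  have hpos : 0 < i * (q ^ d - 1) := Nat.mul_pos hi1 (by omega)
  have hle := Nat.le_of_dvd hpos hdvd
  have h2 : q ^ d ≤ q ^ k := Nat.pow_le_pow_right (by omega) hdk
  have h3 : q ^ (k + 1) ≤ q ^ Module.finrank F K := Nat.pow_le_pow_right (by omega) hk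
  have h4 : i * (q ^ d - 1) ≤ (q - 1) * (q ^ k - 1) := Nat.mul_le_mul hi2 (by omega)
  have h5 : (q - 1) * (q ^ k - 1) + q + q ^ k = q ^ (k + 1) + 1 := by
    obtain ⟨a, ha⟩ : ∃ a, q = a + 1 := ⟨q - 1, by omega⟩
    obtain ⟨b, hb⟩ : ∃ b, q ^ k = b + 1 := ⟨q ^ k - 1, by omega⟩
    rw [pow_succ, hb, ha, Nat.add_sub_cancel, Nat.add_sub_cancel]
    ring
  omega

lemma exists_det_eq_of_large_degree {k N : ℕ} (hk : k + 1 ≤ N) (u : Fˣ) :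
    ∃ P : Matrix (Fin N) (Fin N) F, P.det = u ∧
      ∀ g : F[X], g ≠ 0 → g.natDegree ≤ k → IsUnit (aeval P g) := by
  obtain ⟨p, hp⟩ := CharP.exists F
  have : Fact p.Prime := ⟨CharP.char_is_prime F p⟩
  have : NeZero N := ⟨by omega⟩
  let K := FiniteField.Extension F p N
  have hK : Module.finrank F K = N := FiniteField.finrank_extension F p N
  have : Finite K := Module.finite_of_finite F
  obtain ⟨β, h1, h2⟩ := exists_norm_eq_of_large_degree (K := K) (by rw [hK]; exact hk) u
  let b : Module.Basis (Fin N) F K := Module.finBasisOfFinrankEq F K hK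
  refine ⟨Algebra.leftMulMatrix b β, by rw [← Algebra.norm_eq_matrix_det, h1], fun g hg hgk => ?_⟩
  rw [Polynomial.aeval_algHom_apply]
  exact (isUnit_iff_ne_zero.mpr (h2 g hg hgk)).map _

end LargeDegree

section LowerKCF
open Polynomial
variable {F : Type} [Field F] [Fintype F] {n k N : ℕ}

lemma aeval_mul_of_mul_eq {ι κ : Type} [Fintype ι] [DecidableEq ι] [Fintype κ] [DecidableEq κ]
    {P : Matrix ι ι F} {T : Matrix κ κ F} {y : Matrix ι κ F} (h : P * y = y * T) (g : F[X]) :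
    aeval P g * y = y * aeval T g := by
  induction g using Polynomial.induction_on' with
  | add a b ha hb => rw [map_add, map_add, Matrix.add_mul, Matrix.mul_add, ha, hb]
  | monomial m c =>
    have hp : ∀ m : ℕ, P ^ m * y = y * T ^ m := by
      intro m
      induction m with
      | zero => simp
      | succ m ih => rw [pow_succ, pow_succ, Matrix.mul_assoc, h, ← Matrix.mul_assoc, ih,
          Matrix.mul_assoc]
    rw [aeval_monomial, aeval_monomial, ← Algebra.smul_def, ← Algebra.smul_def, Matrix.smul_mul,
      Matrix.mul_smul, hp]

lemma charpoly_eq_of_embedding {A T : Matrix (Fin k) (Fin k) F} {P : Matrix (Fin N) (Fin N) F}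
    (hP : ∀ g : F[X], g ≠ 0 → g.natDegree ≤ k → IsUnit (aeval P g))
    {x : Matrix (Fin k ⊕ Fin N) (Fin k) F} (hx : LInv x)
    (h : fromBlocks A 0 0 P * x = x * T) : A.charpoly = T.charpoly := by
  rw [← fromRows_toRows x] at h hx
  rw [fromBlocks_mul_fromRows, fromRows_mul] at h
  have h1 := congrArg Matrix.toRows₁ h
  have h2 := congrArg Matrix.toRows₂ h
  rw [toRows₁_fromRows, toRows₁_fromRows] at h1
  rw [toRows₂_fromRows, toRows₂_fromRows] at h2
  simp only [Matrix.zero_mul, add_zero, zero_add] at h1 h2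
  have h3 := aeval_mul_of_mul_eq h2 T.charpoly
  rw [Matrix.aeval_self_charpoly, Matrix.mul_zero] at h3
  obtain ⟨u, hu⟩ := hP T.charpoly T.charpoly_monic.ne_zero (by
    rw [Matrix.charpoly_natDegree_eq_dim, Fintype.card_fin])
  have h4 : x.toRows₂ = 0 := by
    have := congrArg (fun z => (↑u⁻¹ : Matrix (Fin N) (Fin N) F) * z) h3
    simpa [← hu, ← Matrix.mul_assoc] using this
  obtain ⟨x', hx'⟩ := hx
  rw [← fromCols_toCols x', fromCols_mul_fromRows, h4, Matrix.mul_zero, add_zero] at hx'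
  exact (charpoly_conj (mul_eq_one_comm.mp hx') h1.symm).symm

lemma exists_embedding_submatrix {ι κ : Type} [Fintype ι] [DecidableEq ι] [Fintype κ]
    [DecidableEq κ] (e : ι ≃ κ) (X : Matrix ι ι F) (T : Matrix (Fin k) (Fin k) F) :
    (∃ x : Matrix κ (Fin k) F, LInv x ∧ X.submatrix e.symm e.symm * x = x * T) ↔
      ∃ x : Matrix ι (Fin k) F, LInv x ∧ X * x = x * T := by
  constructor
  · rintro ⟨x, ⟨x', hx'⟩, hx⟩
    refine ⟨x.submatrix e id, ⟨x'.submatrix id e, ?_⟩, ?_⟩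
    · rw [← Matrix.submatrix_mul _ _ _ _ _ e.bijective, hx']
      simp
    · have := congrArg (fun z => z.submatrix e id) hx
      rw [Matrix.submatrix_mul _ _ _ _ _ e.bijective,
        Matrix.submatrix_mul _ _ _ _ _ Function.bijective_id] at this
      simpa using this
  · rintro ⟨x, ⟨x', hx'⟩, hx⟩
    refine ⟨x.submatrix e.symm id, ⟨x'.submatrix id e.symm, ?_⟩, ?_⟩
    · rw [← Matrix.submatrix_mul _ _ _ _ _ e.symm.bijective, hx']
      simp
    · rw [← Matrix.submatrix_mul _ _ _ _ _ e.symm.bijective, hx,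
        Matrix.submatrix_mul _ _ _ _ _ Function.bijective_id]
      simp

lemma card_le_finrank_KCF {ψ : AddChar F ℂ} (hψ : ψ ≠ 1) (hn : 2 * k + 1 ≤ n) :
    (Fintype.card F - 1) * Fintype.card (UnitCoeffs F k) ≤
      Module.finrank ℂ (KCF (Fin n) ψ (k + 1)) := by
  obtain ⟨N, rfl⟩ : ∃ N, n = k + N := ⟨n - k, by omega⟩
  choose P hP1 hP2 using fun u : Fˣ =>
    exists_det_eq_of_large_degree (F := F) (k := k) (N := N) (by omega) u
  let e : Fin k ⊕ Fin N ≃ Fin (k + N) := finSumFinEquiv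
  rw [← Fintype.card_units, ← Fintype.card_prod]
  refine card_le_finrank_of_eval _
    (fun i : Fˣ × UnitCoeffs F k => embCount (companion i.2.1) ((companion i.2.1).det * i.1))
    (fun i => embCount_mem_KCF hψ _ (mul_ne_zero (det_companion_ne_zero i.2) i.1.ne_zero))
    (fun i => (fromBlocks (companion i.2.1) 0 0 (P i.1)).submatrix e.symm e.symm) ?_
  rintro ⟨u, f⟩ ⟨v, g⟩
  rw [embCount_ne_zero, exists_embedding_submatrix, Matrix.det_submatrix_equiv_self,
    Matrix.det_fromBlocks_zero₂₁, hP1]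
  constructor
  · rintro ⟨h1, x, hx, h2⟩
    have h3 := charpoly_eq_of_embedding (hP2 v) hx h2
    rw [companion_charpoly, companion_charpoly] at h3
    have h4 : g = f := Subtype.ext (monicPoly_injective h3)
    subst h4
    have h5 := mul_left_cancel₀ (det_companion_ne_zero g) h1
    exact Prod.ext (Units.ext h5.symm) rfl
  · intro h
    obtain ⟨rfl, rfl⟩ := Prod.ext_iff.mp h
    refine ⟨rfl, fromRows 1 0, ⟨fromCols 1 0, ?_⟩, ?_⟩
    · rw [fromCols_mul_fromRows]; simp
    · rw [fromBlocks_mul_fromRows, fromRows_mul]; simp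

lemma pow_le_finrank_KCF {ψ : AddChar F ℂ} (hψ : ψ ≠ 1) (hn : 2 * k + 1 ≤ n) :
    Fintype.card F ^ (k + 1) ≤
      Module.finrank ℂ (KCF (Fin n) ψ (k + 1)) + 2 * Fintype.card F ^ k := by
  have h1 := card_le_finrank_KCF hψ hn
  have hq : 1 ≤ Fintype.card F := Fintype.card_pos
  obtain ⟨a, ha⟩ : ∃ a, Fintype.card F = a + 1 := ⟨_, (Nat.sub_add_cancel hq).symm⟩
  rcases k with _ | k
  · have := Nat.mul_le_mul_left (Fintype.card F - 1) (card_unitCoeffs_zero (F := F))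
    simp only [pow_zero, zero_add, pow_one] at *
    omega
  · have h2 := card_unitCoeffs_succ (F := F) k
    rw [ha, Nat.add_sub_cancel] at h1
    rw [ha] at h2 ⊢
    have h3 := Nat.mul_le_mul_left a h2
    have h4 : (a + 1) ^ (k + 2) = a * (a + 1) ^ (k + 1) + (a + 1) ^ (k + 1) := by ring
    have h5 : a * (a + 1) ^ k ≤ (a + 1) ^ (k + 1) := by
      rw [pow_succ']
      exact Nat.mul_le_mul_right _ (Nat.le_succ a)
    change (a + 1) ^ (k + 2) ≤ _
    rw [mul_add] at h3
    omega

end LowerKCF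

section Asymptotics

lemma exists_finrank_KCF_le (n : ℕ) : ∃ C : ℕ, ∀ p, 2 * p ≤ n → ∀ (F : Type) [Field F] [Fintype F]
    (ψ : AddChar F ℂ), ψ ≠ 1 → Module.finrank ℂ (KCF (Fin n) ψ p) ≤
      if p = 0 then 0 else Fintype.card F ^ p + C * Fintype.card F ^ (p - 1) := by
  induction n using Nat.strong_induction_on with
  | _ n ih =>
  choose A hA using exists_finrank_CF_le
  choose! D hD using ih
  refine ⟨∑ j ∈ Finset.range n, (1 + A j + D j), fun p hp F _ _ ψ hψ => ?_⟩
  have h0 := finrank_KCF_le hψ n p hp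
  rcases Nat.eq_zero_or_pos p with rfl | hp1
  · simpa using h0
  rw [if_neg hp1.ne']
  set q := Fintype.card F with hq
  have hq1 : 1 ≤ q := Fintype.card_pos
  have hmono : ∀ {a b : ℕ}, a ≤ b → q ^ a ≤ q ^ b := fun h => Nat.pow_le_pow_right hq1 h
  refine h0.trans ((Nat.mul_le_mul_right _ (Nat.sub_le q 1)).trans ?_)
  rw [Finset.mul_sum]
  have hterm : ∀ j ∈ Finset.range (2 * p - 1),
      q * (if j < p then Module.finrank ℂ (CF (Fin j) F) else
        Module.finrank ℂ (KCF (Fin j) ψ (p - min (n - j) p))) ≤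
      (if j = p - 1 then q ^ p else 0) + (1 + A j + D j) * q ^ (p - 1) := by
    intro j hj
    rw [Finset.mem_range] at hj
    have hstep : ∀ {t a c : ℕ}, t ≤ c * q ^ a → a + 2 ≤ p → q * t ≤ c * q ^ (p - 1) := by
      intro t a c ht ha
      calc q * t ≤ q * (c * q ^ a) := Nat.mul_le_mul_left _ ht
        _ = c * q ^ (a + 1) := by ring
        _ ≤ _ := Nat.mul_le_mul_left _ (hmono (by omega))
    by_cases hjp : j < p
    · rw [if_pos hjp]
      by_cases hj0 : j = 0
      · have h1 := (hA j F).1 hj0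
        subst hj0
        split_ifs with hp2
        · obtain rfl : p = 1 := by omega
          calc q * _ ≤ q * 1 := Nat.mul_le_mul_left _ h1
            _ ≤ _ := by rw [pow_one, mul_one]; exact Nat.le_add_right _ _
        · rw [zero_add]
          refine (hstep (a := 0) (c := 1) (by simpa using h1) (by omega)).trans
            (Nat.mul_le_mul_right _ (by omega))
      · have h1 := (hA j F).2 (by omega)
        rw [← hq] at h1
        split_ifs with hjp1
        · subst hjp1
          obtain ⟨r, rfl⟩ : ∃ r, p = r + 2 := ⟨p - 2, by omega⟩
          simp only [Nat.add_sub_cancel, show r + 2 - 1 = r + 1 from rfl] at h1 ⊢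
          calc q * _ ≤ q * (q ^ (r + 1) + A (r + 1) * q ^ r) := Nat.mul_le_mul_left _ h1
            _ = q ^ (r + 2) + A (r + 1) * q ^ (r + 1) := by ring
            _ ≤ _ := Nat.add_le_add_left (Nat.mul_le_mul_right _ (by omega)) _
        · rw [zero_add]
          refine (hstep (a := j) (c := 1 + A j) ?_ (by omega)).trans
            (Nat.mul_le_mul_right _ (by omega))
          refine h1.trans ?_
          rw [add_mul, one_mul]
          exact Nat.add_le_add_left (Nat.mul_le_mul_left _ (hmono (by omega))) _
    · rw [if_neg hjp, if_neg (by omega), zero_add]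
      have h1 := hD j (by omega) (p - min (n - j) p) (by omega) F ψ hψ
      rw [← hq] at h1
      refine (hstep (a := p - min (n - j) p) (c := 1 + D j) ?_ (by omega)).trans
        (Nat.mul_le_mul_right _ (by omega))
      refine h1.trans ?_
      split_ifs
      · exact Nat.zero_le _
      · rw [add_mul, one_mul]
        exact Nat.add_le_add_left (Nat.mul_le_mul_left _ (hmono (by omega))) _
  refine (Finset.sum_le_sum hterm).trans ?_
  rw [Finset.sum_add_distrib, ← Finset.sum_mul, Finset.sum_ite_eq' (Finset.range (2 * p - 1)),
    if_pos (Finset.mem_range.mpr (by omega))]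
  refine Nat.add_le_add_left (Nat.mul_le_mul_right _ ?_) _
  exact Finset.sum_le_sum_of_subset (Finset.range_subset_range.mpr (by omega))

lemma exists_finrank_KCF_le_mul (n : ℕ) : ∃ C : ℕ, ∀ p, 2 * p ≤ n → ∀ (F : Type) [Field F]
    [Fintype F] (ψ : AddChar F ℂ), ψ ≠ 1 →
      Module.finrank ℂ (KCF (Fin n) ψ p) ≤ C * Fintype.card F ^ p := by
  obtain ⟨C, hC⟩ := exists_finrank_KCF_le n
  refine ⟨1 + C, fun p hp F _ _ ψ hψ => (hC p hp F ψ hψ).trans ?_⟩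
  split_ifs
  · exact Nat.zero_le _
  · rw [add_mul, one_mul]
    exact Nat.add_le_add_left
      (Nat.mul_le_mul_left _ (Nat.pow_le_pow_right Fintype.card_pos (Nat.sub_le _ _))) _

lemma abs_div_pow_sub_one_lt {N q c K : ℕ} {ε : ℝ} (hε : 0 < ε) (hq : 0 < q) (hc : (c : ℝ) / ε < q)
    (h1 : N ≤ q ^ (K + 1) + c * q ^ K) (h2 : q ^ (K + 1) ≤ N + c * q ^ K) :
    |(N : ℝ) / (q : ℝ) ^ (K + 1) - 1| < ε := by
  have hq' : (0 : ℝ) < q := by exact_mod_cast hq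
  have hqK : (0 : ℝ) < (q : ℝ) ^ K := pow_pos hq' K
  have h1' : (N : ℝ) ≤ (q : ℝ) ^ (K + 1) + c * (q : ℝ) ^ K := by exact_mod_cast h1
  have h2' : (q : ℝ) ^ (K + 1) ≤ (N : ℝ) + c * (q : ℝ) ^ K := by exact_mod_cast h2
  rw [div_lt_iff₀ hε] at hc
  have h3 : (c : ℝ) * (q : ℝ) ^ K < ε * (q : ℝ) ^ (K + 1) := by
    rw [pow_succ']
    nlinarith
  have h4 : (N : ℝ) / (q : ℝ) ^ (K + 1) - 1 = (N - (q : ℝ) ^ (K + 1)) / (q : ℝ) ^ (K + 1) := by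
    field_simp
  rw [h4, abs_div, abs_of_pos (pow_pos hq' (K + 1)), div_lt_iff₀ (pow_pos hq' (K + 1)), abs_lt]
  constructor <;> linarith

lemma exists_threshold {G : (F : Type) → [Field F] → [Fintype F] → AddChar F ℂ → ℕ} {K c : ℕ}
    (h : ∀ (F : Type) [Field F] [Fintype F] (ψ : AddChar F ℂ), ψ ≠ 1 →
      G F ψ ≤ Fintype.card F ^ (K + 1) + c * Fintype.card F ^ K ∧
      Fintype.card F ^ (K + 1) ≤ G F ψ + c * Fintype.card F ^ K) (ε : ℝ) (hε : 0 < ε) :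
    ∃ Q : ℕ, ∀ (F : Type) [Field F] [Fintype F], Q ≤ Fintype.card F → ∀ (ψ : AddChar F ℂ), ψ ≠ 1 →
      |(G F ψ : ℝ) / (Fintype.card F : ℝ) ^ (K + 1) - 1| < ε := by
  obtain ⟨Q, hQ⟩ := exists_nat_gt ((c : ℝ) / ε)
  refine ⟨Q, fun F _ _ hF ψ hψ => ?_⟩
  exact abs_div_pow_sub_one_lt hε Fintype.card_pos
    (hQ.trans_le (by exact_mod_cast hF)) (h F ψ hψ).1 (h F ψ hψ).2

lemma exists_URankIsoClasses_bound_of_lt (n k : ℕ) (hk : k < n / 2) : ∃ c : ℕ,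
    ∀ (F : Type) [Field F] [Fintype F] (ψ : AddChar F ℂ), ψ ≠ 1 →
      URankIsoClasses n F ψ k ≤ Fintype.card F ^ (k + 1) + c * Fintype.card F ^ k ∧
      Fintype.card F ^ (k + 1) ≤ URankIsoClasses n F ψ k + c * Fintype.card F ^ k := by
  obtain ⟨C, hC⟩ := exists_finrank_KCF_le n
  obtain ⟨C', hC'⟩ := exists_finrank_KCF_le_mul n
  refine ⟨C + (C' + 2), fun F _ _ ψ hψ => ?_⟩
  have h1 := (URankIsoClasses_eq hψ (n := n) hk.le).1 hk
  have h2 := hC (k + 1) (by omega) F ψ hψ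
  have h3 := hC' k (by omega) F ψ hψ
  have h4 := pow_le_finrank_KCF (n := n) (k := k) hψ (by omega)
  rw [if_neg (Nat.succ_ne_zero k), Nat.add_sub_cancel] at h2
  rw [add_mul, add_mul]
  constructor <;> omega

lemma exists_URankIsoClasses_bound_of_eq (n : ℕ) : ∃ c : ℕ,
    ∀ (F : Type) [Field F] [Fintype F] (ψ : AddChar F ℂ), ψ ≠ 1 →
      URankIsoClasses (n + 1) F ψ ((n + 1) / 2) ≤ Fintype.card F ^ (n + 1) + c * Fintype.card F ^ n ∧
      Fintype.card F ^ (n + 1) ≤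
        URankIsoClasses (n + 1) F ψ ((n + 1) / 2) + c * Fintype.card F ^ n := by
  obtain ⟨C, hC⟩ := exists_finrank_CF_le (n + 1)
  obtain ⟨C', hC'⟩ := exists_finrank_KCF_le_mul (n + 1)
  refine ⟨C + (C' + 1), fun F _ _ ψ hψ => ?_⟩
  have h1 := (URankIsoClasses_eq hψ (n := n + 1) le_rfl).2 rfl
  have h2 := (hC F).2 (Nat.succ_pos n)
  have h3 := (hC' ((n + 1) / 2) (by omega) F ψ hψ).trans
    (Nat.mul_le_mul_left C' (Nat.pow_le_pow_right Fintype.card_pos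
      (show (n + 1) / 2 ≤ n + 1 - 1 by omega)))
  have h4 := pow_le_finrank_CF (F := F) n
  rw [Nat.add_sub_cancel] at h2 h3
  rw [add_mul, add_mul, one_mul]
  constructor <;> omega

end Asymptotics

end URank

/-- fix `n ≥ 2`.  For fixed `0 ≤ k < ⌊n/2⌋`, `N_{U,k}(q)/q^{k+1} → 1` as
`q → ∞` over prime powers, and for `k = ⌊n/2⌋`, `N_{U,k}(q)/q^n → 1` as `q → ∞`. -/
theorem card_URank_irreps (n : ℕ) (hn : 2 ≤ n) (k : ℕ) (hk : k ≤ n / 2) :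
    (k < n / 2 →
      ∀ ε : ℝ, 0 < ε → ∃ Q : ℕ,
        ∀ (F : Type) [Field F] [Fintype F], Q ≤ Fintype.card F →
          ∀ (ψ : AddChar F ℂ), ψ ≠ 1 →
            |(URankIsoClasses n F ψ k : ℝ) / (Fintype.card F : ℝ) ^ (k + 1) - 1| < ε)
    ∧ (k = n / 2 →
      ∀ ε : ℝ, 0 < ε → ∃ Q : ℕ,
        ∀ (F : Type) [Field F] [Fintype F], Q ≤ Fintype.card F →
          ∀ (ψ : AddChar F ℂ), ψ ≠ 1 →
            |(URankIsoClasses n F ψ k : ℝ) / (Fintype.card F : ℝ) ^ n - 1| < ε) := by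
  refine ⟨fun hk' ε hε => ?_, fun hk' ε hε => ?_⟩
  · obtain ⟨c, hc⟩ := URank.exists_URankIsoClasses_bound_of_lt n k hk'
    exact URank.exists_threshold (G := fun F _ _ ψ => URankIsoClasses n F ψ k) hc ε hε
  · obtain ⟨n, rfl⟩ : ∃ r, n = r + 1 := ⟨n - 1, by omega⟩
    subst hk'
    obtain ⟨c, hc⟩ := URank.exists_URankIsoClasses_bound_of_eq n
    exact URank.exists_threshold (G := fun F _ _ ψ => URankIsoClasses (n + 1) F ψ ((n + 1) / 2))
      hc ε hε
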